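/- There exists a closed infinite-dimensional linear subspace X of the quotient Banach space ℓ∞/c₀ such that X is isometrically isomorphic to C(K) for some compact Hausdorff space K, and every injective bounded linear operator T : X → X is surjective. -/

import Mathlib

open Filter

noncomputable instance : Fact ((1 : ENNReal) ≤ ⊤) := ⟨le_top⟩

/-- The Banach space `ℓ∞` of bounded real sequences with the supremum norm. -/
noncomputable abbrev ellInfty : Type := lp (fun _ : ℕ => ℝ) ⊤

/-- The closed subspace `c₀` of `ℓ∞` consisting of the sequences converging to `0`. -/
noncomputable def cZero : Submodule ℝ ellInfty where
  carrier := {x | Tendsto (fun n => x n) atTop (nhds 0)}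
  add_mem' := by
    intro a b ha hb
    simpa [lp.coeFn_add, Pi.add_apply] using ha.add hb
  zero_mem' := by simp only [lp.coeFn_zero] at *; exact (tendsto_const_nhds : Tendsto (fun _ : ℕ => (0:ℝ)) atTop (nhds 0))
  smul_mem' := by
    intro c x hx
    have : Tendsto (fun n => c * x n) atTop (nhds (c * 0)) := hx.const_mul c
    simpa [lp.coeFn_smul, Pi.smul_apply, smul_eq_mul] using this


set_option linter.unusedSectionVars false
namespace FK
open TopologicalSpace Topology
section Pre
variable {K : Type} [TopologicalSpace K]

noncomputable def ind (c : Clopens K) : C(K, ℝ) :=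
  ⟨Set.indicator (c : Set K) (fun _ => 1), c.isClopen.continuous_indicator continuous_const⟩

lemma ind_of_mem {c : Clopens K} {x : K} (h : x ∈ c) : ind c x = 1 :=
  Set.indicator_of_mem (s := (c : Set K)) h (fun _ => (1 : ℝ))

lemma ind_of_not {c : Clopens K} {x : K} (h : x ∉ c) : ind c x = 0 :=
  Set.indicator_of_notMem (s := (c : Set K)) h (fun _ => (1 : ℝ))

lemma mem_sup {a b : Clopens K} {x : K} : x ∈ a ⊔ b ↔ x ∈ a ∨ x ∈ b := Iff.rfl
lemma mem_inf {a b : Clopens K} {x : K} : x ∈ a ⊓ b ↔ x ∈ a ∧ x ∈ b := Iff.rfl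
lemma mem_sdiff {a b : Clopens K} {x : K} : x ∈ a \ b ↔ x ∈ a ∧ x ∉ b := Iff.rfl
lemma mem_compl {a : Clopens K} {x : K} : x ∈ aᶜ ↔ x ∉ a := Iff.rfl
lemma mem_bot {x : K} : x ∈ (⊥ : Clopens K) ↔ False := Iff.rfl
lemma mem_top {x : K} : x ∈ (⊤ : Clopens K) ↔ True := Iff.rfl

lemma mem_fsup {ι : Type*} {s : Finset ι} {c : ι → Clopens K} {x : K} :
    x ∈ s.sup c ↔ ∃ i ∈ s, x ∈ c i := by
  classical
  induction s using Finset.induction_on with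
  | empty => simp [mem_bot]
  | insert i s hi ih => simp [Finset.sup_insert, mem_sup, ih]

lemma ne_bot_iff {a : Clopens K} : a ≠ ⊥ ↔ ∃ x, x ∈ a := by
  constructor
  · intro h
    by_contra hh
    push Not at hh
    apply h
    ext x
    exact ⟨fun h => (hh x h).elim, fun h => h.elim⟩
  · rintro ⟨x, hx⟩ rfl
    exact hx

lemma disj_iff {a b : Clopens K} : Disjoint a b ↔ ∀ x, x ∈ a → x ∉ b := by
  rw [← Clopens.coe_disjoint, Set.disjoint_left]; rfl

lemma le_iff {a b : Clopens K} : a ≤ b ↔ ∀ x, x ∈ a → x ∈ b := Iff.rfl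

lemma ind_inf (a b : Clopens K) : ind (a ⊓ b) = ind a * ind b := by
  ext x
  by_cases ha : x ∈ a <;> by_cases hb : x ∈ b <;>
    simp [ind_of_mem, ind_of_not, ha, hb, mem_inf]

lemma ind_sup {a b : Clopens K} (h : Disjoint a b) : ind (a ⊔ b) = ind a + ind b := by
  ext x
  have := disj_iff.1 h x
  by_cases ha : x ∈ a <;> by_cases hb : x ∈ b <;>
    simp_all [ind_of_mem, ind_of_not, mem_sup]

lemma ind_sdiff {a b : Clopens K} (h : a ≤ b) : ind (b \ a) = ind b - ind a := by
  ext x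
  have : x ∈ a → x ∈ b := fun hx => h hx
  by_cases ha : x ∈ a <;> by_cases hb : x ∈ b <;>
    simp_all [ind_of_mem, ind_of_not, mem_sdiff]

lemma ind_top : ind (⊤ : Clopens K) = 1 := by
  ext x; simp [ind_of_mem, mem_top]

lemma ind_bot : ind (⊥ : Clopens K) = 0 := by
  ext x; simp [ind_of_not, mem_bot]

lemma ind_fsup {ι : Type*} (s : Finset ι) (c : ι → Clopens K)
    (hd : (s : Set ι).PairwiseDisjoint c) : ind (s.sup c) = ∑ i ∈ s, ind (c i) := by
  classical
  induction s using Finset.induction_on with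
  | empty => simp [ind_bot]
  | insert i s hi ih =>
    rw [Finset.sup_insert, Finset.sum_insert hi, ind_sup, ih]
    · exact hd.subset (by simp)
    · rw [Finset.disjoint_sup_right]
      intro j hj
      exact hd (by simp) (by simp [hj]) (by rintro rfl; exact hi hj)

/-- value of a combination over a disjoint family -/
lemma sum_ind_apply {ι : Type*} (s : Finset ι) (c : ι → Clopens K)
    (hd : (s : Set ι).PairwiseDisjoint c) (g : ι → ℝ) {i : ι} (hi : i ∈ s) {x : K}
    (hx : x ∈ c i) : ∑ j ∈ s, g j * ind (c j) x = g i := by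
  rw [Finset.sum_eq_single i]
  · simp [ind_of_mem hx]
  · intro j hj hji
    rw [ind_of_not, mul_zero]
    exact disj_iff.1 (hd hi hj (Ne.symm hji)) x hx
  · exact fun h => (h hi).elim

lemma sum_ind_apply_zero {ι : Type*} (s : Finset ι) (c : ι → Clopens K)
    (g : ι → ℝ) {x : K}
    (hx : ∀ i ∈ s, x ∉ c i) : ∑ j ∈ s, g j * ind (c j) x = 0 :=
  Finset.sum_eq_zero fun j hj => by rw [ind_of_not (hx j hj), mul_zero]

variable [CompactSpace K]

lemma norm_ind_le (c : Clopens K) : ‖ind c‖ ≤ 1 := by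
  rw [ContinuousMap.norm_le _ zero_le_one]
  intro x
  by_cases h : x ∈ c
  · simp [ind_of_mem h]
  · simp [ind_of_not h]

lemma norm_comb_le {ι : Type*} (s : Finset ι) (c : ι → Clopens K)
    (hd : (s : Set ι).PairwiseDisjoint c) (g : ι → ℝ) {C : ℝ} (hC : 0 ≤ C)
    (hg : ∀ i ∈ s, |g i| ≤ C) : ‖∑ i ∈ s, g i • ind (c i)‖ ≤ C := by
  rw [ContinuousMap.norm_le _ hC]
  intro x
  simp only [ContinuousMap.coe_sum, ContinuousMap.coe_smul, Finset.sum_apply, Pi.smul_apply,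
    smul_eq_mul]
  by_cases h : ∃ i ∈ s, x ∈ c i
  · obtain ⟨i, hi, hx⟩ := h
    rw [sum_ind_apply s c hd g hi hx]
    exact hg i hi
  · push Not at h
    rw [sum_ind_apply_zero s c g h]
    simpa

lemma F1 (φ : C(K, ℝ) →L[ℝ] ℝ) {ι : Type*} (s : Finset ι) (c : ι → Clopens K)
    (hd : (s : Set ι).PairwiseDisjoint c) : ∑ i ∈ s, |φ (ind (c i))| ≤ ‖φ‖ := by
  have h1 : ∑ i ∈ s, |φ (ind (c i))| =
      φ (∑ i ∈ s, (SignType.sign (φ (ind (c i))) : ℝ) • ind (c i)) := by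
    rw [map_sum]
    refine Finset.sum_congr rfl fun i _ => ?_
    rw [map_smul, smul_eq_mul, sign_mul_self]
  rw [h1]
  refine (le_abs_self _).trans ((φ.le_opNorm _).trans ?_)
  refine (mul_le_mul_of_nonneg_left (norm_comb_le s c hd _ zero_le_one ?_) (norm_nonneg _)).trans
    (by simp)
  intro i _
  rcases lt_trichotomy (φ (ind (c i))) 0 with h | h | h <;> simp [h]

lemma sum_abs_le_two (φ : C(K, ℝ) →L[ℝ] ℝ) {ι : Type*} (s : Finset ι) (c : ι → Clopens K)
    (hd : (s : Set ι).PairwiseDisjoint c) {R : Clopens K} {ε : ℝ}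
    (hR : ∀ a ≤ R, |φ (ind a)| ≤ ε) (hc : ∀ i ∈ s, c i ≤ R) :
    ∑ i ∈ s, |φ (ind (c i))| ≤ 2 * ε := by
  classical
  have key : ∀ t ⊆ s, |∑ i ∈ t, φ (ind (c i))| ≤ ε := by
    intro t ht
    rw [← map_sum, ← ind_fsup t c (hd.subset (by exact_mod_cast ht))]
    exact hR _ (Finset.sup_le fun i hi => hc i (ht hi))
  rw [← Finset.sum_filter_add_sum_filter_not s (fun i => 0 ≤ φ (ind (c i)))]
  have h1 := key _ (Finset.filter_subset (fun i => 0 ≤ φ (ind (c i))) s)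
  have h2 := key _ (Finset.filter_subset (fun i => ¬ 0 ≤ φ (ind (c i))) s)
  have e1 : ∑ i ∈ s.filter (fun i => 0 ≤ φ (ind (c i))), |φ (ind (c i))| =
      ∑ i ∈ s.filter (fun i => 0 ≤ φ (ind (c i))), φ (ind (c i)) :=
    Finset.sum_congr rfl fun i hi => abs_of_nonneg (Finset.mem_filter.1 hi).2
  have e2 : ∑ i ∈ s.filter (fun i => ¬ 0 ≤ φ (ind (c i))), |φ (ind (c i))| =
      - ∑ i ∈ s.filter (fun i => ¬ 0 ≤ φ (ind (c i))), φ (ind (c i)) := by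
    rw [← Finset.sum_neg_distrib]
    exact Finset.sum_congr rfl fun i hi => abs_of_neg (not_le.1 (Finset.mem_filter.1 hi).2)
  rw [e1, e2]
  linarith [abs_le.1 h1, abs_le.1 h2]

variable [T2Space K] [TotallyDisconnectedSpace K]

lemma exists_clopen_nhd {x : K} {U : Set K} (hU : IsOpen U) (hx : x ∈ U) :
    ∃ c : Clopens K, x ∈ c ∧ (c : Set K) ⊆ U := by
  obtain ⟨V, hV, hxV, hVU⟩ := compact_exists_isClopen_in_isOpen hU hx
  exact ⟨⟨V, hV⟩, hxV, hVU⟩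

lemma exists_between {F U : Set K} (hF : IsClosed F) (hU : IsOpen U) (h : F ⊆ U) :
    ∃ c : Clopens K, F ⊆ c ∧ (c : Set K) ⊆ U := by
  classical
  have := hF.isCompact.elim_nhds_subcover' (fun x hx => ((exists_clopen_nhd hU (h hx)).choose : Set K))
    (fun x hx => (Clopens.isOpen _).mem_nhds (exists_clopen_nhd hU (h hx)).choose_spec.1)
  obtain ⟨t, ht⟩ := this
  refine ⟨t.sup fun x => (exists_clopen_nhd hU (h x.2)).choose, ?_, ?_⟩
  · intro x hx
    obtain ⟨i, hi, hx⟩ := Set.mem_iUnion₂.1 (ht hx)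
    exact mem_fsup.2 ⟨i, hi, hx⟩
  · intro x hx
    obtain ⟨i, hi, hx⟩ := mem_fsup.1 hx
    exact (exists_clopen_nhd hU (h i.2)).choose_spec.2 hx

lemma disjointify {P : Clopens K → Prop} (hP : ∀ a b, P a → b ≤ a → P b)
    (t : Finset (Clopens K)) (ht : ∀ a ∈ t, P a) :
    ∃ s : Finset (Clopens K), (∀ c ∈ s, c ≠ ⊥ ∧ P c) ∧ (s : Set (Clopens K)).PairwiseDisjoint id ∧
      s.sup id = t.sup id := by
  classical
  induction t using Finset.induction_on with
  | empty => exact ⟨∅, by simp, by simp, rfl⟩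
  | insert a t ha ih =>
    obtain ⟨s, h1, h2, h3⟩ := ih fun b hb => ht b (Finset.mem_insert_of_mem hb)
    by_cases hb : a \ s.sup id = ⊥
    · refine ⟨s, h1, h2, ?_⟩
      rw [Finset.sup_insert, ← h3]
      exact (sup_eq_right.2 (sdiff_eq_bot_iff.1 hb)).symm
    · refine ⟨insert (a \ s.sup id) s, ?_, ?_, ?_⟩
      · intro c hc
        rcases Finset.mem_insert.1 hc with rfl | hc
        · exact ⟨hb, hP a _ (ht a (Finset.mem_insert_self _ _)) sdiff_le⟩
        · exact h1 c hc
      · rw [Finset.coe_insert]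
        apply h2.insert
        intro j hj _
        exact disjoint_sdiff_self_left.mono_right (Finset.le_sup (f := id) hj)
      · rw [Finset.sup_insert, Finset.sup_insert, ← h3]
        simp

lemma cover {P : Clopens K → Prop} (hP : ∀ a b, P a → b ≤ a → P b)
    (h : ∀ x : K, ∃ c, x ∈ c ∧ P c) :
    ∃ s : Finset (Clopens K), (∀ c ∈ s, c ≠ ⊥ ∧ P c) ∧ (s : Set (Clopens K)).PairwiseDisjoint id ∧
      ∀ x : K, ∃ c ∈ s, x ∈ c := by
  classical
  choose c hc hPc using h
  obtain ⟨t, -, ht⟩ := (isCompact_univ (X := K)).elim_nhds_subcover (fun x => (c x : Set K))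
    (fun x _ => (Clopens.isOpen _).mem_nhds (hc x))
  obtain ⟨s, h1, h2, h3⟩ := disjointify hP (t.image c) (by
    intro a ha
    obtain ⟨x, _, rfl⟩ := Finset.mem_image.1 ha
    exact hPc x)
  refine ⟨s, h1, h2, fun x => ?_⟩
  obtain ⟨i, hi, hx⟩ := Set.mem_iUnion₂.1 (ht (Set.mem_univ x))
  have : x ∈ s.sup id := by
    rw [h3]
    exact mem_fsup.2 ⟨c i, Finset.mem_image_of_mem _ hi, hx⟩
  exact mem_fsup.1 this

lemma simple_approx (f : C(K, ℝ)) {θ : ℝ} (hθ : 0 < θ) :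
    ∃ (s : Finset (Clopens K)) (t : Clopens K → ℝ), (s : Set (Clopens K)).PairwiseDisjoint id ∧
      (∀ c ∈ s, |t c| ≤ ‖f‖) ∧ ‖f - ∑ c ∈ s, t c • ind c‖ ≤ θ := by
  obtain ⟨s, h1, h2, h3⟩ := cover (K := K) (P := fun c => ∀ x ∈ c, ∀ y ∈ c, |f x - f y| ≤ θ)
    (fun a b ha hb x hx y hy => ha x (hb hx) y (hb hy)) (by
      intro x
      obtain ⟨c, hc, hcU⟩ := exists_clopen_nhd (x := x) (U := {y | |f y - f x| < θ / 2})
        (isOpen_lt (by fun_prop) continuous_const) (by simp; positivity)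
      refine ⟨c, hc, fun y hy z hz => ?_⟩
      have a1 : |f y - f x| < θ / 2 := hcU hy
      have a2 : |f z - f x| < θ / 2 := hcU hz
      rw [abs_le]
      constructor <;> linarith [abs_lt.1 a1, abs_lt.1 a2])
  have hne : ∀ c : Clopens K, c ∈ s → ∃ x, x ∈ c := fun c hc => ne_bot_iff.1 (h1 c hc).1
  choose p hp using hne
  classical
  refine ⟨s, fun c => if h : c ∈ s then f (p c h) else 0, h2, ?_, ?_⟩
  · intro c hc
    simp only [hc, dite_true]
    exact f.norm_coe_le_norm _
  · rw [ContinuousMap.norm_le _ hθ.le]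
    intro x
    obtain ⟨c, hc, hx⟩ := h3 x
    simp only [ContinuousMap.coe_sub, ContinuousMap.coe_sum, ContinuousMap.coe_smul,
      Finset.sum_apply, Pi.smul_apply, smul_eq_mul, Pi.sub_apply]
    have := sum_ind_apply s id h2 (fun c => if h : c ∈ s then f (p c h) else 0) hc hx
    simp only [id] at this
    rw [this]
    simp only [hc, dite_true]
    exact (h1 c hc).2 x hx _ (hp c hc)

/-- Lemma SM -/
lemma SM (φ : C(K, ℝ) →L[ℝ] ℝ) {R : Clopens K} {ε : ℝ}
    (hR : ∀ a ≤ R, |φ (ind a)| ≤ ε) (f : C(K, ℝ)) : |φ (f * ind R)| ≤ 2 * ε * ‖f‖ := by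
  have hε : 0 ≤ ε := (abs_nonneg _).trans (hR R le_rfl)
  apply le_of_forall_pos_le_add
  intro κ hκ
  have hθ : 0 < κ / (‖φ‖ + 1) := by positivity
  obtain ⟨s, t, h1, h2, h3⟩ := simple_approx f hθ
  have e : φ (f * ind R) = φ ((f - ∑ c ∈ s, t c • ind c) * ind R) +
      ∑ c ∈ s, t c * φ (ind (c ⊓ R)) := by
    simp only [sub_mul, map_sub, Finset.sum_mul, smul_mul_assoc, ← ind_inf, map_sum, map_smul,
      smul_eq_mul]
    ring
  have b1 : |φ ((f - ∑ c ∈ s, t c • ind c) * ind R)| ≤ κ := by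
    refine (φ.le_opNorm _).trans ?_
    have : ‖(f - ∑ c ∈ s, t c • ind c) * ind R‖ ≤ κ / (‖φ‖ + 1) :=
      (norm_mul_le _ _).trans (by
        calc _ ≤ κ / (‖φ‖ + 1) * 1 := mul_le_mul h3 (norm_ind_le R) (norm_nonneg _) hθ.le
          _ = _ := mul_one _)
    calc ‖φ‖ * _ ≤ (‖φ‖ + 1) * (κ / (‖φ‖ + 1)) :=
          mul_le_mul (by linarith) this (norm_nonneg _) (by positivity)
      _ = κ := by field_simp
  have b2 : |∑ c ∈ s, t c * φ (ind (c ⊓ R))| ≤ 2 * ε * ‖f‖ := by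
    have hd : (s : Set (Clopens K)).PairwiseDisjoint (fun c => c ⊓ R) := by
      intro a ha b hb hab
      exact (h1 ha hb hab).mono inf_le_left inf_le_left
    have := sum_abs_le_two φ s _ hd hR (fun i _ => inf_le_right)
    calc _ ≤ ∑ c ∈ s, |t c * φ (ind (c ⊓ R))| := Finset.abs_sum_le_sum_abs _ _
      _ ≤ ∑ c ∈ s, ‖f‖ * |φ (ind (c ⊓ R))| := Finset.sum_le_sum fun c hc => by
          rw [abs_mul]
          exact mul_le_mul_of_nonneg_right (h2 c hc) (abs_nonneg _)
      _ = ‖f‖ * ∑ c ∈ s, |φ (ind (c ⊓ R))| := by rw [Finset.mul_sum]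
      _ ≤ ‖f‖ * (2 * ε) := mul_le_mul_of_nonneg_left this (norm_nonneg _)
      _ = _ := by ring
  rw [e]
  exact (abs_add_le _ _).trans (by linarith)

end Pre

/-- evaluation functional composed with an operator -/
noncomputable def evT {K : Type} [TopologicalSpace K] [CompactSpace K]
    (T : C(K, ℝ) →L[ℝ] C(K, ℝ)) (y : K) : C(K, ℝ) →L[ℝ] ℝ :=
  (ContinuousMap.evalCLM ℝ y).comp T

lemma evT_apply {K : Type} [TopologicalSpace K] [CompactSpace K]
    (T : C(K, ℝ) →L[ℝ] C(K, ℝ)) (y : K) (f : C(K, ℝ)) : evT T y f = T f y := rfl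

lemma norm_evT_le {K : Type} [TopologicalSpace K] [CompactSpace K]
    (T : C(K, ℝ) →L[ℝ] C(K, ℝ)) (y : K) : ‖evT T y‖ ≤ ‖T‖ := by
  refine ContinuousLinearMap.opNorm_le_bound _ T.opNorm_nonneg fun f => ?_
  exact ((T f).norm_coe_le_norm y).trans (T.le_opNorm f)
end FK


set_option linter.unusedSectionVars false
namespace FK
open TopologicalSpace Topology
section RieszAbs
variable {Y : Type*} [NormedAddCommGroup Y] [NormedSpace ℝ Y] [CompleteSpace Y]

lemma riesz_bdd_below (V : Y →L[ℝ] Y)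
    (hc : ∀ u : ℕ → Y, (∃ C, ∀ n, ‖u n‖ ≤ C) → ∃ φ : ℕ → ℕ, StrictMono φ ∧
      CauchySeq (fun n => V (V (u (φ n)))))
    (hinj : ∀ u, u + V u = 0 → u = 0) : ∃ c > 0, ∀ u, c * ‖u‖ ≤ ‖u + V u‖ := by
  by_contra hcon
  push Not at hcon
  have h1 : ∀ n : ℕ, ∃ u : Y, ‖u‖ = 1 ∧ ‖u + V u‖ ≤ 1 / ((n : ℝ) + 1) := by
    intro n
    obtain ⟨u, hu⟩ := hcon (1 / ((n : ℝ) + 1)) (by positivity)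
    have hu0 : u ≠ 0 := by
      rintro rfl
      simp at hu
    have hn : 0 < ‖u‖ := norm_pos_iff.2 hu0
    refine ⟨‖u‖⁻¹ • u, ?_, ?_⟩
    · rw [norm_smul, norm_inv, norm_norm, inv_mul_cancel₀ hn.ne']
    · rw [map_smul, ← smul_add, norm_smul, norm_inv, norm_norm, inv_mul_le_iff₀ hn, mul_comm]
      exact hu.le
  choose u hu1 hu2 using h1
  obtain ⟨φ, hφ, hC⟩ := hc u ⟨1, fun n => (hu1 n).le⟩
  obtain ⟨w, hw⟩ := cauchySeq_tendsto_of_complete hC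
  have hr : Tendsto (fun n => u (φ n) + V (u (φ n))) atTop (𝓝 0) := by
    have : Tendsto (fun n => u n + V (u n)) atTop (𝓝 0) :=
      squeeze_zero_norm hu2 tendsto_one_div_add_atTop_nhds_zero_nat
    exact this.comp hφ.tendsto_atTop
  have hlim : Tendsto (fun n => u (φ n)) atTop (𝓝 w) := by
    have h3 : Tendsto (fun n => V (V (u (φ n))) + ((u (φ n) + V (u (φ n))) -
        V (u (φ n) + V (u (φ n))))) atTop (𝓝 (w + (0 - V 0))) :=
      hw.add (hr.sub ((V.continuous.tendsto 0).comp hr))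
    rw [map_zero, sub_zero, add_zero] at h3
    refine h3.congr fun n => ?_
    rw [map_add]; abel
  have hw1 : ‖w‖ = 1 := by
    have := hlim.norm
    simp only [hu1] at this
    exact (tendsto_nhds_unique this tendsto_const_nhds)
  have hw0 : w + V w = 0 :=
    tendsto_nhds_unique (hlim.add ((V.continuous.tendsto w).comp hlim)) hr
  rw [hinj w hw0] at hw1
  simp at hw1

lemma riesz_surj (V : Y →L[ℝ] Y)
    (hc : ∀ u : ℕ → Y, (∃ C, ∀ n, ‖u n‖ ≤ C) → ∃ φ : ℕ → ℕ, StrictMono φ ∧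
      CauchySeq (fun n => V (V (u (φ n)))))
    (hinj : ∀ u, u + V u = 0 → u = 0) : ∀ w, ∃ u, u + V u = w := by
  obtain ⟨c, hc0, hcb⟩ := riesz_bdd_below V hc hinj
  by_contra hcon
  push Not at hcon
  obtain ⟨w, hw⟩ := hcon
  set R : Y →L[ℝ] Y := 1 + V with hR
  have hRa : ∀ u, R u = u + V u := fun u => rfl
  have hpow : ∀ n : ℕ, ∀ u, c ^ n * ‖u‖ ≤ ‖(R ^ n) u‖ := by
    intro n
    induction n with
    | zero => intro u; simp
    | succ n ih =>
      intro u
      have h1 := ih (R u)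
      have h2 := hcb u
      rw [pow_succ R, mul_apply_eq_comp]
      calc c ^ (n + 1) * ‖u‖ = c ^ n * (c * ‖u‖) := by ring
        _ ≤ c ^ n * ‖R u‖ := mul_le_mul_of_nonneg_left h2 (by positivity)
        _ ≤ _ := h1
  have hinjp : ∀ n : ℕ, Function.Injective (R ^ n : Y →L[ℝ] Y) := by
    intro n
    rw [injective_iff_map_eq_zero]
    intro u hu
    have := hpow n u
    rw [hu, norm_zero] at this
    have h4 : 0 < c ^ n := by positivity
    have : ‖u‖ ≤ 0 := by
      by_contra h
      push Not at h
      nlinarith [mul_pos h4 h]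
    exact norm_le_zero_iff.1 this
  set M : ℕ → Submodule ℝ Y := fun n => LinearMap.range ((R ^ n : Y →L[ℝ] Y) : Y →ₗ[ℝ] Y) with hM
  have hclosed : ∀ n, IsClosed (M n : Set Y) := by
    intro n
    have ha : AntilipschitzWith (Real.toNNReal (c ^ n)⁻¹) (R ^ n : Y →L[ℝ] Y) := by
      apply AddMonoidHomClass.antilipschitz_of_bound
      intro x
      have h4 : 0 < c ^ n := by positivity
      rw [Real.coe_toNNReal _ (by positivity)]
      have := hpow n x
      rw [inv_mul_eq_div, le_div_iff₀ h4]
      linarith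
    have := ha.isClosed_range (R ^ n : Y →L[ℝ] Y).uniformContinuous
    exact this
  have hmono : ∀ m n, m ≤ n → M n ≤ M m := by
    rintro m n hmn x ⟨y, rfl⟩
    obtain ⟨k, rfl⟩ := Nat.exists_eq_add_of_le hmn
    refine ⟨(R ^ k) y, ?_⟩
    change (R ^ m) ((R ^ k) y) = (R ^ (m + k)) y
    rw [pow_add]; rfl
  have hRM : ∀ n x, x ∈ M n → R x ∈ M (n + 1) := by
    rintro n x ⟨y, rfl⟩
    refine ⟨y, ?_⟩
    change (R ^ (n + 1)) y = R ((R ^ n) y)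
    rw [pow_succ']; rfl
  have hex : ∀ n, ∃ u ∈ M n, ‖u‖ = 1 ∧ ∀ y ∈ M (n + 1), 1 / 2 ≤ ‖u - y‖ := by
    intro n
    have h := riesz_lemma (𝕜 := ℝ) (E := M n) (F := (M (n + 1)).comap (M n).subtype)
      ((hclosed (n + 1)).preimage continuous_subtype_val) (by
        refine ⟨⟨(R ^ n) w, ⟨w, rfl⟩⟩, ?_⟩
        rintro ⟨y, hy⟩
        rw [pow_succ] at hy
        exact hw y (hinjp n hy)) (r := 1 / 2) (by norm_num)
    obtain ⟨x₀, hx0, hx⟩ := h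
    have hne : (x₀ : Y) ≠ 0 := by
      intro h0
      apply hx0
      rw [Submodule.mem_comap]
      simp only [Submodule.subtype_apply, h0]
      exact Submodule.zero_mem _
    have hn : 0 < ‖(x₀ : Y)‖ := norm_pos_iff.2 hne
    refine ⟨‖(x₀ : Y)‖⁻¹ • (x₀ : Y), (M n).smul_mem _ x₀.2, ?_, ?_⟩
    · rw [norm_smul, norm_inv, norm_norm, inv_mul_cancel₀ hn.ne']
    · intro y hy
      have h5 := hx ⟨‖(x₀ : Y)‖ • y, hmono n (n + 1) (Nat.le_succ n)
        (Submodule.smul_mem _ _ hy)⟩ (Submodule.smul_mem _ _ hy)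
      have h6 : ‖(x₀ : Y)‖⁻¹ • (x₀ : Y) - y = ‖(x₀ : Y)‖⁻¹ • ((x₀ : Y) - ‖(x₀ : Y)‖ • y) := by
        rw [smul_sub, smul_smul, inv_mul_cancel₀ hn.ne', one_smul]
      rw [h6, norm_smul, norm_inv, norm_norm, inv_mul_eq_div, le_div_iff₀ hn]
      exact h5
  choose u huM hu1 hud using hex
  obtain ⟨φ, hφ, hC⟩ := hc u ⟨1, fun n => (hu1 n).le⟩
  obtain ⟨N, hN⟩ := Metric.cauchySeq_iff.1 hC (1 / 2) (by norm_num)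
  have h7 := hN N le_rfl (N + 1) (Nat.le_succ N)
  set n := φ N
  set m := φ (N + 1)
  have hnm : n + 1 ≤ m := hφ (Nat.lt_succ_self N)
  have hVV : ∀ x, V (V x) = x - (R x + R x - R (R x)) := by
    intro x
    simp only [hRa, map_add]; abel
  have h8 : V (V (u m)) ∈ M (n + 1) := by
    rw [hVV]
    have a1 := huM m
    have a2 := hmono _ _ (Nat.le_succ m) (hRM _ _ a1)
    have a3 := hmono _ _ (Nat.le_succ m) (hRM _ _ a2)
    exact hmono _ _ hnm (Submodule.sub_mem _ a1 (Submodule.sub_mem _ (Submodule.add_mem _ a2 a2) a3))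
  have h9 : R (u n) + R (u n) - R (R (u n)) ∈ M (n + 1) := by
    have a2 := hRM _ _ (huM n)
    exact Submodule.sub_mem _ (Submodule.add_mem _ a2 a2) (hmono _ _ (Nat.le_succ _) (hRM _ _ a2))
  have h10 := hud n _ (Submodule.add_mem _ h9 h8)
  rw [dist_eq_norm, hVV (u n)] at h7
  rw [sub_add_eq_sub_sub] at h10
  linarith
end RieszAbs
end FK


set_option linter.unusedSectionVars false
namespace FK
open TopologicalSpace Topology
section P5b
variable {K : Type} [TopologicalSpace K] [CompactSpace K]

lemma exists_mem_all (C : ℕ → Clopens K) (hC : Antitone C) (hne : ∀ n, C n ≠ ⊥) :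
    ∃ x, ∀ n, x ∈ C n := by
  have := IsCompact.nonempty_iInter_of_sequence_nonempty_isCompact_isClosed
    (fun n => (C n : Set K)) (fun n => hC (Nat.le_succ n)) (fun n => ne_bot_iff.1 (hne n))
    (C 0).isClosed.isCompact (fun n => (C n).isClosed)
  obtain ⟨x, hx⟩ := this
  exact ⟨x, fun n => Set.mem_iInter.1 hx n⟩

def Sm (V : C(K, ℝ) →L[ℝ] C(K, ℝ)) (a : Clopens K) (ε : ℝ) : Prop :=
  ∀ c ≤ a, ‖V (ind c)‖ ≤ ε

lemma Sm.mono {V : C(K, ℝ) →L[ℝ] C(K, ℝ)} {a b : Clopens K} {ε : ℝ} (h : Sm V a ε) (hb : b ≤ a) :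
    Sm V b ε := fun c hc => h c (hc.trans hb)

lemma Sm.sup {V : C(K, ℝ) →L[ℝ] C(K, ℝ)} {a b : Clopens K} {ε δ : ℝ} (h : Sm V a ε)
    (h' : Sm V b δ) : Sm V (a ⊔ b) (ε + δ) := by
  intro c hc
  have e : c = (c ⊓ a) ⊔ (c \ a) := (sup_inf_sdiff c a).symm
  have hd : Disjoint (c ⊓ a) (c \ a) := disjoint_inf_sdiff
  rw [e, ind_sup hd, map_add]
  refine (norm_add_le _ _).trans (add_le_add (h _ inf_le_right) (h' _ ?_))
  exact sdiff_le_iff.2 hc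

def WC (V : C(K, ℝ) →L[ℝ] C(K, ℝ)) : Prop :=
  ∀ a : ℕ → Clopens K, Pairwise (Function.onFun Disjoint a) →
    Tendsto (fun n => ‖V (ind (a n))‖) atTop (𝓝 0)

lemma WC.exhaust {V : C(K, ℝ) →L[ℝ] C(K, ℝ)} (hV : WC V) (s : ℕ → Clopens K) (hs : Monotone s)
    {ε : ℝ} (hε : 0 < ε) : ∃ n, ∀ m ≥ n, Sm V (s m \ s n) ε := by
  by_contra hcon
  push Not at hcon
  have h : ∀ n, ∃ m ≥ n, ∃ c ≤ s m \ s n, ε < ‖V (ind c)‖ := by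
    intro n
    obtain ⟨m, hm, h2⟩ := hcon n
    unfold Sm at h2
    push Not at h2
    exact ⟨m, hm, h2⟩
  choose m hm c hc hcε using h
  let k : ℕ → ℕ := fun i => m^[i] 0
  have hk : ∀ i, k (i + 1) = m (k i) := fun i => Function.iterate_succ_apply' m i 0
  have hkm : Monotone k := monotone_nat_of_le_succ fun i => by rw [hk]; exact hm _
  have hd : Pairwise (Function.onFun Disjoint (fun i => c (k i))) := by
    rw [pairwise_disjoint_on]
    intro i j hij
    have h1 : c (k i) ≤ s (k j) :=
      (hc (k i)).trans (sdiff_le.trans (hs (by rw [← hk]; exact hkm hij)))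
    exact (disjoint_sdiff_self_right.mono h1 (hc (k j)))
  have := hV _ hd
  obtain ⟨i, hi⟩ := (this.eventually (gt_mem_nhds hε)).exists
  exact absurd (hcε (k i)) (not_lt.2 hi.le)

lemma WC.exhaust' {V : C(K, ℝ) →L[ℝ] C(K, ℝ)} (hV : WC V) (s : ℕ → Clopens K) (hs : Antitone s)
    {ε : ℝ} (hε : 0 < ε) : ∃ n, ∀ m ≥ n, Sm V (s n \ s m) ε := by
  obtain ⟨n, hn⟩ := hV.exhaust (fun i => (s i)ᶜ) (fun i j hij => compl_le_compl (hs hij)) hε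
  refine ⟨n, fun m hm => ?_⟩
  have := hn m hm
  rwa [compl_sdiff_compl] at this

lemma WC.X {V : C(K, ℝ) →L[ℝ] C(K, ℝ)} (hV : WC V) (a : ℕ → Clopens K) {ε : ℝ} (hε : 0 < ε) :
    ∃ (C : ℕ → Clopens K) (ν : ℕ → ℕ), Antitone C ∧ (∀ k, C k ≤ (Finset.Ico k (ν k)).sup a) ∧
      ∀ k, ∀ᶠ n in atTop, Sm V (a n \ C k) ε := by
  have h : ∀ k : ℕ, ∃ n, ∀ m ≥ n, Sm V ((Finset.Ico k m).sup a \ (Finset.Ico k n).sup a)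
      (ε * (1 / 2) ^ (k + 1)) := fun k =>
    hV.exhaust (fun m => (Finset.Ico k m).sup a)
      (fun i j hij => Finset.sup_mono (Finset.Ico_subset_Ico_right hij)) (by positivity)
  choose ν hν using h
  let B : ℕ → Clopens K := fun k => (Finset.Ico k (ν k)).sup a
  refine ⟨fun k => (Finset.range (k + 1)).inf B, ν, ?_, ?_, ?_⟩
  · intro i j hij
    exact Finset.inf_mono (Finset.range_mono (by omega))
  · intro k
    exact Finset.inf_le (f := B) (Finset.self_mem_range_succ k)
  · have hB : ∀ k, ∀ᶠ n in atTop, Sm V (a n \ B k) (ε * (1 / 2) ^ (k + 1)) := by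
      intro k
      filter_upwards [eventually_ge_atTop (max k (ν k))] with n hn
      refine (hν k (n + 1) (by omega)).mono (sdiff_le_sdiff_right ?_)
      exact Finset.le_sup (f := a) (by simp; omega)
    have key : ∀ k, ∀ᶠ n in atTop, Sm V (a n \ (Finset.range (k + 1)).inf B)
        (ε * (1 - (1 / 2) ^ (k + 1))) := by
      intro k
      induction k with
      | zero =>
        filter_upwards [hB 0] with n hn
        have e : ε * (1 - (1 / 2) ^ (0 + 1)) = ε * (1 / 2) ^ (0 + 1) := by norm_num
        rw [e]
        simpa using hn
      | succ k ih =>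
        filter_upwards [ih, hB (k + 1)] with n h1 h2
        rw [Finset.range_add_one, Finset.inf_insert, sdiff_inf]
        have := h2.sup h1
        have e : ε * (1 / 2) ^ (k + 1 + 1) + ε * (1 - (1 / 2) ^ (k + 1)) =
          ε * (1 - (1 / 2) ^ (k + 1 + 1)) := by ring
        rwa [e] at this
    intro k
    filter_upwards [key k] with n hn c hc
    refine (hn c hc).trans ?_
    have : (0 : ℝ) ≤ (1 / 2) ^ (k + 1) := by positivity
    nlinarith

lemma WC.b {V : C(K, ℝ) →L[ℝ] C(K, ℝ)} (hV : WC V) (a : ℕ → Clopens K)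
    (ha : ∀ x, ∀ᶠ n in atTop, x ∉ a n) {ε : ℝ} (hε : 0 < ε) : ∀ᶠ n in atTop, Sm V (a n) ε := by
  obtain ⟨C, ν, h1, h2, h3⟩ := hV.X a hε
  by_cases h : ∃ k, C k = ⊥
  · obtain ⟨k, hk⟩ := h
    have := h3 k
    simpa [hk] using this
  · push Not at h
    obtain ⟨x, hx⟩ := exists_mem_all C h1 h
    obtain ⟨N, hN⟩ := eventually_atTop.1 (ha x)
    obtain ⟨i, hi, hxi⟩ := mem_fsup.1 (h2 N (hx N))
    exact absurd hxi (hN i (Finset.mem_Ico.1 hi).1)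

variable [T2Space K] [TotallyDisconnectedSpace K]

lemma Sm.bound {V : C(K, ℝ) →L[ℝ] C(K, ℝ)} {a : Clopens K} {ε : ℝ} (h : Sm V a ε) (f : C(K, ℝ)) :
    ‖V (f * ind a)‖ ≤ 2 * ε * ‖f‖ := by
  have hε : 0 ≤ ε := (norm_nonneg _).trans (h a le_rfl)
  rw [ContinuousMap.norm_le _ (by positivity)]
  intro x
  exact SM (evT V x) (fun c hc => ((V (ind c)).norm_coe_le_norm x).trans (h c hc)) f

lemma Sm.bound' {V : C(K, ℝ) →L[ℝ] C(K, ℝ)} {a : Clopens K} {ε : ℝ} (h : Sm V a ε) (f : C(K, ℝ))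
    {δ : ℝ} (hδ : 0 ≤ δ) (hf : ∀ x, x ∉ a → |f x| ≤ δ) : ‖V f‖ ≤ 2 * ε * ‖f‖ + ‖V‖ * δ := by
  have e : f = f * ind a + f * ind aᶜ := by
    ext x
    by_cases hx : x ∈ a
    · simp [ind_of_mem hx, ind_of_not (c := aᶜ) (x := x) (by rw [mem_compl]; simpa)]
    · simp [ind_of_not hx, ind_of_mem (c := aᶜ) (x := x) (by rw [mem_compl]; simpa)]
  have h1 : ‖f * ind aᶜ‖ ≤ δ := by
    rw [ContinuousMap.norm_le _ hδ]
    intro x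
    by_cases hx : x ∈ a
    · simp [ind_of_not (c := aᶜ) (x := x) (by rw [mem_compl]; simpa), hδ]
    · simpa [ind_of_mem (c := aᶜ) (x := x) (by rw [mem_compl]; simpa)] using hf x hx
  calc ‖V f‖ = ‖V (f * ind a) + V (f * ind aᶜ)‖ := by rw [← map_add, ← e]
    _ ≤ ‖V (f * ind a)‖ + ‖V (f * ind aᶜ)‖ := norm_add_le _ _
    _ ≤ _ := add_le_add (h.bound f) ((V.le_opNorm _).trans
        (mul_le_mul_of_nonneg_left h1 V.opNorm_nonneg))

lemma exists_level (f : C(K, ℝ)) {δ : ℝ} (hδ : 0 < δ) : ∃ a : Clopens K,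
    (∀ x ∈ a, δ / 2 < |f x|) ∧ ∀ x, x ∉ a → |f x| ≤ δ := by
  obtain ⟨c, h1, h2⟩ := exists_between (K := K) (F := {x | δ ≤ |f x|}) (U := {x | δ / 2 < |f x|})
    (isClosed_le continuous_const (by fun_prop)) (isOpen_lt continuous_const (by fun_prop))
    (fun x hx => lt_of_lt_of_le (by linarith) (show δ ≤ |f x| from hx))
  refine ⟨c, fun x hx => h2 hx, fun x hx => ?_⟩
  by_contra h
  exact hx (h1 (not_le.1 h).le)

lemma WC.b' {V : C(K, ℝ) →L[ℝ] C(K, ℝ)} (hV : WC V) (w : ℕ → C(K, ℝ)) {M : ℝ}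
    (hM : ∀ n, ‖w n‖ ≤ M) (hw : ∀ x, Tendsto (fun n => w n x) atTop (𝓝 0)) :
    Tendsto (fun n => ‖V (w n)‖) atTop (𝓝 0) := by
  have hM0 : 0 ≤ M := (norm_nonneg _).trans (hM 0)
  rw [Metric.tendsto_nhds]
  intro ε hε
  set δ := ε / (4 * (‖V‖ + 1)) with hδ
  have hδ0 : 0 < δ := by positivity
  have h := fun n => exists_level (w n) hδ0
  choose a ha1 ha2 using h
  have hε' : 0 < ε / (8 * (M + 1)) := by positivity
  have := hV.b a (by
    intro x
    have h1 := (hw x).abs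
    rw [abs_zero] at h1
    filter_upwards [h1.eventually (gt_mem_nhds (half_pos hδ0))] with n hn hx
    exact absurd (ha1 n x hx) (not_lt.2 hn.le)) hε'
  filter_upwards [this] with n hn
  have h1 := hn.bound' (w n) hδ0.le (ha2 n)
  rw [Real.dist_eq, sub_zero, abs_norm]
  have h2 : 2 * (ε / (8 * (M + 1))) * ‖w n‖ ≤ ε / 4 := by
    calc _ ≤ 2 * (ε / (8 * (M + 1))) * (M + 1) :=
          mul_le_mul_of_nonneg_left ((hM n).trans (by linarith)) (by positivity)
      _ = ε / 4 := by field_simp; norm_num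
  have h3 : ‖V‖ * δ ≤ ε / 4 := by
    calc _ ≤ (‖V‖ + 1) * δ := mul_le_mul_of_nonneg_right (by linarith) hδ0.le
      _ = ε / 4 := by rw [hδ]; field_simp
  linarith

end P5b
section Dom
variable {K : Type} [TopologicalSpace K] [CompactSpace K]

lemma exists_dom (φ : C(K, ℝ) →L[ℝ] ℝ) : ∃ ψ : C(K, ℝ) →ₗ[ℝ] ℝ, (∀ f, 0 ≤ f → 0 ≤ ψ f) ∧
    ∀ f, |φ f| ≤ ψ |f| := by
  let p : (C(K, ℝ) × C(K, ℝ)) →ₗ.[ℝ] ℝ :=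
    ⟨Submodule.prod ⊥ ⊤, ((φ : C(K, ℝ) →ₗ[ℝ] ℝ).comp (LinearMap.snd ℝ _ _)).comp
      (Submodule.subtype _)⟩
  let N : C(K, ℝ) × C(K, ℝ) → ℝ := fun q => ‖φ‖ * ‖(q.1 + |q.2|) ⊔ 0‖
  have hle : ∀ f g : C(K, ℝ), 0 ≤ f → f ≤ g → ‖f‖ ≤ ‖g‖ := by
    intro f g hf hfg
    rw [ContinuousMap.norm_le _ (norm_nonneg _)]
    intro x
    have h0 : 0 ≤ f x := hf x
    have h1 : f x ≤ g x := hfg x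
    rw [Real.norm_of_nonneg h0]
    exact h1.trans ((le_abs_self _).trans (g.norm_coe_le_norm x))
  obtain ⟨g, hg1, hg2⟩ := exists_extension_of_le_sublinear p N (by
      intro c hc q
      have : (c • q).1 + |(c • q).2| = c • (q.1 + |q.2|) := by
        ext x; simp [abs_mul, abs_of_pos hc]
      have h2 : (c • (q.1 + |q.2|)) ⊔ 0 = c • ((q.1 + |q.2|) ⊔ 0) := by
        ext x
        simp [mul_max_of_nonneg _ _ hc.le, mul_add]
      simp only [N]
      rw [this, h2, norm_smul, Real.norm_of_nonneg hc.le]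
      ring) (by
      intro q r
      simp only [N]
      rw [← mul_add]
      refine mul_le_mul_of_nonneg_left ?_ φ.opNorm_nonneg
      refine le_trans (hle _ _ le_sup_right ?_) (norm_add_le _ _)
      intro x
      change max (q.1 x + r.1 x + |q.2 x + r.2 x|) 0 ≤
        max (q.1 x + |q.2 x|) 0 + max (r.1 x + |r.2 x|) 0
      refine sup_le ?_ (add_nonneg le_sup_right le_sup_right)
      have h3 := abs_add_le (q.2 x) (r.2 x)
      have h4 : q.1 x + |q.2 x| ≤ (q.1 x + |q.2 x|) ⊔ 0 := le_sup_left
      have h5 : r.1 x + |r.2 x| ≤ (r.1 x + |r.2 x|) ⊔ 0 := le_sup_left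
      linarith) (by
      rintro ⟨⟨f, h⟩, hf⟩
      have hf0 : f = 0 := hf.1
      subst hf0
      change φ h ≤ ‖φ‖ * ‖(0 + |h|) ⊔ 0‖
      rw [zero_add, sup_eq_left.2 (abs_nonneg h)]
      refine (le_abs_self _).trans ((φ.le_opNorm h).trans
        (mul_le_mul_of_nonneg_left ?_ φ.opNorm_nonneg))
      rw [ContinuousMap.norm_le _ (norm_nonneg _)]
      intro x
      have := (|h|).norm_coe_le_norm x
      simpa using this)
  have hgφ : ∀ h, g (0, h) = φ h := fun h => hg1 ⟨(0, h), ⟨rfl, trivial⟩⟩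
  have hgs : ∀ f h, g (f, h) = g (f, 0) + φ h := by
    intro f h
    rw [← hgφ, ← map_add]; simp
  refine ⟨g.comp (LinearMap.inl ℝ _ _), ?_, ?_⟩
  · intro f hf
    have := hg2 (-f, 0)
    have h0 : N (-f, 0) = 0 := by
      simp only [N, abs_zero, add_zero]
      rw [sup_eq_right.2 (by simpa using hf)]; simp
    rw [h0] at this
    have h1 : g (-f, 0) = - g (f, 0) := by rw [← map_neg]; simp
    change 0 ≤ g (f, 0)
    linarith
  · have key : ∀ f, φ f ≤ g (|f|, 0) := by
      intro f
      have := hg2 (-|f|, f)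
      have h0 : N (-|f|, f) = 0 := by simp [N]
      rw [h0, hgs] at this
      have h1 : g (-|f|, 0) = - g (|f|, 0) := by rw [← map_neg]; simp
      linarith
    intro f
    change |φ f| ≤ g (|f|, 0)
    rw [abs_le']
    refine ⟨key f, ?_⟩
    have := key (-f)
    rwa [map_neg, abs_neg] at this
end Dom
end FK


set_option linter.unusedSectionVars false
namespace FK
open TopologicalSpace Topology
section P5c
variable {K : Type} [TopologicalSpace K] [CompactSpace K]

lemma pos_mono {ψ : C(K, ℝ) →ₗ[ℝ] ℝ} (h : ∀ f, 0 ≤ f → 0 ≤ ψ f) {f g : C(K, ℝ)} (hfg : f ≤ g) :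
    ψ f ≤ ψ g := by
  have := h (g - f) (sub_nonneg.2 hfg)
  rw [map_sub] at this
  linarith

lemma ind_nonneg (a : Clopens K) : 0 ≤ ind a := by
  intro x
  change 0 ≤ ind a x
  by_cases h : x ∈ a
  · simp [ind_of_mem h]
  · simp [ind_of_not h]

lemma ind_mono {a b : Clopens K} (h : a ≤ b) : ind a ≤ ind b := by
  intro x
  change ind a x ≤ ind b x
  by_cases hx : x ∈ a
  · rw [ind_of_mem hx, ind_of_mem (h hx)]
  · rw [ind_of_not hx]; exact ind_nonneg b x

lemma pos_fsup {ψ : C(K, ℝ) →ₗ[ℝ] ℝ} (h : ∀ f, 0 ≤ f → 0 ≤ ψ f) (s : Finset ℕ)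
    (a : ℕ → Clopens K) : ψ (ind (s.sup a)) ≤ ∑ i ∈ s, ψ (ind (a i)) := by
  rw [← map_sum]
  apply pos_mono h
  intro x
  change ind _ x ≤ (∑ i ∈ s, ind (a i)) x
  rw [ContinuousMap.sum_apply]
  by_cases hx : x ∈ s.sup a
  · obtain ⟨i, hi, hxi⟩ := mem_fsup.1 hx
    rw [ind_of_mem hx, ← ind_of_mem hxi]
    exact Finset.single_le_sum (f := fun i => ind (a i) x) (fun i _ => ind_nonneg (a i) x) hi
  · rw [ind_of_not hx]
    exact Finset.sum_nonneg fun i _ => ind_nonneg (a i) x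

lemma geo_sum (m n : ℕ) : ∑ j ∈ Finset.Ico m n, (1 / 2 : ℝ) ^ j ≤ 2 * (1 / 2) ^ m := by
  rcases le_total n m with h | h
  · rw [Finset.Ico_eq_empty_of_le h]; simp
  · have : ∑ j ∈ Finset.Ico m n, (1 / 2 : ℝ) ^ j = 2 * (1 / 2) ^ m - 2 * (1 / 2) ^ n := by
      induction n, h using Nat.le_induction with
      | base => simp
      | succ k hk ih => rw [Finset.sum_Ico_succ_top hk, ih]; ring
    rw [this]
    have : (0 : ℝ) ≤ (1 / 2) ^ n := by positivity
    linarith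

lemma WC.control {V : C(K, ℝ) →L[ℝ] C(K, ℝ)} (hV : WC V) (ψ : K → C(K, ℝ) →ₗ[ℝ] ℝ)
    (hp : ∀ y f, 0 ≤ f → 0 ≤ ψ y f) (hd : ∀ y f, |V f y| ≤ ψ y |f|) {ε : ℝ} (hε : 0 < ε) :
    ∃ Y : Finset K, ∃ δ > 0, ∀ a : Clopens K, (∀ y ∈ Y, ψ y (ind a) ≤ δ) → Sm V a ε := by
  classical
  by_contra hcon
  push Not at hcon
  have h1 : ∀ (Y : Finset K) (δ : ℝ), 0 < δ → ∃ (c : Clopens K) (y : K),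
      (∀ z ∈ Y, ψ z (ind c) ≤ δ) ∧ ε < |V (ind c) y| := by
    intro Y δ hδ
    obtain ⟨a, ha, hna⟩ := hcon Y δ hδ
    unfold Sm at hna
    push Not at hna
    obtain ⟨c, hc, hcε⟩ := hna
    have : ∃ y, ε < |V (ind c) y| := by
      by_contra h
      push Not at h
      exact absurd ((ContinuousMap.norm_le _ hε.le).2 h) (not_le.2 hcε)
    obtain ⟨y, hy⟩ := this
    exact ⟨c, y, fun z hz => (pos_mono (hp z) (ind_mono hc)).trans (ha z hz), hy⟩
  obtain ⟨f, hf1, hf2⟩ := exists_seq_of_forall_finset_exists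
    (P := fun p : Clopens K × K × ℕ => ε < |V (ind p.1) p.2.1|)
    (r := fun p q => p.2.2 < q.2.2 ∧ ψ p.2.1 (ind q.1) ≤ (1 / 2) ^ q.2.2) (by
      intro s _
      obtain ⟨c, y, h2, h3⟩ := h1 (s.image fun p => p.2.1) ((1 / 2) ^ (s.sup (fun p => p.2.2) + 1))
        (by positivity)
      refine ⟨(c, y, s.sup (fun p => p.2.2) + 1), h3, fun p hp => ⟨?_, ?_⟩⟩
      · exact Nat.lt_succ_of_le (Finset.le_sup (f := fun p : Clopens K × K × ℕ => p.2.2) hp)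
      · exact h2 _ (Finset.mem_image_of_mem _ hp))
  have hidx : ∀ n, n ≤ (f n).2.2 := by
    have : StrictMono (fun n => (f n).2.2) := fun m n h => (hf2 m n h).1
    exact fun n => this.le_apply
  set a : ℕ → Clopens K := fun n => (f n).1
  set y : ℕ → K := fun n => (f n).2.1
  have hψ : ∀ m n, m < n → ψ (y m) (ind (a n)) ≤ (1 / 2) ^ n := fun m n h =>
    ((hf2 m n h).2).trans (pow_le_pow_of_le_one (by norm_num) (by norm_num) (hidx n))
  have hε4 : 0 < ε / 4 := by positivity
  obtain ⟨C, ν, c1, c2, c3⟩ := hV.X a hε4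
  obtain ⟨k, hk⟩ := hV.exhaust' C c1 hε4
  obtain ⟨n, hn⟩ := (c3 k).exists
  obtain ⟨m0, hm0⟩ := exists_pow_lt_of_lt_one (show (0 : ℝ) < ε / 8 by positivity)
    (show (1 / 2 : ℝ) < 1 by norm_num)
  set m := max (max k (n + 1)) m0
  have hmk : k ≤ m := (le_max_left _ _).trans (le_max_left _ _)
  have hmn : n + 1 ≤ m := (le_max_right _ _).trans (le_max_left _ _)
  have hm2 : (1 / 2 : ℝ) ^ m < ε / 8 :=
    (pow_le_pow_of_le_one (by norm_num) (by norm_num) (le_max_right _ _)).trans_lt hm0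
  have e : ind (a n) = ind (a n \ C k) + ind (a n ⊓ (C k \ C m)) + ind (a n ⊓ C m) := by
    ext x
    have hc : x ∈ C m → x ∈ C k := fun h => c1 hmk h
    simp only [ContinuousMap.add_apply]
    by_cases x1 : x ∈ a n <;> by_cases x2 : x ∈ C k <;> by_cases x3 : x ∈ C m <;>
      simp_all [ind_of_mem, ind_of_not, mem_sdiff, mem_inf]
  have t1 : |V (ind (a n \ C k)) (y n)| ≤ ε / 4 :=
    ((V _).norm_coe_le_norm _).trans (hn _ le_rfl)
  have t2 : |V (ind (a n ⊓ (C k \ C m))) (y n)| ≤ ε / 4 :=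
    ((V _).norm_coe_le_norm _).trans (hk m hmk _ inf_le_right)
  have t3 : |V (ind (a n ⊓ C m)) (y n)| ≤ 2 * (1 / 2) ^ m := by
    refine (hd _ _).trans ?_
    rw [abs_of_nonneg (ind_nonneg _)]
    refine (pos_mono (hp _) (ind_mono (inf_le_right.trans (c2 m)))).trans ?_
    refine (pos_fsup (hp _) _ _).trans ((Finset.sum_le_sum ?_).trans (geo_sum m (ν m)))
    intro i hi
    exact hψ n i (by have := (Finset.mem_Ico.1 hi).1; omega)
  have t0 : ε < |V (ind (a n)) (y n)| := hf1 n
  rw [e, map_add, map_add, ContinuousMap.add_apply, ContinuousMap.add_apply] at t0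
  have := abs_add_three (V (ind (a n \ C k)) (y n)) (V (ind (a n ⊓ (C k \ C m))) (y n))
    (V (ind (a n ⊓ C m)) (y n))
  linarith

lemma pos_bound {ψ : C(K, ℝ) →ₗ[ℝ] ℝ} (h : ∀ f, 0 ≤ f → 0 ≤ ψ f) {f : C(K, ℝ)} {M : ℝ}
    (hf : ‖f‖ ≤ M) : |ψ f| ≤ M * ψ 1 := by
  have h1 : f ≤ M • (1 : C(K, ℝ)) := by
    intro x
    change f x ≤ M * 1
    rw [mul_one]
    exact (le_abs_self _).trans ((f.norm_coe_le_norm x).trans hf)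
  have h2 : -f ≤ M • (1 : C(K, ℝ)) := by
    intro x
    change -f x ≤ M * 1
    rw [mul_one]
    exact (neg_le_abs _).trans ((f.norm_coe_le_norm x).trans hf)
  have h3 := pos_mono h h1
  have h4 := pos_mono h h2
  rw [map_smul, smul_eq_mul] at h3 h4
  rw [map_neg] at h4
  exact abs_le'.2 ⟨h3, h4⟩

variable [T2Space K] [TotallyDisconnectedSpace K]

/-- control in terms of functions -/
lemma WC.control_fun {V : C(K, ℝ) →L[ℝ] C(K, ℝ)} (hV : WC V) {ε : ℝ} (hε : 0 < ε) :
    ∃ (l : C(K, ℝ) →ₗ[ℝ] ℝ) (δ : ℝ), (∀ f, 0 ≤ f → 0 ≤ l f) ∧ 0 < δ ∧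
      ∀ a : Clopens K, l (ind a) ≤ δ → Sm V a ε := by
  have h := fun y => exists_dom (evT V y)
  choose ψ h1 h2 using h
  obtain ⟨Y, δ, hδ, hY⟩ := hV.control ψ h1 h2 hε
  refine ⟨∑ y ∈ Y, ψ y, δ, ?_, hδ, ?_⟩
  · intro f hf
    rw [LinearMap.sum_apply]
    exact Finset.sum_nonneg fun y _ => h1 y f hf
  · intro a ha
    apply hY
    intro y hy
    refine le_trans ?_ ha
    rw [LinearMap.sum_apply]
    exact Finset.single_le_sum (f := fun y => ψ y (ind a)) (fun y _ => h1 y _ (ind_nonneg a)) hy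

lemma WC.pointwise {V : C(K, ℝ) →L[ℝ] C(K, ℝ)} (hV : WC V) (u : ℕ → C(K, ℝ)) {C : ℝ}
    (hC0 : 0 < C) (hu : ∀ n, ‖u n‖ ≤ C) :
    ∃ φ : ℕ → ℕ, StrictMono φ ∧ ∀ y, CauchySeq (fun n => V (u (φ n)) y) := by
  have hctl := fun j : ℕ => hV.control_fun (ε := 1 / ((j : ℝ) + 1)) (by positivity)
  choose l d hl hd hctl using hctl
  -- extraction
  let P : ℕ → (ℕ × ℕ → ℝ) := fun m q => l q.2 (u q.1 * u m)
  have hcomp : IsCompact (Set.pi Set.univ fun q : ℕ × ℕ =>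
      Set.Icc (-(C * C * l q.2 1)) (C * C * l q.2 1)) := isCompact_univ_pi fun q => isCompact_Icc
  obtain ⟨L, -, φ, hφ, hlim⟩ := hcomp.tendsto_subseq (x := P) (by
    intro m q _
    rw [Set.mem_Icc, ← abs_le]
    exact pos_bound (hl q.2) ((norm_mul_le _ _).trans
      (mul_le_mul (hu _) (hu _) (norm_nonneg _) hC0.le)))
  have hconv : ∀ n j, Tendsto (fun m => l j (u n * u (φ m))) atTop (𝓝 (L (n, j))) := fun n j =>
    (tendsto_pi_nhds.1 hlim) (n, j)
  refine ⟨φ, hφ, fun y => ?_⟩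
  by_contra hnc
  rw [Metric.cauchySeq_iff] at hnc
  push Not at hnc
  obtain ⟨δ, hδ, hnc⟩ := hnc
  choose p hp q hq hpq using hnc
  have hz : ∀ k, ∃ z : C(K, ℝ), (z = u (φ (p k)) - u (φ (q k)) ∨ z = u (φ (q k)) - u (φ (p k))) ∧
      δ ≤ V z y := by
    intro k
    have h1 := hpq k
    rw [Real.dist_eq] at h1
    rcases le_abs'.1 h1 with h | h
    · refine ⟨_, Or.inr rfl, ?_⟩
      rw [map_sub, ContinuousMap.sub_apply]; linarith
    · exact ⟨_, Or.inl rfl, by rwa [map_sub]⟩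
  choose z hz1 hz2 using hz
  have hzn : ∀ k, ‖z k‖ ≤ 2 * C := by
    intro k
    rcases hz1 k with h | h <;> rw [h] <;>
      exact (norm_sub_le _ _).trans (by linarith [hu (φ (p k)), hu (φ (q k))])
  have hlz : ∀ n j, Tendsto (fun k => l j (u n * z k)) atTop (𝓝 0) := by
    intro n j
    have hpt : Tendsto p atTop atTop := tendsto_atTop_mono hp tendsto_id
    have hqt : Tendsto q atTop atTop := tendsto_atTop_mono hq tendsto_id
    have h1 := ((hconv n j).comp hpt).sub ((hconv n j).comp hqt)
    rw [sub_self] at h1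
    have h2 := h1.abs
    rw [abs_zero] at h2
    rw [tendsto_zero_iff_abs_tendsto_zero]
    refine h2.congr fun k => ?_
    simp only [Function.comp]
    rcases hz1 k with h | h <;> rw [h, mul_sub, map_sub]
    exact abs_sub_comm _ _
  have hlzz : ∀ i j, Tendsto (fun k => l j (z i * z k)) atTop (𝓝 0) := by
    intro i j
    rcases hz1 i with h | h
    · have := (hlz (φ (p i)) j).sub (hlz (φ (q i)) j)
      rw [sub_self] at this
      refine this.congr fun k => ?_
      rw [h, sub_mul, map_sub]
    · have := (hlz (φ (q i)) j).sub (hlz (φ (p i)) j)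
      rw [sub_self] at this
      refine this.congr fun k => ?_
      rw [h, sub_mul, map_sub]
  -- choose j
  obtain ⟨j, hj⟩ := exists_nat_one_div_lt (show 0 < δ / (16 * C) by positivity)
  have hB0 : 0 ≤ l j 1 := hl j 1 (fun x => zero_le_one)
  set B : ℝ := (2 * C) * (2 * C) * l j 1 with hB
  have hZ : ∀ N : ℕ, ∃ Z : C(K, ℝ), l j (Z * Z) ≤ N * (B + 1) ∧ N * δ ≤ V Z y ∧
      ‖Z‖ ≤ N * (2 * C) ∧ Tendsto (fun k => l j (Z * z k)) atTop (𝓝 0) := by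
    intro N
    induction N with
    | zero => exact ⟨0, by simp, by simp, by simp, by simp⟩
    | succ N ih =>
      obtain ⟨Z, a1, a2, a3, a4⟩ := ih
      obtain ⟨k, hk⟩ := (a4.eventually (gt_mem_nhds (show (0 : ℝ) < 1 / 2 by norm_num))).exists
      refine ⟨Z + z k, ?_, ?_, ?_, ?_⟩
      · have e : (Z + z k) * (Z + z k) = Z * Z + (2 : ℝ) • (Z * z k) + z k * z k := by
          ext x; simp; ring
        have b := (le_abs_self _).trans (pos_bound (hl j) ((norm_mul_le (z k) (z k)).trans
          (mul_le_mul (hzn k) (hzn k) (norm_nonneg _) (by positivity))))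
        rw [e, map_add, map_add, map_smul, smul_eq_mul]
        push_cast
        rw [← hB] at b
        linarith
      · rw [map_add, ContinuousMap.add_apply]
        push_cast
        linarith [hz2 k]
      · push_cast
        linarith [norm_add_le Z (z k), hzn k]
      · have := a4.add (hlzz k j)
        rw [add_zero] at this
        refine this.congr fun i => ?_
        rw [add_mul, map_add]
  set θ : ℝ := δ / (4 * (‖V‖ + 1)) with hθ
  have hθ0 : 0 < θ := by positivity
  have hBn : 0 ≤ B := by positivity
  obtain ⟨N, hN⟩ := exists_nat_gt (4 * (B + 1) / (θ ^ 2 * d j))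
  have hdj := hd j
  have hNp : (0 : ℝ) < N := lt_of_le_of_lt (by positivity) hN
  obtain ⟨Z, a1, a2, a3, -⟩ := hZ N
  set f : C(K, ℝ) := (N : ℝ)⁻¹ • Z with hf
  have hfn : ‖f‖ ≤ 2 * C := by
    rw [hf, norm_smul, norm_inv, Real.norm_of_nonneg hNp.le, inv_mul_le_iff₀ hNp]
    exact a3
  have hVf : δ ≤ V f y := by
    rw [hf, map_smul, ContinuousMap.smul_apply, smul_eq_mul, inv_mul_eq_div, le_div_iff₀ hNp]
    linarith
  have hff : l j (f * f) ≤ (B + 1) / N := by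
    have e : f * f = ((N : ℝ)⁻¹ * (N : ℝ)⁻¹) • (Z * Z) := by
      rw [hf]; ext x; simp; ring
    rw [e, map_smul, smul_eq_mul]
    calc _ ≤ ((N : ℝ)⁻¹ * (N : ℝ)⁻¹) * (N * (B + 1)) :=
          mul_le_mul_of_nonneg_left a1 (by positivity)
      _ = _ := by field_simp
  obtain ⟨a, ha1, ha2⟩ := exists_level f hθ0
  have hla : l j (ind a) ≤ d j := by
    have h1 : ind a ≤ (4 / θ ^ 2) • (f * f) := by
      intro x
      change ind a x ≤ (4 / θ ^ 2) * (f x * f x)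
      by_cases hx : x ∈ a
      · rw [ind_of_mem hx]
        have h2 := ha1 x hx
        have h3 : (θ / 2) ^ 2 ≤ f x * f x := by
          rw [← sq, ← sq_abs (f x)]
          exact pow_le_pow_left₀ (by positivity) h2.le 2
        calc (1 : ℝ) = 4 / θ ^ 2 * (θ / 2) ^ 2 := by field_simp; norm_num
          _ ≤ _ := mul_le_mul_of_nonneg_left h3 (by positivity)
      · rw [ind_of_not hx]
        exact mul_nonneg (by positivity) (mul_self_nonneg _)
    have h2 := pos_mono (hl j) h1
    rw [map_smul, smul_eq_mul] at h2
    refine h2.trans ?_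
    calc _ ≤ 4 / θ ^ 2 * ((B + 1) / N) := mul_le_mul_of_nonneg_left hff (by positivity)
      _ ≤ d j := by
        rw [div_lt_iff₀ (by positivity)] at hN
        rw [div_mul_div_comm, div_le_iff₀ (by positivity)]
        linarith
  have hb := (hctl j a hla).bound' f hθ0.le ha2
  have h1 : ‖V‖ * θ ≤ δ / 4 := by
    calc _ ≤ (‖V‖ + 1) * θ := mul_le_mul_of_nonneg_right (by linarith) hθ0.le
      _ = δ / 4 := by rw [hθ]; field_simp
  have h2 : 2 * (1 / ((j : ℝ) + 1)) * ‖f‖ ≤ δ / 4 := by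
    have : (0 : ℝ) < 1 / ((j : ℝ) + 1) := by positivity
    calc _ ≤ 2 * (δ / (16 * C)) * (2 * C) := by
          apply mul_le_mul _ hfn (norm_nonneg _) (by positivity)
          linarith
      _ = δ / 4 := by field_simp; norm_num
  have h3 : V f y ≤ ‖V f‖ := (le_abs_self _).trans ((V f).norm_coe_le_norm y)
  linarith

lemma WC.VV {V : C(K, ℝ) →L[ℝ] C(K, ℝ)} (hV : WC V) (u : ℕ → C(K, ℝ))
    (hu : ∃ C, ∀ n, ‖u n‖ ≤ C) :
    ∃ φ : ℕ → ℕ, StrictMono φ ∧ CauchySeq (fun n => V (V (u (φ n)))) := by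
  obtain ⟨C, hC⟩ := hu
  have hC0 : 0 < C + 1 := by linarith [norm_nonneg (u 0), hC 0]
  obtain ⟨φ, hφ, h⟩ := hV.pointwise u hC0 (fun n => (hC n).trans (by linarith))
  refine ⟨φ, hφ, ?_⟩
  by_contra hnc
  rw [Metric.cauchySeq_iff] at hnc
  push Not at hnc
  obtain ⟨δ, hδ, hnc⟩ := hnc
  choose p hp q hq hpq using hnc
  have hpt : Tendsto p atTop atTop := tendsto_atTop_mono hp tendsto_id
  have hqt : Tendsto q atTop atTop := tendsto_atTop_mono hq tendsto_id
  have hb := hV.b' (fun k => V (u (φ (p k))) - V (u (φ (q k)))) (M := ‖V‖ * C + ‖V‖ * C) (by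
      intro k
      refine (norm_sub_le _ _).trans (add_le_add ?_ ?_) <;>
      exact (V.le_opNorm _).trans (mul_le_mul_of_nonneg_left (hC _) V.opNorm_nonneg)) (by
      intro x
      obtain ⟨L, hL⟩ := cauchySeq_tendsto_of_complete (h x)
      have := (hL.comp hpt).sub (hL.comp hqt)
      rw [sub_self] at this
      exact this)
  obtain ⟨k, hk⟩ := (hb.eventually (gt_mem_nhds hδ)).exists
  have := hpq k
  rw [dist_eq_norm, ← map_sub] at this
  linarith

lemma WC.fredholm {V : C(K, ℝ) →L[ℝ] C(K, ℝ)} (hV : WC V) (hinj : ∀ u, u + V u = 0 → u = 0) :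
    ∀ w, ∃ u, u + V u = w :=
  riesz_surj V (fun u hu => hV.VV u hu) hinj

end P5c
end FK


set_option linter.unusedSectionVars false
namespace FK
open TopologicalSpace Topology

structure Good (K : Type) [TopologicalSpace K] : Prop where
  p1 : ∀ d : ℕ → Clopens K, Antitone d → (∀ n, d n ≠ ⊥) → ∃ e : Clopens K, e ≠ ⊥ ∧ ∀ n, e ≤ d n
  perf : ∀ c : Clopens K, c ≠ ⊥ → ∃ e : Clopens K, e ≠ ⊥ ∧ e < c
  p2 : ∀ a : ℕ → Clopens K, Pairwise (Function.onFun Disjoint a) →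
    ∃ (W : Set (Set ℕ)) (α : Set ℕ → Clopens K), ¬ W.Countable ∧ (∀ b ∈ W, b.Infinite) ∧
      (∀ b ∈ W, ∀ n, (n ∈ b → a n ≤ α b) ∧ (n ∉ b → Disjoint (a n) (α b))) ∧
      (∀ b ∈ W, ∀ b' ∈ W, b ≠ b' → ∃ N, α b ⊓ α b' ≤ (Finset.range N).sup a) ∧
      (∀ v : ℕ → Clopens K, (∀ m, v m ≠ ⊥) → (∀ m n, Disjoint (v m) (a n)) →
        ¬ {b ∈ W | ¬ ∃ c : Clopens K, (∀ m ∈ b, v m ≤ c) ∧ (∀ m, m ∉ b → Disjoint (v m) c)}.Countable)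

lemma rosenthal_aux {δ : ℝ} (hδ : 0 < δ) (j : ℕ) : ∀ s : ℕ → ℕ → ℝ, (∀ m n, 0 ≤ s m n) →
    (∀ m (F : Finset ℕ), ∑ n ∈ F, s m n ≤ j * δ) → ∃ θ : ℕ → ℕ, Function.Injective θ ∧
      ∀ m (F : Finset ℕ), m ∉ F → ∑ n ∈ F, s (θ m) (θ n) ≤ δ := by
  classical
  induction j with
  | zero =>
    intro s hs h
    refine ⟨id, Function.injective_id, fun m F _ => (h m F).trans ?_⟩
    simp [hδ.le]
  | succ j ih =>
    intro s hs h
    by_cases hk : ∃ k, ∀ m (F : Finset ℕ), m ∉ F →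
        ∑ n ∈ F, s (Nat.pair k m) (Nat.pair k n) ≤ δ
    · obtain ⟨k, hk⟩ := hk
      refine ⟨fun m => Nat.pair k m, fun a b hab => ?_, hk⟩
      exact (Nat.pair_eq_pair.1 hab).2
    · push Not at hk
      choose m F hmF hF using hk
      obtain ⟨θ, hθ, h2⟩ := ih (fun k l => s (Nat.pair k (m k)) (Nat.pair l (m l)))
        (fun _ _ => hs _ _) (by
          intro k G
          have h3 := h (Nat.pair k (m k)) ((F k).image (Nat.pair k) ∪
            G.image (fun l => Nat.pair l (m l)))
          rw [Finset.sum_union, Finset.sum_image, Finset.sum_image] at h3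
          · have := hF k
            push_cast at h3
            linarith
          · intro a _ b _ hab
            exact (Nat.pair_eq_pair.1 hab).1
          · intro a _ b _ hab
            exact (Nat.pair_eq_pair.1 hab).2
          · rw [Finset.disjoint_left]
            intro x hx hy
            obtain ⟨i, hi, rfl⟩ := Finset.mem_image.1 hx
            obtain ⟨l, hl, hli⟩ := Finset.mem_image.1 hy
            obtain ⟨rfl, rfl⟩ := Nat.pair_eq_pair.1 hli
            exact hmF _ hi)
      refine ⟨fun k => Nat.pair (θ k) (m (θ k)), fun a b hab => ?_, h2⟩
      exact hθ (Nat.pair_eq_pair.1 hab).1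

lemma rosenthal {δ : ℝ} (hδ : 0 < δ) (s : ℕ → ℕ → ℝ) (hs : ∀ m n, 0 ≤ s m n) {M : ℝ}
    (h : ∀ m (F : Finset ℕ), ∑ n ∈ F, s m n ≤ M) : ∃ θ : ℕ → ℕ, Function.Injective θ ∧
      ∀ m (F : Finset ℕ), m ∉ F → ∑ n ∈ F, s (θ m) (θ n) ≤ δ := by
  obtain ⟨j, hj⟩ := exists_nat_gt (M / δ)
  refine rosenthal_aux hδ j s hs fun m F => (h m F).trans ?_
  rw [div_lt_iff₀ hδ] at hj
  exact hj.le

section P3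
variable {K : Type} [TopologicalSpace K] [CompactSpace K] [T2Space K] [TotallyDisconnectedSpace K]

lemma Good.constNat (hK : Good K) (f : ℕ → C(K, ℝ)) (x : K) :
    ∃ v : Clopens K, v ≠ ⊥ ∧ ∀ y ∈ v, ∀ n, f n y = f n x := by
  have h : ∀ i : ℕ, ∃ e : Clopens K, x ∈ e ∧ ∀ y ∈ e, ∀ n ∈ Finset.range (i + 1),
      |f n y - f n x| < 1 / ((i : ℝ) + 1) := by
    intro i
    obtain ⟨c, hc, hcU⟩ := exists_clopen_nhd (x := x)
      (U := ⋂ n ∈ Finset.range (i + 1), {y | |f n y - f n x| < 1 / ((i : ℝ) + 1)})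
      (isOpen_biInter_finset fun n _ => isOpen_lt (by fun_prop) continuous_const)
      (by simp only [Set.mem_iInter]
          intro n _
          simp only [Set.mem_ofPred_eq, sub_self, abs_zero]
          positivity)
    refine ⟨c, hc, fun y hy n hn => ?_⟩
    exact Set.mem_iInter₂.1 (hcU hy) n hn
  choose e he1 he2 using h
  have hmem : ∀ k, x ∈ (Finset.range (k + 1)).inf e := by
    intro k
    induction k with
    | zero => simpa using he1 0
    | succ k ih => rw [Finset.range_add_one, Finset.inf_insert]; exact ⟨he1 _, ih⟩
  obtain ⟨v, hv, hv2⟩ := hK.p1 (fun k => (Finset.range (k + 1)).inf e)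
    (fun i j hij => Finset.inf_mono (Finset.range_mono (by omega)))
    (fun k => ne_bot_iff.2 ⟨x, hmem k⟩)
  refine ⟨v, hv, fun y hy n => ?_⟩
  have h1 : ∀ k : ℕ, n ≤ k → |f n y - f n x| < 1 / ((k : ℝ) + 1) := by
    intro k hk
    refine he2 k y ?_ n (by simp; omega)
    exact (hv2 k).trans (Finset.inf_le (f := e) (Finset.self_mem_range_succ k)) hy
  by_contra hne
  have hpos : 0 < |f n y - f n x| := abs_pos.2 (sub_ne_zero.2 hne)
  obtain ⟨k, hk⟩ := exists_nat_one_div_lt hpos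
  have h2 := h1 (max n k) (le_max_left _ _)
  have h3 : 1 / (((max n k : ℕ) : ℝ) + 1) ≤ 1 / ((k : ℝ) + 1) := by
    apply one_div_le_one_div_of_le (by positivity)
    have : (k : ℝ) ≤ ((max n k : ℕ) : ℝ) := by exact_mod_cast le_max_right n k
    linarith
  linarith

lemma Good.const (hK : Good K) {ι : Type} [Countable ι] [Nonempty ι] (f : ι → C(K, ℝ)) (x : K) :
    ∃ v : Clopens K, v ≠ ⊥ ∧ ∀ y ∈ v, ∀ n, f n y = f n x := by
  obtain ⟨g, hg⟩ := exists_surjective_nat ι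
  obtain ⟨v, hv, h⟩ := hK.constNat (fun n => f (g n)) x
  refine ⟨v, hv, fun y hy i => ?_⟩
  obtain ⟨n, rfl⟩ := hg i
  exact h y hy n

lemma ind_eq_iff {c : Clopens K} {x y : K} (h : ind c x = ind c y) : x ∈ c ↔ y ∈ c := by
  by_cases hx : x ∈ c <;> by_cases hy : y ∈ c <;> simp_all [ind_of_mem, ind_of_not]

theorem Good.WM (hK : Good K) (T : C(K, ℝ) →L[ℝ] C(K, ℝ)) (a : ℕ → Clopens K)
    (ha : Pairwise (Function.onFun Disjoint a)) (y : ℕ → K) (hy : ∀ n, y n ∉ a n) {ε : ℝ}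
    (hε : 0 < ε) (h : ∀ n, ε < |T (ind (a n)) (y n)|) : False := by
  classical
  set δ : ℝ := min (ε / 8) (1 / 2) with hδ
  have hδ0 : 0 < δ := lt_min (by positivity) (by norm_num)
  have hδ1 : δ ≤ ε / 8 := min_le_left _ _
  have hδ2 : δ ≤ 1 / 2 := min_le_right _ _
  obtain ⟨θ, hθ, hros⟩ := rosenthal hδ0 (fun m n => |T (ind (a n)) (y m)| + |ind (a n) (y m)|)
    (fun _ _ => by positivity) (M := ‖T‖ + 1) (by
      intro m F
      rw [Finset.sum_add_distrib]
      have hd : ((F : Set ℕ)).PairwiseDisjoint a := fun i _ j _ hij => ha hij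
      refine add_le_add ((F1 (evT T (y m)) F a hd).trans (norm_evT_le T _)) ?_
      refine (F1 (evT (ContinuousLinearMap.id ℝ _) (y m)) F a hd).trans ((norm_evT_le _ _).trans ?_)
      exact ContinuousLinearMap.norm_id_le)
  -- pass to subsequence
  replace ha : Pairwise (Function.onFun Disjoint (a ∘ θ)) := fun i j hij =>
    ha (fun h => hij (hθ h))
  replace hy : ∀ n, (y ∘ θ) n ∉ (a ∘ θ) n := fun n => hy _
  replace h : ∀ n, ε < |T (ind ((a ∘ θ) n)) ((y ∘ θ) n)| := fun n => h _
  replace hros : ∀ m (F : Finset ℕ), m ∉ F →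
    ∑ n ∈ F, (|T (ind ((a ∘ θ) n)) ((y ∘ θ) m)| + |ind ((a ∘ θ) n) ((y ∘ θ) m)|) ≤ δ := hros
  generalize a ∘ θ = a at *
  generalize y ∘ θ = y at *
  have hya : ∀ m n, y m ∉ a n := by
    intro m n hmn
    by_cases e : m = n
    · subst e; exact hy m hmn
    · have := hros m {n} (by simpa using e)
      rw [Finset.sum_singleton, ind_of_mem hmn, abs_one] at this
      linarith [abs_nonneg (T (ind (a n)) (y m))]
  have hrow : ∀ m (F : Finset ℕ), m ∉ F → ∑ n ∈ F, |T (ind (a n)) (y m)| ≤ δ := by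
    intro m F hF
    refine (Finset.sum_le_sum fun n _ => ?_).trans (hros m F hF)
    exact le_add_of_nonneg_right (abs_nonneg _)
  have hv : ∀ m, ∃ v : Clopens K, v ≠ ⊥ ∧ (∀ n, ∀ z ∈ v, T (ind (a n)) z = T (ind (a n)) (y m)) ∧
      ∀ n, Disjoint v (a n) := by
    intro m
    obtain ⟨v, hv, hv2⟩ := hK.const (fun i : ℕ ⊕ ℕ => i.elim (fun n => T (ind (a n)))
      (fun n => ind (a n))) (y m)
    refine ⟨v, hv, fun n z hz => hv2 z hz (Sum.inl n), fun n => ?_⟩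
    rw [disj_iff]
    intro z hz hza
    have := hv2 z hz (Sum.inr n)
    exact hya m n ((ind_eq_iff this).1 hza)
  choose v hv0 hvT hva using hv
  obtain ⟨W, α, hW, -, hα1, hα2, hα3⟩ := hK.p2 a ha
  let t : ℕ → Set ℕ → ℝ := fun m b => if m ∈ b then T (ind (a m)) (y m) else 0
  have claim : ∀ m (S : Finset (Set ℕ)), (∀ b ∈ S, b ∈ W) → ∀ z ∈ v m,
      (∀ b ∈ S, 2 * δ < |T (ind (α b)) z - t m b|) → (S.card : ℝ) * δ ≤ ‖T‖ := by
    intro m S hS z hz hbad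
    have hN : ∃ N, m < N ∧ ∀ b ∈ S, ∀ b' ∈ S, b ≠ b' → α b ⊓ α b' ≤ (Finset.range N).sup a := by
      have h1 : ∀ b b' : Set ℕ, ∃ N, b ∈ S → b' ∈ S → b ≠ b' → α b ⊓ α b' ≤ (Finset.range N).sup a := by
        intro b b'
        by_cases hh : b ∈ S ∧ b' ∈ S ∧ b ≠ b'
        · obtain ⟨N, hN⟩ := hα2 b (hS b hh.1) b' (hS b' hh.2.1) hh.2.2
          exact ⟨N, fun _ _ _ => hN⟩
        · exact ⟨0, fun h1 h2 h3 => (hh ⟨h1, h2, h3⟩).elim⟩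
      choose N hN using h1
      refine ⟨(S.sup fun b => S.sup fun b' => N b b') + m + 1, by omega, fun b hb b' hb' hne => ?_⟩
      refine (hN b b' hb hb' hne).trans (Finset.sup_mono (Finset.range_mono ?_))
      have h1 : N b b' ≤ S.sup fun b' => N b b' := Finset.le_sup (f := fun b' => N b b') hb'
      have h2 : (S.sup fun b' => N b b') ≤ S.sup fun b => S.sup fun b' => N b b' :=
        Finset.le_sup (f := fun b => S.sup fun b' => N b b') hb
      omega
    obtain ⟨N, hmN, hN⟩ := hN
    let r : Set ℕ → Clopens K := fun b => α b \ (Finset.range N).sup a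
    have hrd : (S : Set (Set ℕ)).PairwiseDisjoint r := by
      intro b hb b' hb' hne
      rw [Function.onFun, disj_iff]
      intro x hx hx'
      exact hx.2 (hN b hb b' hb' hne ⟨hx.1, hx'.1⟩)
    have hbig : ∀ b ∈ S, δ ≤ |evT T z (ind (r b))| := by
      intro b hb
      have e1 : ind (α b) = ind (r b) + ∑ n ∈ (Finset.range N).filter (· ∈ b), ind (a n) := by
        rw [← ind_fsup _ _ (fun i _ j _ hij => ha hij), ← ind_sup]
        · congr 1
          ext x
          change x ∈ α b ↔ x ∈ r b ⊔ _
          rw [mem_sup]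
          constructor
          · intro hx
            by_cases hxa : x ∈ (Finset.range N).sup a
            · right
              obtain ⟨i, hi, hxi⟩ := mem_fsup.1 hxa
              refine mem_fsup.2 ⟨i, Finset.mem_filter.2 ⟨hi, ?_⟩, hxi⟩
              by_contra hib
              exact disj_iff.1 ((hα1 b (hS b hb) i).2 hib) x hxi hx
            · exact Or.inl ⟨hx, hxa⟩
          · rintro (hx | hx)
            · exact hx.1
            · obtain ⟨i, hi, hxi⟩ := mem_fsup.1 hx
              exact (hα1 b (hS b hb) i).1 (Finset.mem_filter.1 hi).2 hxi
        · exact disjoint_sdiff_self_left.mono_right (Finset.sup_mono (Finset.filter_subset _ _))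
      have e2 : T (ind (α b)) z = evT T z (ind (r b)) +
          ∑ n ∈ (Finset.range N).filter (· ∈ b), T (ind (a n)) (y m) := by
        rw [e1, map_add, map_sum, ContinuousMap.add_apply, ContinuousMap.sum_apply, evT_apply]
        congr 1
        exact Finset.sum_congr rfl fun n _ => hvT m n z hz
      have e3 : |(∑ n ∈ (Finset.range N).filter (· ∈ b), T (ind (a n)) (y m)) - t m b| ≤ δ := by
        have e4 : (∑ n ∈ (Finset.range N).filter (· ∈ b), T (ind (a n)) (y m)) - t m b =
            ∑ n ∈ ((Finset.range N).filter (· ∈ b)).erase m, T (ind (a n)) (y m) := by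
          by_cases hmb : m ∈ b
          · have hm' : m ∈ (Finset.range N).filter (· ∈ b) := by simp [hmN, hmb]
            rw [← Finset.add_sum_erase _ _ hm']
            simp [t, hmb]
          · rw [Finset.erase_eq_of_notMem (by simp [hmb])]
            simp [t, hmb]
        rw [e4]
        exact (Finset.abs_sum_le_sum_abs _ _).trans (hrow m _ (by simp))
      have h5 := hbad b hb
      rw [e2] at h5
      have h6 := abs_add_le (evT T z (ind (r b)))
        ((∑ n ∈ (Finset.range N).filter (· ∈ b), T (ind (a n)) (y m)) - t m b)
      rw [← add_sub_assoc] at h6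
      linarith
    calc (S.card : ℝ) * δ = ∑ b ∈ S, δ := by simp
      _ ≤ ∑ b ∈ S, |evT T z (ind (r b))| := Finset.sum_le_sum hbig
      _ ≤ ‖evT T z‖ := F1 _ _ _ hrd
      _ ≤ ‖T‖ := norm_evT_le _ _
  have hS : ∀ m, ∃ (S : Finset (Set ℕ)) (v' : Clopens K), v' ≠ ⊥ ∧ v' ≤ v m ∧
      ∀ b ∈ W, b ∉ S → ∀ z ∈ v', |T (ind (α b)) z - t m b| ≤ 2 * δ := by
    intro m
    let Q : Finset (Set ℕ) → Prop := fun S => (∀ b ∈ S, b ∈ W) ∧ ∃ z ∈ v m,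
      ∀ b ∈ S, 2 * δ < |T (ind (α b)) z - t m b|
    have hQ : ∃ S, Q S ∧ ∀ S', Q S' → S'.card ≤ S.card := by
      let A : Set ℕ := {n | ∃ S, Q S ∧ S.card = n}
      have hA : A.Nonempty := by
        obtain ⟨z, hz⟩ := ne_bot_iff.1 (hv0 m)
        exact ⟨0, ∅, ⟨by simp, z, hz, by simp⟩, rfl⟩
      have hB : BddAbove A := by
        refine ⟨⌊‖T‖ / δ⌋₊, ?_⟩
        rintro n ⟨S, ⟨h1, z, hz, h2⟩, rfl⟩
        apply Nat.le_floor
        rw [le_div_iff₀ hδ0]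
        exact claim m S h1 z hz h2
      obtain ⟨S, hS, hc⟩ := Nat.sSup_mem hA hB
      exact ⟨S, hS, fun S' hS' => hc ▸ le_csSup hB ⟨S', hS', rfl⟩⟩
    obtain ⟨S, ⟨hSW, z, hz, hzb⟩, hmax⟩ := hQ
    obtain ⟨c, hzc, hcU⟩ := exists_clopen_nhd (x := z)
      (U := (v m : Set K) ∩ ⋂ b ∈ S, {w | 2 * δ < |T (ind (α b)) w - t m b|})
      ((v m).isOpen.inter (isOpen_biInter_finset fun b _ =>
        isOpen_lt continuous_const (by fun_prop))) ⟨hz, Set.mem_iInter₂.2 hzb⟩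
    refine ⟨S, c, ne_bot_iff.2 ⟨z, hzc⟩, fun w hw => (hcU hw).1, ?_⟩
    intro b hb hbS w hw
    by_contra hcon
    push Not at hcon
    have := hmax (insert b S) ⟨?_, w, (hcU hw).1, ?_⟩
    · rw [Finset.card_insert_of_notMem hbS] at this
      omega
    · intro b' hb'
      rcases Finset.mem_insert.1 hb' with rfl | hb'
      · exact hb
      · exact hSW b' hb'
    · intro b' hb'
      rcases Finset.mem_insert.1 hb' with rfl | hb'
      · exact hcon
      · exact Set.mem_iInter₂.1 (hcU hw).2 b' hb'
  choose S v' hv'0 hv'v hv'b using hS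
  have h3 := hα3 v' hv'0 (fun m n => (hva m n).mono_left (hv'v m))
  have hcount : (⋃ m, ((S m : Finset (Set ℕ)) : Set (Set ℕ))).Countable :=
    Set.countable_iUnion fun m => (S m).countable_toSet
  obtain ⟨b, ⟨hbW, hbn⟩, hbS⟩ : ∃ b, b ∈ {b ∈ W | ¬ ∃ c : Clopens K, (∀ m ∈ b, v' m ≤ c) ∧
      (∀ m, m ∉ b → Disjoint (v' m) c)} ∧ b ∉ ⋃ m, ((S m : Finset (Set ℕ)) : Set (Set ℕ)) := by
    by_contra hcon
    exact h3 (hcount.mono fun b hb => by_contra fun hb2 => hcon ⟨b, hb, hb2⟩)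
  have hbS' : ∀ m, b ∉ S m := fun m hm => hbS (Set.mem_iUnion.2 ⟨m, hm⟩)
  apply hbn
  obtain ⟨c, hc1, hc2⟩ := exists_between (K := K) (F := {z | ε - 2 * δ ≤ |T (ind (α b)) z|})
    (U := {z | 2 * δ < |T (ind (α b)) z|})
    (isClosed_le continuous_const (by fun_prop)) (isOpen_lt continuous_const (by fun_prop))
    (fun x hx => lt_of_lt_of_le (by linarith) (show ε - 2 * δ ≤ _ from hx))
  refine ⟨c, fun m hm z hz => ?_, fun m hm => ?_⟩
  · apply hc1
    have h4 := hv'b m b hbW (hbS' m) z hz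
    simp only [t, hm, if_true] at h4
    have h5 := h m
    have h6 := abs_sub_abs_le_abs_sub (T (ind (a m)) (y m)) (T (ind (α b)) z)
    rw [abs_sub_comm] at h6
    change ε - 2 * δ ≤ _
    linarith
  · rw [disj_iff]
    intro z hz hzc
    have h4 := hv'b m b hbW (hbS' m) z hz
    simp only [t, hm, if_false, sub_zero] at h4
    exact absurd (hc2 hzc) (not_lt.2 h4)

theorem Good.WM' (hK : Good K) (T : C(K, ℝ) →L[ℝ] C(K, ℝ)) {ε : ℝ} (hε : 0 < ε)
    (P : Clopens K → Prop) (R₀ : Clopens K) (h0 : P R₀)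
    (h : ∀ R, P R → ∃ R' ≤ R, P R' ∧ ∃ c ≤ R, Disjoint c R' ∧ ∃ y, y ∉ c ∧ ε < |T (ind c) y|) :
    False := by
  have h' : ∀ R : {R // P R}, ∃ R' : {R // P R}, R'.1 ≤ R.1 ∧ ∃ c ≤ R.1, Disjoint c R'.1 ∧
      ∃ y, y ∉ c ∧ ε < |T (ind c) y| := by
    rintro ⟨R, hR⟩
    obtain ⟨R', h1, h2, h3⟩ := h R hR
    exact ⟨⟨R', h2⟩, h1, h3⟩
  choose g hg c hc hd y hy hyε using h'
  let r : ℕ → {R // P R} := fun n => g^[n] ⟨R₀, h0⟩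
  have hr : ∀ n, r (n + 1) = g (r n) := fun n => Function.iterate_succ_apply' g n _
  have hanti : Antitone (fun n => (r n).1) := antitone_nat_of_succ_le fun n => by
    rw [hr]; exact hg _
  refine hK.WM T (fun n => c (r n)) ?_ (fun n => y (r n)) (fun n => hy _) hε (fun n => hyε _)
  rw [pairwise_disjoint_on]
  intro i j hij
  have h1 : c (r j) ≤ (g (r i)).1 := by
    rw [← hr]
    exact (hc _).trans (hanti hij)
  exact (hd (r i)).mono_right h1

end P3
end FK


set_option linter.unusedSectionVars false
namespace FK
open TopologicalSpace Topology
section P4a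
variable {K : Type} [TopologicalSpace K] [CompactSpace K] [T2Space K] [TotallyDisconnectedSpace K]

lemma alpha_decomp {a : ℕ → Clopens K} (ha : Pairwise (Function.onFun Disjoint a)) {A : Clopens K}
    {b : Set ℕ} [DecidablePred (· ∈ b)]
    (h : ∀ n, (n ∈ b → a n ≤ A) ∧ (n ∉ b → Disjoint (a n) A)) (N : ℕ) :
    ind A = ind (A \ (Finset.range N).sup a) + ∑ n ∈ (Finset.range N).filter (· ∈ b), ind (a n) := by
  rw [← ind_fsup _ _ (fun i _ j _ hij => ha hij), ← ind_sup]
  · congr 1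
    ext x
    change x ∈ A ↔ x ∈ A \ _ ⊔ _
    rw [mem_sup]
    constructor
    · intro hx
      by_cases hxa : x ∈ (Finset.range N).sup a
      · right
        obtain ⟨i, hi, hxi⟩ := mem_fsup.1 hxa
        refine mem_fsup.2 ⟨i, Finset.mem_filter.2 ⟨hi, ?_⟩, hxi⟩
        by_contra hib
        exact disj_iff.1 ((h i).2 hib) x hxi hx
      · exact Or.inl ⟨hx, hxa⟩
    · rintro (hx | hx)
      · exact hx.1
      · obtain ⟨i, hi, hxi⟩ := mem_fsup.1 hx
        exact (h i).1 (Finset.mem_filter.1 hi).2 hxi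
  · exact disjoint_sdiff_self_left.mono_right (Finset.sup_mono (Finset.filter_subset _ _))

lemma Good.SB (hK : Good K) (T : C(K, ℝ) →L[ℝ] C(K, ℝ)) (a : ℕ → Clopens K) (W : Set (Set ℕ))
    (α : Set ℕ → Clopens K) (hW : ¬ W.Countable)
    (h2 : ∀ b ∈ W, ∀ b' ∈ W, b ≠ b' → ∃ N, α b ⊓ α b' ≤ (Finset.range N).sup a) :
    ∃ b ∈ W, ∀ ε > 0, ∃ N, ∀ c ≤ α b \ (Finset.range N).sup a, ∀ y, y ∉ c → |T (ind c) y| ≤ ε := by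
  have hfin : ∀ ε > 0, {b ∈ W | ∀ N, ∃ c ≤ α b \ (Finset.range N).sup a, ∃ y, y ∉ c ∧
      ε < |T (ind c) y|}.Finite := by
    intro ε hε
    by_contra hinf
    rw [← Set.Infinite] at hinf
    set b : ℕ → Set ℕ := fun n => ((Set.Infinite.natEmbedding _ hinf) n : Set ℕ) with hb
    have hbinj : ∀ i j, i ≠ j → b i ≠ b j := fun i j hij h =>
      hij ((Set.Infinite.natEmbedding _ hinf).injective (Subtype.ext h))
    have hbm := fun n => (Set.Infinite.natEmbedding _ hinf n).2
    have hN : ∀ i j, ∃ N, j < i → α (b i) ⊓ α (b j) ≤ (Finset.range N).sup a := by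
      intro i j
      by_cases hij : j < i
      · obtain ⟨N, hN⟩ := h2 (b i) (hbm i).1 (b j) (hbm j).1 (hbinj i j (by omega))
        exact ⟨N, fun _ => hN⟩
      · exact ⟨0, fun h => (hij h).elim⟩
    choose N hN using hN
    have hc := fun i => (hbm i).2 ((Finset.range i).sup fun j => N i j)
    choose c hc y hy hyε using hc
    refine hK.WM T c ?_ y hy hε hyε
    rw [pairwise_disjoint_on]
    intro j i hij
    rw [disj_iff]
    intro x hxj hxi
    refine (hc i hxi).2 ?_
    have h3 := hN i j hij ⟨(hc i hxi).1, (hc j hxj).1⟩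
    have h4 : (Finset.range (N i j)).sup a ≤
        (Finset.range ((Finset.range i).sup fun j => N i j)).sup a :=
      Finset.sup_mono (Finset.range_mono (Finset.le_sup (f := fun j => N i j)
        (Finset.mem_range.2 hij)))
    exact h4 h3
  by_contra hcon
  push Not at hcon
  apply hW
  refine Set.Countable.mono ?_ (Set.countable_iUnion fun k : ℕ =>
    (hfin (1 / ((k : ℝ) + 1)) (by positivity)).countable)
  intro b hb
  obtain ⟨ε, hε, h⟩ := hcon b hb
  obtain ⟨k, hk⟩ := exists_nat_one_div_lt hε
  refine Set.mem_iUnion.2 ⟨k, hb, fun N => ?_⟩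
  obtain ⟨c, hc, y, hy, hyε⟩ := h N
  exact ⟨c, hc, y, hy, hk.trans hyε⟩

def Loc (T : C(K, ℝ) →L[ℝ] C(K, ℝ)) (a : Clopens K) : Prop :=
  ∀ c ≤ a, ∀ y, y ∉ c → T (ind c) y = 0

lemma Loc.mono {T : C(K, ℝ) →L[ℝ] C(K, ℝ)} {a b : Clopens K} (h : Loc T a) (hb : b ≤ a) :
    Loc T b := fun c hc => h c (hc.trans hb)

lemma Loc.eq {T : C(K, ℝ) →L[ℝ] C(K, ℝ)} {e c : Clopens K} (h : Loc T e) (hc : c ≤ e) {y : K}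
    (hy : y ∈ c) : T (ind c) y = T (ind e) y := by
  have h1 := h (e \ c) sdiff_le y (fun h => h.2 hy)
  rw [ind_sdiff hc, map_sub, ContinuousMap.sub_apply] at h1
  linarith

lemma Good.loc (hK : Good K) (T : C(K, ℝ) →L[ℝ] C(K, ℝ)) (U : Clopens K) (hU : U ≠ ⊥) :
    ∃ e ≤ U, e ≠ ⊥ ∧ Loc T e := by
  have h' : ∀ c : {c : Clopens K // c ≠ ⊥}, ∃ e : {c : Clopens K // c ≠ ⊥}, e.1 < c.1 := by
    rintro ⟨c, hc⟩
    obtain ⟨e, h1, h2⟩ := hK.perf c hc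
    exact ⟨⟨e, h1⟩, h2⟩
  choose g hg using h'
  let d : ℕ → {c : Clopens K // c ≠ ⊥} := fun n => g^[n] ⟨U, hU⟩
  have hd : ∀ n, d (n + 1) = g (d n) := fun n => Function.iterate_succ_apply' g n _
  have hanti : Antitone (fun n => (d n).1) := antitone_nat_of_succ_le fun n => by
    rw [hd]; exact (hg _).le
  let a : ℕ → Clopens K := fun n => (d n).1 \ (d (n + 1)).1
  have ha0 : ∀ n, a n ≠ ⊥ := by
    intro n h
    have h1 := sdiff_eq_bot_iff.1 h
    rw [hd] at h1
    exact absurd (hg (d n)) (not_lt_of_ge h1)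
  have haU : ∀ n, a n ≤ U := fun n => sdiff_le.trans (hanti (Nat.zero_le n))
  have ha : Pairwise (Function.onFun Disjoint a) := by
    rw [pairwise_disjoint_on]
    intro i j hij
    have h1 : a j ≤ (d (i + 1)).1 := sdiff_le.trans (hanti hij)
    exact disjoint_sdiff_self_left.mono_right h1
  obtain ⟨W, α, hW, hinf, hα1, hα2, -⟩ := hK.p2 a ha
  obtain ⟨b, hb, hsb⟩ := hK.SB T a W α hW hα2
  obtain ⟨e, he, he2⟩ := hK.p1 (fun N => U ⊓ (α b \ (Finset.range N).sup a)) (by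
      intro i j hij
      exact inf_le_inf le_rfl (sdiff_le_sdiff le_rfl (Finset.sup_mono (Finset.range_mono hij)))) (by
      intro N
      obtain ⟨n, hn, hnN⟩ := (hinf b hb).exists_gt N
      obtain ⟨x, hx⟩ := ne_bot_iff.1 (ha0 n)
      refine ne_bot_iff.2 ⟨x, haU n hx, (hα1 b hb n).1 hn hx, fun hxs => ?_⟩
      obtain ⟨i, hi, hxi⟩ := mem_fsup.1 hxs
      have : i ≠ n := by
        have := Finset.mem_range.1 hi
        omega
      exact disj_iff.1 (ha this) x hxi hx)
  refine ⟨e, (he2 0).trans inf_le_left, he, fun c hc y hy => ?_⟩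
  rw [← abs_nonpos_iff]
  apply le_of_forall_pos_le_add
  intro ε hε
  obtain ⟨N, hN⟩ := hsb ε hε
  rw [zero_add]
  exact hN c (hc.trans ((he2 N).trans inf_le_right)) y hy

lemma Good.bd (hK : Good K) (T : C(K, ℝ) →L[ℝ] C(K, ℝ)) (hT : Function.Injective T) :
    ∃ η > 0, ∀ e, Loc T e → ∀ y ∈ e, η ≤ |T (ind e) y| := by
  classical
  by_contra hcon
  push Not at hcon
  have hstep : ∀ η > 0, ∃ (v : Clopens K) (t : ℝ), (v ≠ ⊥ ∧ Loc T v ∧ (∀ c ≤ v, ∀ z ∈ c, T (ind c) z = t) ∧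
      t ≠ 0) ∧ |t| < η := by
    intro η hη
    obtain ⟨e, he, y, hy, hyη⟩ := hcon η hη
    obtain ⟨v, hv, hv2⟩ := hK.const (fun i : Bool => if i then T (ind e) else ind e) y
    have hve : v ≤ e := fun z hz => (ind_eq_iff (hv2 z hz false)).2 hy
    have hvt : ∀ z ∈ v, T (ind e) z = T (ind e) y := fun z hz => hv2 z hz true
    have hvc : ∀ c ≤ v, ∀ z ∈ c, T (ind c) z = T (ind e) y := fun c hc z hz => by
      rw [he.eq (hc.trans hve) hz, hvt z (hc hz)]
    refine ⟨v, T (ind e) y, ⟨hv, he.mono hve, hvc, fun h0 => ?_⟩, hyη⟩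
    obtain ⟨x, hx⟩ := ne_bot_iff.1 hv
    have : T (ind v) = T 0 := by
      rw [map_zero]
      ext z
      by_cases hz : z ∈ v
      · rw [hvc v le_rfl z hz, h0]; rfl
      · rw [he.mono hve v le_rfl z hz]; rfl
    have h1 := congrArg (fun f : C(K, ℝ) => f x) (hT this)
    simp [ind_of_mem hx] at h1
  obtain ⟨f, hf1, hf2⟩ := exists_seq_of_forall_finset_exists
    (P := fun p : Clopens K × ℝ => p.1 ≠ ⊥ ∧ Loc T p.1 ∧ (∀ c ≤ p.1, ∀ z ∈ c, T (ind c) z = p.2) ∧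
      p.2 ≠ 0)
    (r := fun p q => |q.2| < |p.2| / 2) (by
      intro s hs
      have : ∃ η > 0, ∀ p ∈ s, η ≤ |p.2| / 2 := by
        rcases s.eq_empty_or_nonempty with rfl | hne
        · exact ⟨1, one_pos, by simp⟩
        · refine ⟨s.inf' hne (fun p => |p.2| / 2), ?_, fun p hp => Finset.inf'_le _ hp⟩
          rw [gt_iff_lt, Finset.lt_inf'_iff]
          intro p hp
          have := abs_pos.2 (hs p hp).2.2.2
          positivity
      obtain ⟨η, hη, hηs⟩ := this
      obtain ⟨v, t, h1, h2⟩ := hstep η hη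
      exact ⟨(v, t), h1, fun p hp => h2.trans_le (hηs p hp)⟩)
  let a : ℕ → Clopens K := fun n => (f n).1
  let t : ℕ → ℝ := fun n => (f n).2
  have hbot : ∀ n, a n ≠ ⊥ := fun n => (hf1 n).1
  have hloc : ∀ n, Loc T (a n) := fun n => (hf1 n).2.1
  have hval : ∀ n, ∀ c ≤ a n, ∀ z ∈ c, T (ind c) z = t n := fun n => (hf1 n).2.2.1
  have ht2 : ∀ m n, m < n → |t n| < |t m| / 2 := hf2
  have ha : Pairwise (Function.onFun Disjoint a) := by
    rw [pairwise_disjoint_on]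
    intro i j hij
    rw [disj_iff]
    intro x hxi hxj
    have h1 := hval i (a i ⊓ a j) inf_le_left x ⟨hxi, hxj⟩
    have h2 := hval j (a i ⊓ a j) inf_le_right x ⟨hxi, hxj⟩
    have h3 := ht2 i j hij
    rw [h1] at h2
    rw [h2] at h3
    linarith [abs_nonneg (t j)]
  have htp : ∀ n, |t n| ≤ |t 0| * (1 / 2) ^ n := by
    intro n
    induction n with
    | zero => simp
    | succ n ih =>
      have := ht2 n (n + 1) (Nat.lt_succ_self n)
      rw [pow_succ]
      linarith
  have htt : Tendsto (fun n => |t n|) atTop (𝓝 0) := by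
    have h1 : Tendsto (fun n : ℕ => |t 0| * (1 / 2 : ℝ) ^ n) atTop (𝓝 (|t 0| * 0)) :=
      (tendsto_pow_atTop_nhds_zero_of_lt_one (by norm_num) (by norm_num)).const_mul _
    rw [mul_zero] at h1
    exact squeeze_zero (fun n => abs_nonneg _) htp h1
  obtain ⟨W, α, hW, hinf, hα1, hα2, -⟩ := hK.p2 a ha
  obtain ⟨b, hb, hsb⟩ := hK.SB T a W α hW hα2
  have hdec : ∀ N y, (∀ k, k < N → y ∉ a k) →
      T (ind (α b)) y = T (ind (α b \ (Finset.range N).sup a)) y := by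
    intro N y hy
    have h1 := alpha_decomp ha (hα1 b hb) N
    have h2 := congrArg (fun f => T f y) h1
    simp only [map_add, map_sum, ContinuousMap.add_apply, ContinuousMap.sum_apply] at h2
    rw [h2, Finset.sum_eq_zero, add_zero]
    intro i hi
    exact hloc i _ le_rfl y (hy i (Finset.mem_range.1 (Finset.mem_filter.1 hi).1))
  -- common point
  obtain ⟨x, hx⟩ : (⋂ j : ℕ, ((α b \ (Finset.range j).sup a : Clopens K) : Set K) ∩
      {y | |T (ind (α b)) y| ≤ 1 / ((j : ℝ) + 1)}).Nonempty := by
    apply IsCompact.nonempty_iInter_of_sequence_nonempty_isCompact_isClosed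
    · intro i z hz
      refine ⟨?_, ?_⟩
      · exact sdiff_le_sdiff (le_refl (α b)) (Finset.sup_mono (Finset.range_mono (Nat.le_succ i))) hz.1
      · refine le_trans (show |T (ind (α b)) z| ≤ _ from hz.2) ?_
        apply one_div_le_one_div_of_le (by positivity)
        push_cast
        linarith
    · intro j
      obtain ⟨N, hN⟩ := hsb (1 / (2 * ((j : ℝ) + 1))) (by positivity)
      have h1 := htt.eventually (gt_mem_nhds (show 0 < 1 / (2 * ((j : ℝ) + 1)) by positivity))
      obtain ⟨M, hM⟩ := eventually_atTop.1 h1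
      obtain ⟨n, hnb, hn⟩ := (hinf b hb).exists_gt (max (max N j) M)
      obtain ⟨y, hy⟩ := ne_bot_iff.1 (hbot n)
      have hya : ∀ k, k < n → y ∉ a k := fun k hk h => disj_iff.1 (ha (ne_of_lt hk)) y h hy
      have hN1 : N < n := lt_of_le_of_lt ((le_max_left _ _).trans (le_max_left _ _)) hn
      have hj1 : j < n := lt_of_le_of_lt ((le_max_right _ _).trans (le_max_left _ _)) hn
      have hM1 : M ≤ n := ((le_max_right _ _).trans hn.le)
      have hyα : y ∈ α b := (hα1 b hb n).1 hnb hy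
      have hys : ∀ i, i ≤ n → y ∉ (Finset.range i).sup a := by
        intro i hi h
        obtain ⟨k, hk, hyk⟩ := mem_fsup.1 h
        exact hya k (lt_of_lt_of_le (Finset.mem_range.1 hk) hi) hyk
      refine ⟨y, ⟨hyα, hys j hj1.le⟩, ?_⟩
      have hd := hdec N y (fun k hk => hya k (hk.trans hN1))
      have hle : a n ≤ α b \ (Finset.range N).sup a := by
        intro z hz
        refine ⟨(hα1 b hb n).1 hnb hz, fun h => ?_⟩
        obtain ⟨k, hk, hzk⟩ := mem_fsup.1 h
        have := Finset.mem_range.1 hk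
        exact disj_iff.1 (ha (show k ≠ n by omega)) z hzk hz
      have h3 := hN ((α b \ (Finset.range N).sup a) \ a n) sdiff_le y (fun h => h.2 hy)
      rw [ind_sdiff hle, map_sub, ContinuousMap.sub_apply, ← hd, hval n (a n) le_rfl y hy] at h3
      have h4 := hM n hM1
      have h5 := abs_sub_abs_le_abs_sub (T (ind (α b)) y) (t n)
      change |T (ind (α b)) y| ≤ 1 / ((j : ℝ) + 1)
      have h6 : 1 / ((j : ℝ) + 1) = 1 / (2 * ((j : ℝ) + 1)) + 1 / (2 * ((j : ℝ) + 1)) := by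
        field_simp; norm_num
      linarith
    · exact (((Clopens.isClosed _)).inter (isClosed_le (by fun_prop) continuous_const)).isCompact
    · intro i
      exact ((Clopens.isClosed _)).inter (isClosed_le (by fun_prop) continuous_const)
  rw [Set.mem_iInter] at hx
  have hxα : x ∈ α b := (hx 0).1.1
  have hxa : ∀ k, x ∉ a k := fun k hk =>
    (hx (k + 1)).1.2 (mem_fsup.2 ⟨k, Finset.self_mem_range_succ k, hk⟩)
  have hx0 : T (ind (α b)) x = 0 := by
    rw [← abs_nonpos_iff]
    apply le_of_forall_pos_le_add
    intro ε hε
    obtain ⟨k, hk⟩ := exists_nat_one_div_lt hε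
    have := (hx k).2
    change |T (ind (α b)) x| ≤ _ at this
    linarith
  obtain ⟨U, hU, hU2⟩ := hK.const (fun i : Option (Option ℕ) => match i with
    | none => T (ind (α b))
    | some none => ind (α b)
    | some (some k) => ind (a k)) x
  have hUα : U ≤ α b := fun z hz => (ind_eq_iff (hU2 z hz (some none))).2 hxα
  have hUa : ∀ z ∈ U, ∀ k, z ∉ a k := fun z hz k h =>
    hxa k ((ind_eq_iff (hU2 z hz (some (some k)))).1 h)
  have hU0 : ∀ z ∈ U, T (ind (α b)) z = 0 := fun z hz => (hU2 z hz none).trans hx0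
  have hUN : ∀ N, U ≤ α b \ (Finset.range N).sup a := by
    intro N z hz
    refine ⟨hUα hz, fun h => ?_⟩
    obtain ⟨k, _, hzk⟩ := mem_fsup.1 h
    exact hUa z hz k hzk
  have hTU : T (ind U) = T 0 := by
    rw [map_zero]
    ext y
    change T (ind U) y = 0
    rw [← abs_nonpos_iff]
    apply le_of_forall_pos_le_add
    intro ε hε
    rw [zero_add]
    obtain ⟨N, hN⟩ := hsb ε hε
    by_cases hy : y ∈ U
    · have h1 := hN ((α b \ (Finset.range N).sup a) \ U) sdiff_le y (fun h => h.2 hy)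
      rw [ind_sdiff (hUN N), map_sub, ContinuousMap.sub_apply,
        ← hdec N y (fun k _ => hUa y hy k), hU0 y hy, zero_sub, abs_neg] at h1
      exact h1
    · exact hN U (hUN N) y hy
  obtain ⟨z, hz⟩ := ne_bot_iff.1 hU
  have h1 := congrArg (fun f : C(K, ℝ) => f z) (hT hTU)
  simp [ind_of_mem hz] at h1

end P4a
end FK


set_option linter.unusedSectionVars false
namespace FK
open TopologicalSpace Topology
section P4b
variable {K : Type} [TopologicalSpace K] [CompactSpace K] [T2Space K] [TotallyDisconnectedSpace K]

structure Setup (T : C(K, ℝ) →L[ℝ] C(K, ℝ)) (s : Finset (Clopens K)) (x : Clopens K → K)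
    (ε η : ℝ) : Prop where
  hη : 0 < η
  hε : ε = η / 32
  disj : (s : Set (Clopens K)).PairwiseDisjoint id
  cov : ∀ y : K, ∃ p ∈ s, y ∈ p
  mem : ∀ p ∈ s, x p ∈ p
  nice : ∀ p ∈ s, ∀ c ≤ p, x p ∉ c → ∀ y, y ∉ c → |T (ind c) y| ≤ ε
  loc : ∀ U : Clopens K, U ≠ ⊥ → ∃ e ≤ U, e ≠ ⊥ ∧ Loc T e
  bd : ∀ e, Loc T e → ∀ y ∈ e, η ≤ |T (ind e) y|

def Nice (T : C(K, ℝ) →L[ℝ] C(K, ℝ)) (ε : ℝ) (p : Clopens K) : Prop :=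
  ∃ x ∈ p, ∀ c ≤ p, x ∉ c → ∀ y, y ∉ c → |T (ind c) y| ≤ ε

lemma Good.setup (hK : Good K) (T : C(K, ℝ) →L[ℝ] C(K, ℝ)) (hT : Function.Injective T) [Nonempty K] :
    ∃ s x ε η, Setup T s x ε η := by
  obtain ⟨η, hη, hbd⟩ := hK.bd T hT
  have hε : 0 < η / 32 := by positivity
  obtain ⟨s, h1, h2, h3⟩ := cover (K := K) (P := fun c => ∃ x, ∀ d ≤ c, x ∉ d → ∀ y, y ∉ d → |T (ind d) y| ≤ η / 32)
    (fun a b ⟨x, hx⟩ hb => ⟨x, fun d hd => hx d (hd.trans hb)⟩) (by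
      intro x
      by_contra hcon
      push Not at hcon
      refine hK.WM' T hε (fun R => x ∈ R) ⊤ trivial ?_
      intro R hR
      obtain ⟨d, hd, hxd, y, hy, hyε⟩ := hcon R hR x
      exact ⟨R \ d, sdiff_le, ⟨hR, hxd⟩, d, hd, disjoint_sdiff_self_right, y, hy, hyε⟩)
  have h4 : ∀ c, ∃ x, c ∈ s → x ∈ c ∧ ∀ d ≤ c, x ∉ d → ∀ y, y ∉ d → |T (ind d) y| ≤ η / 32 := by
    intro c
    by_cases hc : c ∈ s
    · obtain ⟨hb, x, hx⟩ := h1 c hc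
      by_cases hxc : x ∈ c
      · exact ⟨x, fun _ => ⟨hxc, hx⟩⟩
      · obtain ⟨z, hz⟩ := ne_bot_iff.1 hb
        exact ⟨z, fun _ => ⟨hz, fun d hd _ => hx d hd (fun h => hxc (hd h))⟩⟩
    · exact ⟨Classical.arbitrary K, fun h => (hc h).elim⟩
  choose x hx using h4
  exact ⟨s, x, η / 32, η, hη, rfl, h2, h3, fun p hp => (hx p hp).1, fun p hp => (hx p hp).2,
    fun U hU => hK.loc T U hU, hbd⟩

noncomputable def GG (T : C(K, ℝ) →L[ℝ] C(K, ℝ)) (s : Finset (Clopens K)) : C(K, ℝ) →L[ℝ] C(K, ℝ) :=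
  ∑ p ∈ s, (ContinuousLinearMap.mul ℝ C(K, ℝ) (ind p)) ∘L T ∘L (ContinuousLinearMap.mul ℝ C(K, ℝ) (ind p))

noncomputable def EE (s : Finset (Clopens K)) (x : Clopens K → K) : C(K, ℝ) →L[ℝ] C(K, ℝ) :=
  ∑ p ∈ s, (ContinuousMap.evalCLM ℝ (x p)).smulRight (ind p)

namespace Setup
variable {T : C(K, ℝ) →L[ℝ] C(K, ℝ)} {s : Finset (Clopens K)} {x : Clopens K → K} {ε η : ℝ}
variable (S : Setup T s x ε η)
include S

lemma G_apply {p : Clopens K} (hp : p ∈ s) {y : K} (hy : y ∈ p) (f : C(K, ℝ)) :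
    GG T s f y = T (f * ind p) y := by
  have h := sum_ind_apply s id S.disj (fun q => T (f * ind q) y) hp hy
  rw [← h]
  simp [GG, mul_comm]

lemma E_apply {p : Clopens K} (hp : p ∈ s) {y : K} (hy : y ∈ p) (f : C(K, ℝ)) :
    EE s x f y = f (x p) := by
  have h := sum_ind_apply s id S.disj (fun q => f (x q)) hp hy
  rw [← h]
  simp [EE]

lemma epos : 0 < ε := by rw [S.hε]; linarith [S.hη]

lemma dense (R : Clopens K) (Pr : K → Prop) (hPr : IsClosed {y | Pr y})
    (h : ∀ e, Loc T e → ∀ y ∈ e, y ∈ R → Pr y) : ∀ y ∈ R, Pr y := by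
  intro y hy
  by_contra hn
  obtain ⟨c, hc, hcU⟩ := exists_clopen_nhd (hPr.isOpen_compl.inter R.isOpen)
    (show y ∈ {y | Pr y}ᶜ ∩ (R : Set K) from ⟨hn, hy⟩)
  obtain ⟨e, he, hne, hl⟩ := S.loc c (ne_bot_iff.2 ⟨y, hc⟩)
  obtain ⟨z, hz⟩ := ne_bot_iff.1 hne
  exact (hcU (he hz)).1 (h e hl z hz (hcU (he hz)).2)

omit S in
lemma T_small (T : C(K, ℝ) →L[ℝ] C(K, ℝ)) (f : C(K, ℝ)) {κ : ℝ} (hκ : 0 ≤ κ) (c : Clopens K)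
    (h : ∀ z ∈ c, |f z| ≤ κ) (y : K) : |T (f * ind c) y| ≤ ‖T‖ * κ := by
  refine ((T (f * ind c)).norm_coe_le_norm y).trans ((T.le_opNorm _).trans ?_)
  gcongr
  rw [ContinuousMap.norm_le _ hκ]
  intro z
  by_cases hz : z ∈ c
  · simpa [ind_of_mem hz] using h z hz
  · simpa [ind_of_not hz] using hκ

lemma big {p : Clopens K} (hp : p ∈ s) {R : Clopens K} (hR : R ≤ p) (hx : x p ∉ R) {y : K}
    (hy : y ∉ R) (f : C(K, ℝ)) : |T (f * ind R) y| ≤ 2 * ε * ‖f‖ :=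
  SM (evT T y) (fun a ha => S.nice p hp a (ha.trans hR) (fun h => hx (ha h)) y (fun h => hy (ha h))) f

lemma star (f : C(K, ℝ)) (hf : ∀ p ∈ s, f (x p) = 0) {e : Clopens K} (he : Loc T e) {y : K}
    (hy : y ∈ e) : |GG T s f y - T (ind e) y * f y| ≤ 2 * ε * ‖f‖ := by
  obtain ⟨p, hp, hyp⟩ := S.cov y
  rw [S.G_apply hp hyp]
  apply le_of_forall_pos_le_add
  intro δ hδ
  set κ := δ / (2 * (‖T‖ + 1)) with hκ
  have hT0 := norm_nonneg T
  have hκ0 : 0 < κ := by positivity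
  obtain ⟨a, ha1, ha2⟩ := exists_level f hκ0
  have hxa : x p ∉ a := by
    intro h
    have := ha1 _ h
    rw [hf p hp, abs_zero] at this
    linarith
  obtain ⟨c, hyc, hc⟩ := exists_clopen_nhd (x := y)
    (U := ((e ⊓ p : Clopens K) : Set K) ∩ {z | |f z - f y| < κ})
    ((Clopens.isOpen _).inter (isOpen_lt (by fun_prop) continuous_const))
    ⟨⟨hy, hyp⟩, by simpa using hκ0⟩
  have hce : c ≤ e := fun z hz => (hc hz).1.1
  have hcp : c ≤ p := fun z hz => (hc hz).1.2
  have hdec : f * ind p = (f - ContinuousMap.const K (f y)) * ind c + (f y) • ind c +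
      f * ind ((p \ c) \ a) + f * ind ((p \ c) ⊓ a) := by
    ext z
    have h1 : z ∈ c → z ∈ p := fun h => hcp h
    by_cases hzc : z ∈ c <;> by_cases hzp : z ∈ p <;> by_cases hza : z ∈ a <;>
      simp_all [ind_of_mem, ind_of_not, mem_sdiff, mem_inf]
  have h1 := T_small T (f - ContinuousMap.const K (f y)) hκ0.le c
    (fun z hz => (show |f z - f y| < κ from (hc hz).2).le) y
  have h2 := T_small T f hκ0.le ((p \ c) \ a) (fun z hz => ha2 z hz.2) y
  have h3 := S.big hp (R := (p \ c) ⊓ a) (inf_le_left.trans sdiff_le) (fun h => hxa h.2)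
    (y := y) (fun h => h.1.2 hyc) f
  rw [hdec, map_add, map_add, map_add, map_smul]
  simp only [ContinuousMap.add_apply, ContinuousMap.smul_apply, smul_eq_mul]
  rw [he.eq hce hyc]
  have h4 : ‖T‖ * κ ≤ δ / 2 := by
    rw [hκ]
    rw [mul_div_assoc', div_le_div_iff₀ (by positivity) (by positivity)]
    nlinarith
  rw [abs_le] at *
  constructor <;> nlinarith

lemma star' (f : C(K, ℝ)) (hf : ∀ p ∈ s, f (x p) = 0) {p : Clopens K} (hp : p ∈ s) :
    |GG T s f (x p)| ≤ 2 * ε * ‖f‖ := by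
  rw [S.G_apply hp (S.mem p hp)]
  apply le_of_forall_pos_le_add
  intro δ hδ
  set κ := δ / ((‖T‖ + 1)) with hκ
  have hT0 := norm_nonneg T
  have hκ0 : 0 < κ := by positivity
  obtain ⟨a, ha1, ha2⟩ := exists_level f hκ0
  have hxa : x p ∉ a := by
    intro h
    have := ha1 _ h
    rw [hf p hp, abs_zero] at this
    linarith
  have hdec : f * ind p = f * ind (p \ a) + f * ind (p ⊓ a) := by
    ext z
    by_cases hzp : z ∈ p <;> by_cases hza : z ∈ a <;>
      simp_all [ind_of_mem, ind_of_not, mem_sdiff, mem_inf]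
  have h2 := T_small T f hκ0.le (p \ a) (fun z hz => ha2 z hz.2) (x p)
  have h3 := S.big hp (R := p ⊓ a) inf_le_left (fun h => hxa h.2)
    (y := x p) (fun h => hxa h.2) f
  rw [hdec, map_add]
  simp only [ContinuousMap.add_apply]
  have h4 : ‖T‖ * κ ≤ δ := by
    rw [hκ]
    rw [mul_div_assoc', div_le_iff₀ (by positivity)]
    nlinarith
  rw [abs_le] at *
  constructor <;> nlinarith

end Setup

noncomputable def AA (T : C(K, ℝ) →L[ℝ] C(K, ℝ)) (s : Finset (Clopens K)) (x : Clopens K → K) :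
    C(K, ℝ) →L[ℝ] C(K, ℝ) := GG T s ∘L (1 - EE s x) + EE s x

lemma AA_apply (T : C(K, ℝ) →L[ℝ] C(K, ℝ)) (s : Finset (Clopens K)) (x : Clopens K → K) (f : C(K, ℝ)) :
    AA T s x f = GG T s (f - EE s x f) + EE s x f := rfl

namespace Setup
variable {T : C(K, ℝ) →L[ℝ] C(K, ℝ)} {s : Finset (Clopens K)} {x : Clopens K → K} {ε η : ℝ}
variable (S : Setup T s x ε η)
include S

lemma E_norm {f : C(K, ℝ)} {C : ℝ} (hC : 0 ≤ C) (h : ∀ p ∈ s, |f (x p)| ≤ C) : ‖EE s x f‖ ≤ C := by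
  rw [ContinuousMap.norm_le _ hC]
  intro y
  obtain ⟨p, hp, hyp⟩ := S.cov y
  rw [S.E_apply hp hyp]
  exact h p hp

lemma bddBelow : ∃ C > 0, ∀ f, ‖f‖ ≤ C * ‖AA T s x f‖ := by
  have hε := S.epos
  have hη := S.hη
  have hεη := S.hε
  refine ⟨1 + (1 + 2 * ε) * (3 / η), by positivity, fun f => ?_⟩
  set f₀ := f - EE s x f with hf0
  set g := AA T s x f with hg
  have hg1 : g = GG T s f₀ + EE s x f := AA_apply ..
  have hz : ∀ p ∈ s, f₀ (x p) = 0 := fun p hp => by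
    rw [hf0, ContinuousMap.sub_apply, S.E_apply hp (S.mem p hp), sub_self]
  have h1 : ‖EE s x f‖ ≤ ‖g‖ + 2 * ε * ‖f₀‖ := by
    refine S.E_norm (by positivity) fun p hp => ?_
    have h2 := S.star' f₀ hz hp
    have h3 := g.norm_coe_le_norm (x p)
    have h4 : g (x p) = GG T s f₀ (x p) + f (x p) := by
      rw [hg1, ContinuousMap.add_apply, S.E_apply hp (S.mem p hp)]
    rw [Real.norm_eq_abs] at h3
    have : f (x p) = g (x p) - GG T s f₀ (x p) := by linarith
    rw [this]
    exact (abs_sub _ _).trans (add_le_add h3 h2)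
  have h2 : ∀ y ∈ (⊤ : Clopens K), |f₀ y| ≤ (2 * ‖g‖ + 4 * ε * ‖f₀‖) / η := by
    refine S.dense ⊤ _ (isClosed_le (by fun_prop) continuous_const) ?_
    intro e he y hy _
    rw [le_div_iff₀ hη]
    have h3 := S.star f₀ hz he hy
    have h4 := S.bd e he y hy
    have h5 : GG T s f₀ y = g y - EE s x f y := by rw [hg1, ContinuousMap.add_apply]; ring
    have h6 := g.norm_coe_le_norm y
    have h7 := (EE s x f).norm_coe_le_norm y
    rw [Real.norm_eq_abs] at h6 h7
    have h8 : |T (ind e) y * f₀ y| ≤ |GG T s f₀ y| + 2 * ε * ‖f₀‖ := by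
      have := abs_sub_abs_le_abs_sub (T (ind e) y * f₀ y) (GG T s f₀ y)
      rw [abs_sub_comm] at h3
      linarith
    rw [abs_mul] at h8
    have h9 : |GG T s f₀ y| ≤ ‖g‖ + ‖EE s x f‖ := by
      rw [h5]; exact (abs_sub _ _).trans (add_le_add h6 h7)
    nlinarith [abs_nonneg (f₀ y)]
  have h3 : ‖f₀‖ ≤ (2 * ‖g‖ + 4 * ε * ‖f₀‖) / η := by
    rw [ContinuousMap.norm_le _ (by positivity)]
    exact fun y => h2 y trivial
  rw [le_div_iff₀ hη] at h3
  have h4 : ‖f₀‖ ≤ 3 / η * ‖g‖ := by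
    rw [div_mul_eq_mul_div, le_div_iff₀ hη]
    rw [hεη] at h3
    nlinarith [norm_nonneg f₀, norm_nonneg g]
  have h5 : ‖f‖ ≤ ‖f₀‖ + ‖EE s x f‖ := by
    have : f = f₀ + EE s x f := by rw [hf0]; abel
    conv_lhs => rw [this]
    exact norm_add_le _ _
  calc ‖f‖ ≤ ‖g‖ + (1 + 2 * ε) * ‖f₀‖ := by linarith
    _ ≤ ‖g‖ + (1 + 2 * ε) * (3 / η * ‖g‖) := by gcongr
    _ = _ := by ring

lemma approx (f : C(K, ℝ)) (hf : f ≠ 0) : ∃ v, ‖AA T s x v - f‖ ≤ ‖f‖ / 2 := by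
  have hε := S.epos
  have hη := S.hη
  have hεη := S.hε
  have hfp : 0 < ‖f‖ := norm_pos_iff.2 hf
  set f₀ := f - EE s x f with hf0
  have hz : ∀ p ∈ s, f₀ (x p) = 0 := fun p hp => by
    rw [hf0, ContinuousMap.sub_apply, S.E_apply hp (S.mem p hp), sub_self]
  have hEn : ‖EE s x f‖ ≤ ‖f‖ := S.E_norm hfp.le fun p hp => f.norm_coe_le_norm _
  have hf02 : ‖f₀‖ ≤ 2 * ‖f‖ := by
    have := norm_sub_le f (EE s x f)
    rw [← hf0] at this
    linarith
  obtain ⟨R, hR1, hR2⟩ := exists_level f₀ (show 0 < ‖f‖ / 4 by positivity)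
  have hxR : ∀ p ∈ s, x p ∉ R := by
    intro p hp h
    have := hR1 _ h
    rw [hz p hp, abs_zero] at this
    linarith
  have hloc : ∀ p ∈ s, ∀ e, Loc T e → ∀ y ∈ e, y ∈ R ⊓ p →
      |T (ind (R ⊓ p)) y - T (ind e) y| ≤ ε := by
    intro p hp e he y hye hyR
    have h1 := he.eq (c := e ⊓ (R ⊓ p)) inf_le_left (y := y) ⟨hye, hyR⟩
    have h2 := S.nice p hp ((R ⊓ p) \ (e ⊓ (R ⊓ p))) (sdiff_le.trans inf_le_right)
      (fun h => hxR p hp h.1.1) y (fun h => h.2 ⟨hye, hyR⟩)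
    rwa [ind_sdiff inf_le_right, map_sub, ContinuousMap.sub_apply, h1] at h2
  have hlow : ∀ p ∈ s, ∀ y ∈ R ⊓ p, η - ε ≤ |T (ind (R ⊓ p)) y| := by
    intro p hp
    refine S.dense _ _ (isClosed_le continuous_const (by fun_prop)) ?_
    intro e he y hye hyR
    have h1 := hloc p hp e he y hye hyR
    have h2 := S.bd e he y hye
    rw [abs_sub_comm] at h1
    have h3 := abs_sub_abs_le_abs_sub (T (ind e) y) (T (ind (R ⊓ p)) y)
    linarith
  set H : C(K, ℝ) := ∑ p ∈ s, T (ind (R ⊓ p)) * ind p * ind R + ind Rᶜ with hH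
  have hHR : ∀ p ∈ s, ∀ y ∈ R ⊓ p, H y = T (ind (R ⊓ p)) y := by
    intro p hp y hy
    have h := sum_ind_apply s id S.disj (fun q => T (ind (R ⊓ q)) y) hp hy.2
    rw [← h]
    have h1 : y ∉ Rᶜ := fun h => h hy.1
    simp [hH, ind_of_mem hy.1, ind_of_not h1]
  have hHn : ∀ y, y ∉ R → H y = 1 := by
    intro y hy
    simp [hH, ind_of_not hy, ind_of_mem (mem_compl.2 hy)]
  have hH0 : ∀ y, H y ≠ 0 := by
    intro y h0
    by_cases hy : y ∈ R
    · obtain ⟨p, hp, hyp⟩ := S.cov y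
      have := hlow p hp y ⟨hy, hyp⟩
      rw [← hHR p hp y ⟨hy, hyp⟩, h0, abs_zero] at this
      linarith
    · rw [hHn y hy] at h0; exact one_ne_zero h0
  let u : C(K, ℝ) := ⟨fun y => ind R y * f₀ y / H y, Continuous.div (by fun_prop) (by fun_prop) hH0⟩
  have hu : ∀ y, u y = ind R y * f₀ y / H y := fun y => rfl
  have hun : ∀ y, y ∉ R → u y = 0 := fun y hy => by rw [hu, ind_of_not hy]; simp
  have huR : ∀ y, y ∈ R → u y * H y = f₀ y := fun y hy => by
    rw [hu, ind_of_mem hy, one_mul, div_mul_cancel₀ _ (hH0 y)]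
  have hηε : 0 < η - ε := by linarith
  have hunorm : ‖u‖ ≤ ‖f₀‖ / (η - ε) := by
    rw [ContinuousMap.norm_le _ (by positivity)]
    intro y
    by_cases hy : y ∈ R
    · obtain ⟨p, hp, hyp⟩ := S.cov y
      have h1 := hlow p hp y ⟨hy, hyp⟩
      rw [← hHR p hp y ⟨hy, hyp⟩] at h1
      have h2 := f₀.norm_coe_le_norm y
      rw [le_div_iff₀ hηε, Real.norm_eq_abs]
      rw [← huR y hy, Real.norm_eq_abs, abs_mul] at h2
      nlinarith [abs_nonneg (u y)]
    · rw [hun y hy, norm_zero]; positivity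
  have huz : ∀ p ∈ s, u (x p) = 0 := fun p hp => hun _ (hxR p hp)
  have hmain : ∀ y ∈ (⊤ : Clopens K), |GG T s u y - f₀ y| ≤ 3 * ε * ‖u‖ + ‖f‖ / 4 := by
    refine S.dense ⊤ _ (isClosed_le (by fun_prop) continuous_const) ?_
    intro e he y hy _
    have h1 := S.star u huz he hy
    by_cases hyR : y ∈ R
    · obtain ⟨p, hp, hyp⟩ := S.cov y
      have h2 := hloc p hp e he y hy ⟨hyR, hyp⟩
      have h3 := huR y hyR
      rw [hHR p hp y ⟨hyR, hyp⟩] at h3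
      have h4 : |T (ind e) y * u y - f₀ y| ≤ ε * ‖u‖ := by
        rw [← h3, mul_comm (T (ind e) y), ← mul_sub, abs_mul, abs_sub_comm, mul_comm]
        exact mul_le_mul h2 (u.norm_coe_le_norm y) (abs_nonneg _) hε.le
      have h5 := abs_sub_le (GG T s u y) (T (ind e) y * u y) (f₀ y)
      linarith
    · rw [hun y hyR, mul_zero, sub_zero] at h1
      have h2 := hR2 y hyR
      have h3 := abs_sub (GG T s u y) (f₀ y)
      nlinarith [norm_nonneg u]
  refine ⟨u + EE s x f, ?_⟩
  have hE : EE s x (u + EE s x f) = EE s x f := by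
    ext y
    obtain ⟨p, hp, hyp⟩ := S.cov y
    rw [S.E_apply hp hyp, ContinuousMap.add_apply, huz p hp, zero_add,
      S.E_apply hp (S.mem p hp), S.E_apply hp hyp]
  have hA : AA T s x (u + EE s x f) - f = GG T s u - f₀ := by
    rw [AA_apply, hE, add_sub_cancel_right, hf0]; abel
  rw [hA]
  have h1 : ‖GG T s u - f₀‖ ≤ 3 * ε * ‖u‖ + ‖f‖ / 4 := by
    rw [ContinuousMap.norm_le _ (by positivity)]
    exact fun y => hmain y trivial
  have h2 : 3 * ε * ‖u‖ ≤ ‖f‖ / 4 := by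
    rw [le_div_iff₀ hηε] at hunorm
    rw [hεη] at hunorm ⊢
    have : ‖u‖ * η * (31 / 32) ≤ 2 * ‖f‖ := by linarith
    linarith
  linarith

lemma surj : Function.Surjective (AA T s x) := by
  obtain ⟨C, hC, hb⟩ := S.bddBelow
  have hanti : AntilipschitzWith C.toNNReal (AA T s x) :=
    AddMonoidHomClass.antilipschitz_of_bound _ (fun f => by
      rw [Real.coe_toNNReal _ hC.le]; exact hb f)
  have hcl : IsClosed ((LinearMap.range (AA T s x : C(K, ℝ) →ₗ[ℝ] C(K, ℝ)) : Submodule ℝ C(K, ℝ)) : Set C(K, ℝ)) := by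
    have := hanti.isClosed_range (AA T s x).uniformContinuous
    rw [LinearMap.coe_range]
    exact this
  by_contra hns
  simp only [Function.Surjective] at hns
  push Not at hns
  obtain ⟨w, hw⟩ := hns
  obtain ⟨f, hf, hff⟩ := riesz_lemma (𝕜 := ℝ) hcl ⟨w, fun ⟨v, hv⟩ => hw v hv⟩ (r := 3 / 4) (by norm_num)
  have hf0 : f ≠ 0 := fun h => hf (h ▸ Submodule.zero_mem _)
  obtain ⟨v, hv⟩ := S.approx f hf0
  have h1 := hff _ ⟨v, rfl⟩
  rw [norm_sub_rev] at h1
  have h2 : (3 : ℝ) / 4 * ‖f‖ ≤ ‖AA T s x v - f‖ := h1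
  linarith [norm_pos_iff.2 hf0]

lemma inj : Function.Injective (AA T s x) := by
  obtain ⟨C, hC, hb⟩ := S.bddBelow
  rw [injective_iff_map_eq_zero]
  intro f hf
  have := hb f
  rw [hf, norm_zero, mul_zero] at this
  exact norm_le_zero_iff.1 this

lemma wc (hK : Good K) : WC (T - AA T s x) := by
  intro a ha
  by_contra hcon
  have : ∃ δ > 0, ∃ᶠ n in atTop, δ < ‖(T - AA T s x) (ind (a n))‖ := by
    by_contra h
    push Not at h
    apply hcon
    rw [Metric.tendsto_atTop]
    intro δ hδ
    have h1 := h (δ / 2) (by positivity)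
    obtain ⟨N, hN⟩ := eventually_atTop.1 h1
    refine ⟨N, fun n hn => ?_⟩
    rw [dist_zero_right, norm_norm]
    linarith [hN n hn]
  obtain ⟨δ, hδ, hfr⟩ := this
  have hev : ∀ᶠ n in atTop, ∀ p ∈ s, x p ∉ a n := by
    rw [Filter.eventually_all_finset]
    intro p hp
    by_cases h : ∃ m, x p ∈ a m
    · obtain ⟨m, hm⟩ := h
      filter_upwards [eventually_gt_atTop m] with n hn hxn
      exact disj_iff.1 (ha (ne_of_lt hn)) _ hm hxn
    · push Not at h
      exact Eventually.of_forall h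
  obtain ⟨φ, hφ, hφ2⟩ := Filter.extraction_of_frequently_atTop (hfr.and_eventually hev)
  have hpt : ∀ n, ∃ p, ∃ y, p ∈ s ∧ y ∈ p ∧ δ / 2 < |T (ind (a (φ n) \ p)) y| := by
    intro n
    obtain ⟨h1, h2⟩ := hφ2 n
    set f := (T - AA T s x) (ind (a (φ n))) with hf
    have : ∃ y, δ / 2 < |f y| := by
      by_contra h
      push Not at h
      have := (ContinuousMap.norm_le f (by positivity)).2 h
      linarith
    obtain ⟨y, hy⟩ := this
    obtain ⟨p, hp, hyp⟩ := S.cov y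
    refine ⟨p, y, hp, hyp, ?_⟩
    have hE : EE s x (ind (a (φ n))) = 0 := by
      ext z
      obtain ⟨q, hq, hzq⟩ := S.cov z
      rw [S.E_apply hq hzq, ind_of_not (h2 q hq)]; rfl
    have h3 : f y = T (ind (a (φ n) \ p)) y := by
      rw [hf, _root_.sub_apply, AA_apply, hE, sub_zero, add_zero,
        ContinuousMap.sub_apply, S.G_apply hp hyp, ← ContinuousMap.sub_apply, ← map_sub]
      congr 2
      ext z
      by_cases hz : z ∈ a (φ n) <;> by_cases hzp : z ∈ p <;>
        simp [ind_of_mem, ind_of_not, hz, hzp, mem_sdiff]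
    rwa [← h3]
  choose p y hp hyp hpy using hpt
  refine hK.WM T (fun n => a (φ n) \ p n) ?_ y (fun n h => h.2 (hyp n)) (half_pos hδ) hpy
  intro i j hij
  exact (ha (hφ.injective.ne hij)).mono sdiff_le sdiff_le

end Setup

theorem Good.main (hK : Good K) (T : C(K, ℝ) →L[ℝ] C(K, ℝ)) (hT : Function.Injective T) :
    Function.Surjective T := by
  rcases isEmpty_or_nonempty K with hE | hN
  · intro f
    exact ⟨0, by ext z; exact isEmptyElim z⟩
  obtain ⟨s, x, ε, η, S⟩ := hK.setup T hT
  let A : C(K, ℝ) ≃L[ℝ] C(K, ℝ) := ContinuousLinearEquiv.ofBijective (AA T s x)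
    (LinearMap.ker_eq_bot.2 S.inj) (LinearMap.range_eq_top.2 S.surj)
  have hA : ∀ f, A f = AA T s x f := fun f => rfl
  let V : C(K, ℝ) →L[ℝ] C(K, ℝ) := (A.symm : C(K, ℝ) →L[ℝ] C(K, ℝ)) ∘L (T - AA T s x)
  have hV : ∀ u, u + V u = A.symm (T u) := by
    intro u
    apply A.injective
    rw [map_add, A.apply_symm_apply]
    change A u + A (A.symm ((T - AA T s x) u)) = _
    rw [A.apply_symm_apply, hA, _root_.sub_apply]
    abel
  have hWC : WC V := by
    intro a ha
    have h1 := (S.wc hK a ha).const_mul ‖(A.symm : C(K, ℝ) →L[ℝ] C(K, ℝ))‖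
    rw [mul_zero] at h1
    exact squeeze_zero (fun n => norm_nonneg _) (fun n =>
      ContinuousLinearMap.le_opNorm (A.symm : C(K, ℝ) →L[ℝ] C(K, ℝ)) ((T - AA T s x) (ind (a n)))) h1
  intro w
  obtain ⟨u, hu⟩ := hWC.fredholm (fun u hu => by
    rw [hV] at hu
    apply hT
    rw [map_zero]
    exact A.symm.injective (hu.trans (map_zero _).symm)) (A.symm w)
  rw [hV] at hu
  exact ⟨u, A.symm.injective hu⟩

end P4b
end FK


set_option linter.unusedSectionVars false
namespace FK
open TopologicalSpace Topology
section I1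
open Cardinal

lemma index_exists : ∃ (ι : Type) (_ : LinearOrder ι) (_ : WellFoundedLT ι), #ι = 𝔠 ∧
    (∀ i : ι, #(Set.Iio i) < 𝔠) ∧ ∀ δ : ℕ → ι, ∃ γ, ∀ n, δ n < γ := by
  refine ⟨(𝔠).ord.ToType, inferInstance, inferInstance, mk_ord_toType _, fun i => mk_Iio_toType_ord_lt i, ?_⟩
  intro δ
  by_contra hcon
  push Not at hcon
  have h1 : IsCofinal (Set.range δ) := by
    intro γ
    obtain ⟨n, hn⟩ := hcon γ
    exact ⟨δ n, ⟨n, rfl⟩, hn⟩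
  have h2 := Order.cof_le h1
  rw [Ordinal.cof_toType] at h2
  have h3 := lt_cof_ord_power (a := ℵ₀) (b := 2) le_rfl (by norm_num)
  rw [two_power_aleph0] at h3
  have h4 : #(Set.range δ) ≤ ℵ₀ := by
    rw [le_aleph0_iff_set_countable]
    exact Set.countable_range δ
  exact absurd (h3.trans_le (h2.trans h4)) (lt_irrefl _)

lemma rec_exists {ι D : Type} [LinearOrder ι] [WellFoundedLT ι] [Nonempty D]
    (R : ∀ γ : ι, (∀ β, β < γ → D) → D → Prop) :
    ∃ f : ι → D, ∀ γ, (∃ d, R γ (fun β _ => f β) d) → R γ (fun β _ => f β) (f γ) := by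
  let F : ∀ γ : ι, (∀ β, β < γ → D) → D := fun γ IH => Classical.epsilon (R γ IH)
  refine ⟨(wellFounded_lt (α := ι)).fix F, fun γ h => ?_⟩
  have h1 := (wellFounded_lt (α := ι)).fix_eq F γ
  rw [h1]
  exact Classical.epsilon_spec h

lemma ad_bool : ∃ B : (ℕ → Bool) → Set ℕ, (∀ σ, (B σ).Infinite) ∧
    ∀ σ τ, σ ≠ τ → (B σ ∩ B τ).Finite := by
  let g : (ℕ → Bool) → ℕ → ℕ := fun σ n => Encodable.encode ((List.range n).map σ)
  have hg : ∀ σ τ m n, g σ m = g τ n → m = n ∧ ∀ i < m, σ i = τ i := by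
    intro σ τ m n h
    have h1 := Encodable.encode_injective h
    have h2 : m = n := by simpa using congrArg List.length h1
    subst h2
    refine ⟨rfl, fun i hi => ?_⟩
    exact List.map_inj_left.1 h1 i (List.mem_range.2 hi)
  refine ⟨fun σ => Set.range (g σ), fun σ => Set.infinite_range_of_injective fun m n h => (hg _ _ _ _ h).1, ?_⟩
  intro σ τ hne
  obtain ⟨k, hk⟩ := Function.ne_iff.1 hne
  refine ((Set.finite_Iic k).image (g σ)).subset ?_
  rintro _ ⟨⟨m, rfl⟩, ⟨n, hn⟩⟩
  refine ⟨m, ?_, rfl⟩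
  by_contra hmk
  exact hk ((hg _ _ _ _ hn.symm).2 k (not_le.1 hmk))

lemma ad_exists {ι : Type} (hι : #ι = 𝔠) : ∃ B : ι → Set ℕ, (∀ i, (B i).Infinite) ∧
    ∀ i j, i ≠ j → (B i ∩ B j).Finite := by
  obtain ⟨B, h1, h2⟩ := ad_bool
  have : #ι = #(ℕ → Bool) := by simp [hι]
  obtain ⟨e⟩ := Cardinal.eq.1 this
  exact ⟨fun i => B (e i), fun i => h1 _, fun i j hij => h2 _ _ (e.injective.ne hij)⟩

inductive Gen (S : Set (Set ℕ)) : Set ℕ → Prop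
  | fin {A : Set ℕ} : A.Finite → Gen S A
  | base {A : Set ℕ} : A ∈ S → Gen S A
  | compl {A : Set ℕ} : Gen S A → Gen S Aᶜ
  | union {A B : Set ℕ} : Gen S A → Gen S B → Gen S (A ∪ B)

namespace Gen
variable {S : Set (Set ℕ)}

lemma mono {S' : Set (Set ℕ)} (h : S ⊆ S') {A : Set ℕ} (hA : Gen S A) : Gen S' A := by
  induction hA with
  | fin h => exact .fin h
  | base h' => exact .base (h h')
  | compl _ ih => exact ih.compl
  | union _ _ ih1 ih2 => exact ih1.union ih2

lemma inter {A B : Set ℕ} (hA : Gen S A) (hB : Gen S B) : Gen S (A ∩ B) := by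
  have := (hA.compl.union hB.compl).compl
  rwa [← Set.compl_inter, compl_compl] at this

lemma diff {A B : Set ℕ} (hA : Gen S A) (hB : Gen S B) : Gen S (A \ B) := hA.inter hB.compl

lemma biUnion {A : ℕ → Set ℕ} (hA : ∀ n, Gen S (A n)) {b : Set ℕ} (hb : b.Finite) :
    Gen S (⋃ n ∈ b, A n) := by
  induction b, hb using Set.Finite.induction_on with
  | empty => simpa using Gen.fin Set.finite_empty
  | insert _ _ ih => rw [Set.biUnion_insert]; exact (hA _).union ih

lemma ins {e C : Set ℕ} (h : Gen (insert e S) C) :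
    ∃ p q, Gen S p ∧ Gen S q ∧ C = (p ∩ e) ∪ (q \ e) := by
  induction h with
  | @fin A h => exact ⟨A, A, .fin h, .fin h, by ext x; simp⟩
  | @base A h =>
    rcases h with rfl | h
    · exact ⟨Set.univ, ∅, by simpa using (Gen.fin (S := S) Set.finite_empty).compl, .fin Set.finite_empty, by simp⟩
    · exact ⟨A, A, .base h, .base h, by ext x; simp⟩
  | compl _ ih =>
    obtain ⟨p, q, hp, hq, rfl⟩ := ih
    refine ⟨pᶜ, qᶜ, hp.compl, hq.compl, ?_⟩
    ext x; simp; tauto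
  | union _ _ ih1 ih2 =>
    obtain ⟨p, q, hp, hq, rfl⟩ := ih1
    obtain ⟨p', q', hp', hq', rfl⟩ := ih2
    refine ⟨p ∪ p', q ∪ q', hp.union hp', hq.union hq', ?_⟩
    ext x; simp; tauto

lemma empty_countable : {C | Gen ∅ C}.Countable := by
  have h1 : {C : Set ℕ | C.Finite}.Countable := Set.Countable.ofPred_finite
  refine (h1.union (h1.image (fun A => Aᶜ))).mono ?_
  intro C hC
  change Gen ∅ C at hC
  induction hC with
  | fin h => exact Or.inl h
  | base h => exact h.elim
  | @compl A _ ih =>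
    rcases ih with h | ⟨D, h, rfl⟩
    · exact Or.inr ⟨A, h, rfl⟩
    · left; rwa [compl_compl]
  | @union A B _ _ ih1 ih2 =>
    rcases ih1 with h | ⟨D, h, rfl⟩
    · rcases ih2 with h' | ⟨D', h', rfl⟩
      · exact Or.inl (Set.Finite.union h h')
      · refine Or.inr ⟨D' \ A, Set.Finite.sdiff h', ?_⟩
        ext x; simp; tauto
    · refine Or.inr ⟨D \ B, Set.Finite.sdiff h, ?_⟩
      ext x; simp; tauto

lemma finset_countable (F : Finset (Set ℕ)) : {C | Gen (F : Set (Set ℕ)) C}.Countable := by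
  classical
  induction F using Finset.induction_on with
  | empty => simpa using empty_countable
  | insert e F _ ih =>
    refine ((ih.prod ih).image (fun pq => (pq.1 ∩ e) ∪ (pq.2 \ e))).mono ?_
    intro C hC
    rw [Finset.coe_insert] at hC
    obtain ⟨p, q, hp, hq, rfl⟩ := ins hC
    exact ⟨(p, q), ⟨hp, hq⟩, rfl⟩

lemma exists_finset {C : Set ℕ} (h : Gen S C) :
    ∃ F : Finset S, Gen ((fun x : S => x.1) '' (F : Set S)) C := by
  classical
  induction h with
  | fin h => exact ⟨∅, .fin h⟩
  | @base A h => exact ⟨{⟨A, h⟩}, .base (by simp)⟩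
  | compl _ ih => exact ih.imp fun F h => h.compl
  | union _ _ ih1 ih2 =>
    obtain ⟨F, h⟩ := ih1
    obtain ⟨G, h'⟩ := ih2
    exact ⟨F ∪ G, (h.mono (Set.image_mono (by simp))).union (h'.mono (Set.image_mono (by simp)))⟩

lemma card_lt (hS : #S < 𝔠) : #{C // Gen S C} < 𝔠 := by
  classical
  have h1 : {C | Gen S C} ⊆ ⋃ F : Finset S, {C | Gen ((F.image (fun x : S => x.1) : Finset (Set ℕ)) : Set (Set ℕ)) C} := by
    intro C hC
    obtain ⟨F, hF⟩ := exists_finset hC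
    refine Set.mem_iUnion.2 ⟨F, ?_⟩
    simpa using hF
  have h2 : #(Finset S) < 𝔠 := by
    rcases finite_or_infinite S with hf | hi
    · exact (mk_lt_aleph0 (α := Finset S)).trans aleph0_lt_continuum
    · rwa [mk_finset_of_infinite]
  calc #{C // Gen S C} ≤ _ := mk_le_mk_of_subset h1
    _ ≤ _ := mk_iUnion_le_sum_mk
    _ ≤ Cardinal.sum (fun _ : Finset S => ℵ₀) := by
        apply sum_le_sum
        intro F
        exact (finset_countable _).le_aleph0
    _ = #(Finset S) * ℵ₀ := by simp
    _ < 𝔠 := mul_lt_of_lt aleph0_lt_continuum.le h2 aleph0_lt_continuum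

end Gen

def Kept (G : Set ℕ → Prop) (P : (ℕ → Set ℕ) × Set ℕ) : Prop :=
  ¬ ∃ C, G C ∧ (∀ m ∈ P.2, (P.1 m \ C).Finite) ∧ ∀ m, m ∉ P.2 → (P.1 m ∩ C).Finite

lemma kept_triv (G : Set ℕ → Prop) : Kept G (fun _ => Set.univ, {0}) := by
  rintro ⟨C, _, h1, h2⟩
  have h3 := h1 0 rfl
  have h4 := h2 1 (by simp)
  have := h3.union h4
  rw [Set.sdiff_union_inter] at this
  exact Set.infinite_univ this

lemma step {ι : Type} (hι : #ι = 𝔠) {S : Set (Set ℕ)} (hS : #S < 𝔠) {Λ : Type} (hΛ : #Λ < 𝔠)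
    (Q : Λ → (ℕ → Set ℕ) × Set ℕ) (hQ : ∀ l, Kept (Gen S) (Q l)) (E : ι → Set ℕ)
    (hE : ∀ i j, i ≠ j → Gen S (E i ∩ E j)) (Pn : ι → (ℕ → Set ℕ) × Set ℕ)
    (hbad : #{i | ¬ Kept (Gen (insert (E i) S)) (Pn i)} < 𝔠) (used : Λ → ι) :
    ∃ i, (∀ l, used l ≠ i) ∧ (∀ l, Kept (Gen (insert (E i) S)) (Q l)) ∧
      Kept (Gen (insert (E i) S)) (Pn i) := by
  have hG := Gen.card_lt hS
  have h1 : #(Set.range used) < 𝔠 := mk_range_le.trans_lt hΛ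
  have h2 : #{i | ∃ l, ¬ Kept (Gen (insert (E i) S)) (Q l)} < 𝔠 := by
    have h3 : ∀ i : {i | ∃ l, ¬ Kept (Gen (insert (E i) S)) (Q l)},
        ∃ x : Λ × {C // Gen S C} × {C // Gen S C},
          (∀ m ∈ (Q x.1).2, ((Q x.1).1 m \ ((x.2.1.1 ∩ E i) ∪ (x.2.2.1 \ E i))).Finite) ∧
            ∀ m, m ∉ (Q x.1).2 → ((Q x.1).1 m ∩ ((x.2.1.1 ∩ E i) ∪ (x.2.2.1 \ E i))).Finite := by
      rintro ⟨i, l, hl⟩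
      simp only [Kept, not_not] at hl
      obtain ⟨C, hC, hC2⟩ := hl
      obtain ⟨p, q, hp, hq, rfl⟩ := hC.ins
      exact ⟨(l, ⟨p, hp⟩, ⟨q, hq⟩), hC2⟩
    choose φ hφ1 hφ2 using h3
    have hinj : Function.Injective φ := by
      intro i j hij
      by_contra hne
      have hne' : i.1 ≠ j.1 := fun h => hne (Subtype.ext h)
      have a1 := hφ1 i
      have a2 := hφ2 i
      have b1 := hφ1 j
      have b2 := hφ2 j
      rw [← hij] at b1 b2
      set p := (φ i).2.1
      set q := (φ i).2.2
      refine hQ (φ i).1 ⟨(p.1 ∩ (E i ∩ E j)) ∪ (q.1 \ (E i ∩ E j)), ?_, ?_, ?_⟩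
      · exact (p.2.inter (hE _ _ hne')).union (q.2.diff (hE _ _ hne'))
      · intro m hm
        refine ((a1 m hm).union (b1 m hm)).subset ?_
        intro x
        simp only [Set.mem_union, Set.mem_sdiff, Set.mem_inter_iff]
        tauto
      · intro m hm
        refine ((a2 m hm).union (b2 m hm)).subset ?_
        intro x
        simp only [Set.mem_union, Set.mem_sdiff, Set.mem_inter_iff]
        tauto
    refine (mk_le_of_injective hinj).trans_lt ?_
    rw [mk_prod, mk_prod]
    simp only [lift_id]
    exact mul_lt_of_lt aleph0_lt_continuum.le hΛ (mul_lt_of_lt aleph0_lt_continuum.le hG hG)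
  by_contra hcon
  push Not at hcon
  have hU : (Set.univ : Set ι) ⊆ (Set.range used ∪ {i | ∃ l, ¬ Kept (Gen (insert (E i) S)) (Q l)}) ∪
      {i | ¬ Kept (Gen (insert (E i) S)) (Pn i)} := by
    intro i _
    by_cases a : ∃ l, used l = i
    · exact Or.inl (Or.inl a)
    by_cases b : ∃ l, ¬ Kept (Gen (insert (E i) S)) (Q l)
    · exact Or.inl (Or.inr b)
    push Not at a b
    exact Or.inr (hcon i a b)
  have h5 := mk_le_mk_of_subset hU
  rw [mk_univ, hι] at h5
  refine absurd (h5.trans (mk_union_le _ _)) (not_le.2 ?_)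
  exact add_lt_of_lt aleph0_lt_continuum.le ((mk_union_le _ _).trans_lt
    (add_lt_of_lt aleph0_lt_continuum.le h1 h2)) hbad

lemma fiber_countable {ι : Type} {B : ι → Set ℕ} (hB : ∀ i, (B i).Infinite)
    (hB2 : ∀ i j, i ≠ j → (B i ∩ B j).Finite) {V : ℕ → Set ℕ} (hV : ∀ m, (V m).Infinite)
    (E : ι → Set ℕ) (hE : ∀ i j, i ≠ j → ∀ m, (V m ∩ (E i ∩ E j)).Finite) (p q : Set ℕ) :
    {i | (∀ m ∈ B i, (V m \ ((p ∩ E i) ∪ (q \ E i))).Finite) ∧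
      ∀ m, m ∉ B i → (V m ∩ ((p ∩ E i) ∪ (q \ E i))).Finite}.Countable := by
  set I := {i | (∀ m ∈ B i, (V m \ ((p ∩ E i) ∪ (q \ E i))).Finite) ∧
      ∀ m, m ∉ B i → (V m ∩ ((p ∩ E i) ∪ (q \ E i))).Finite} with hI
  by_cases hsub : I.Subsingleton
  · exact hsub.countable
  rw [Set.not_subsingleton_iff] at hsub
  obtain ⟨j, hj, k, hk, hjk⟩ := hsub
  have hm : ∀ i : ↥(I \ {j, k}), ∃ m, (V m \ E i).Finite := by
    rintro ⟨i, hi, hi2⟩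
    simp only [Set.mem_insert_iff, Set.mem_singleton_iff, not_or] at hi2
    have h1 := ((hB i).sdiff ((hB2 i j hi2.1).union (hB2 i k hi2.2))).nonempty
    obtain ⟨m, hm, hm2⟩ := h1
    have hmj : m ∉ B j := fun h => hm2 (Or.inl ⟨hm, h⟩)
    have hmk : m ∉ B k := fun h => hm2 (Or.inr ⟨hm, h⟩)
    refine ⟨m, ?_⟩
    refine (((hi.1 m hm).union ((hj.2 m hmj).union (hk.2 m hmk))).union (hE j k hjk m)).subset ?_
    intro x
    simp only [Set.mem_union, Set.mem_sdiff, Set.mem_inter_iff]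
    tauto
  choose m hm using hm
  have hinj : Function.Injective m := by
    intro i i' h
    by_contra hne
    have hne' : i.1 ≠ i'.1 := fun h => hne (Subtype.ext h)
    have h1 := hm i
    have h2 := hm i'
    rw [← h] at h2
    refine hV (m i) (((h1.union h2).union (hE _ _ hne' (m i))).subset ?_)
    intro x
    simp only [Set.mem_union, Set.mem_sdiff, Set.mem_inter_iff]
    tauto
  have h1 : (I \ {j, k}).Countable := Set.countable_coe_iff.1 hinj.countable
  refine (h1.union (Set.Countable.insert j (Set.countable_singleton k))).mono ?_
  intro x hx
  by_cases h : x ∈ ({j, k} : Set ι)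
  · exact Or.inr h
  · exact Or.inl ⟨hx, h⟩

lemma newprom {ι : Type} {B : ι → Set ℕ} (hB : ∀ i, (B i).Infinite)
    (hB2 : ∀ i j, i ≠ j → (B i ∩ B j).Finite) {V : ℕ → Set ℕ} (hV : ∀ m, (V m).Infinite)
    {S : Set (Set ℕ)} (hS : #S < 𝔠)
    (E : ι → Set ℕ) (hE : ∀ i j, i ≠ j → ∀ m, (V m ∩ (E i ∩ E j)).Finite) :
    #{i | ¬ Kept (Gen (insert (E i) S)) (V, B i)} < 𝔠 := by
  have hG := Gen.card_lt hS
  have h1 : {i | ¬ Kept (Gen (insert (E i) S)) (V, B i)} ⊆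
      ⋃ x : {C // Gen S C} × {C // Gen S C}, {i | (∀ m ∈ B i, (V m \ ((x.1.1 ∩ E i) ∪ (x.2.1 \ E i))).Finite) ∧
      ∀ m, m ∉ B i → (V m ∩ ((x.1.1 ∩ E i) ∪ (x.2.1 \ E i))).Finite} := by
    intro i hi
    simp only [Kept, not_not, Set.mem_ofPred_eq] at hi
    obtain ⟨C, hC, hC2⟩ := hi
    obtain ⟨p, q, hp, hq, rfl⟩ := hC.ins
    exact Set.mem_iUnion.2 ⟨(⟨p, hp⟩, ⟨q, hq⟩), hC2⟩
  calc _ ≤ _ := mk_le_mk_of_subset h1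
    _ ≤ _ := mk_iUnion_le_sum_mk
    _ ≤ Cardinal.sum (fun _ : {C // Gen S C} × {C // Gen S C} => ℵ₀) := by
        apply sum_le_sum
        intro x
        exact (fiber_countable hB hB2 hV E hE _ _).le_aleph0
    _ = #({C // Gen S C} × {C // Gen S C}) * ℵ₀ := by simp
    _ < 𝔠 := by
      rw [mk_prod]
      simp only [lift_id]
      exact mul_lt_of_lt aleph0_lt_continuum.le (mul_lt_of_lt aleph0_lt_continuum.le hG hG) aleph0_lt_continuum

end I1
end FK


set_option linter.unusedSectionVars false
namespace FK
open TopologicalSpace Topology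
section I2
open Cardinal

abbrev Req : Type := Bool × (ℕ → Set ℕ) × (ℕ → Set ℕ)

lemma mk_seq : #(ℕ → Set ℕ) = 𝔠 := by simp

lemma mk_req : #Req = 𝔠 := by
  rw [mk_prod, mk_prod]
  simp only [lift_id, mk_seq, continuum_mul_self]
  simp

lemma not_countable_of_continuum_le {α : Type} {s : Set α} (h : 𝔠 ≤ #s) : ¬ s.Countable := by
  intro hc
  exact absurd (h.trans hc.le_aleph0) (not_le.2 aleph0_lt_continuum)

lemma req_exists {ι : Type} [LinearOrder ι] (hι : #ι = 𝔠) (hI : ∀ i : ι, #(Set.Iio i) < 𝔠) :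
    ∃ req : ι → Req, ∀ r γ₀, ¬ {γ | γ₀ ≤ γ ∧ req γ = r}.Countable := by
  have h1 : #ι = #(Req × ι) := by
    rw [mk_prod, mk_req]
    simp [hι]
  obtain ⟨e⟩ := Cardinal.eq.1 h1
  refine ⟨fun γ => (e γ).1, fun r γ₀ hc => ?_⟩
  have h2 : Function.Injective (fun k : ι => (⟨e.symm (r, k), by simp⟩ : {γ | (e γ).1 = r})) := by
    intro k k' h
    have := congrArg Subtype.val h
    simpa using this
  have h3 := mk_le_of_injective h2
  have h4 : {γ | (e γ).1 = r} ⊆ {γ | γ₀ ≤ γ ∧ (e γ).1 = r} ∪ Set.Iio γ₀ := by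
    intro γ hγ
    rcases le_or_gt γ₀ γ with h | h
    · exact Or.inl ⟨h, hγ⟩
    · exact Or.inr h
  have h5 := h3.trans ((mk_le_mk_of_subset h4).trans (mk_union_le _ _))
  rw [hι] at h5
  exact absurd h5 (not_le.2 (add_lt_of_lt aleph0_lt_continuum.le
    (hc.le_aleph0.trans_lt aleph0_lt_continuum) (hI γ₀)))

def VA (S : Set (Set ℕ)) (A : ℕ → Set ℕ) : Prop :=
  (∀ n, Gen S (A n)) ∧ Pairwise (Function.onFun Disjoint A)

def VV (A V : ℕ → Set ℕ) : Prop := ∀ m, (V m).Infinite ∧ ∀ n, (V m ∩ A n).Finite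

def VD (A : ℕ → Set ℕ) : Prop := Antitone A ∧ ∀ n, (A n).Infinite

abbrev Dat (ι : Type) : Type := Set ℕ × ((ℕ → Set ℕ) × Set ℕ) × ι

def Spec {ι : Type} (B : ι → Set ℕ) (S : Set (Set ℕ)) (r : Req) (d : Dat ι) : Prop :=
  (r.1 = true → VA S r.2.1 → d.1 = ⋃ n ∈ B d.2.2, r.2.1 n ∧
    (VV r.2.1 r.2.2 → d.2.1 = (r.2.2, B d.2.2))) ∧
  (r.1 = false → VD r.2.1 → d.1.Infinite ∧ (r.2.1 0 \ d.1).Infinite ∧ ∀ n, (d.1 \ r.2.1 n).Finite)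

lemma exists_seq_in {D : ℕ → Set ℕ} (hD : ∀ n, (D n).Infinite) :
    ∃ x : ℕ → ℕ, StrictMono x ∧ ∀ n, x n ∈ D n := by
  have h : ∀ n N, ∃ x, x ∈ D n ∧ N < x := fun n N => (hD n).exists_gt N
  choose g hg1 hg2 using h
  let x : ℕ → ℕ := fun n => Nat.rec (g 0 0) (fun n y => g (n + 1) y) n
  refine ⟨x, strictMono_nat_of_lt_succ fun n => hg2 _ _, fun n => ?_⟩
  cases n with
  | zero => exact hg1 _ _
  | succ n => exact hg1 _ _

lemma inter_biUnion {A : ℕ → Set ℕ} (hA : Pairwise (Function.onFun Disjoint A)) (b c : Set ℕ) :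
    (⋃ n ∈ b, A n) ∩ (⋃ n ∈ c, A n) = ⋃ n ∈ b ∩ c, A n := by
  ext x
  simp only [Set.mem_inter_iff, Set.mem_iUnion, exists_prop]
  constructor
  · rintro ⟨⟨n, hn, hx⟩, ⟨m, hm, hx'⟩⟩
    have : n = m := by
      by_contra hne
      exact Set.disjoint_left.1 (hA hne) hx hx'
    subst this
    exact ⟨n, ⟨hn, hm⟩, hx⟩
  · rintro ⟨n, ⟨h1, h2⟩, hx⟩
    exact ⟨⟨n, h1, hx⟩, ⟨n, h2, hx⟩⟩

lemma stage {ι : Type} (hι : #ι = 𝔠) {B : ι → Set ℕ} (hB : ∀ i, (B i).Infinite)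
    (hB2 : ∀ i j, i ≠ j → (B i ∩ B j).Finite) {S : Set (Set ℕ)} (hS : #S < 𝔠) {Λ : Type} (hΛ : #Λ < 𝔠)
    (Q : Λ → (ℕ → Set ℕ) × Set ℕ) (hQ : ∀ l, Kept (Gen S) (Q l)) (used : Λ → ι) (r : Req) :
    ∃ d : Dat ι, (∀ l, used l ≠ d.2.2) ∧ (∀ l, Kept (Gen (insert d.1 S)) (Q l)) ∧
      Kept (Gen (insert d.1 S)) d.2.1 ∧ Spec B S r d := by
  classical
  have htriv : ∀ E : ι → Set ℕ, #{i | ¬ Kept (Gen (insert (E i) S)) ((fun _ => Set.univ), {0})} < 𝔠 := by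
    intro E
    simp [kept_triv, continuum_pos]
  obtain ⟨k, A, V⟩ := r
  by_cases h1 : k = true ∧ VA S A
  · have hE : ∀ i j, i ≠ j → Gen S ((⋃ n ∈ B i, A n) ∩ (⋃ n ∈ B j, A n)) := by
      intro i j hij
      rw [inter_biUnion h1.2.2]
      exact Gen.biUnion h1.2.1 (hB2 i j hij)
    by_cases h2 : VV A V
    · obtain ⟨i, h3, h4, h5⟩ := step hι hS hΛ Q hQ (fun i => ⋃ n ∈ B i, A n) hE (fun i => (V, B i))
        (newprom hB hB2 (fun m => (h2 m).1) hS _ (by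
          intro i j hij m
          rw [inter_biUnion h1.2.2, Set.inter_iUnion₂]
          exact (hB2 i j hij).biUnion fun n _ => (h2 m).2 n)) used
      refine ⟨(⋃ n ∈ B i, A n, (V, B i), i), h3, h4, h5, fun _ _ => ⟨rfl, fun _ => rfl⟩, fun h => ?_⟩
      simp_all
    · obtain ⟨i, h3, h4, h5⟩ := step hι hS hΛ Q hQ (fun i => ⋃ n ∈ B i, A n) hE
        (fun i => (fun _ => Set.univ, {0})) (htriv _) used
      refine ⟨(⋃ n ∈ B i, A n, (fun _ => Set.univ, {0}), i), h3, h4, h5,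
        fun _ _ => ⟨rfl, fun h => (h2 h).elim⟩, fun h => ?_⟩
      simp_all
  by_cases h2 : k = false ∧ VD A
  · obtain ⟨x, hx, hxA⟩ := exists_seq_in h2.2.2
    obtain ⟨i, h3, h4, h5⟩ := step hι hS hΛ Q hQ (fun i => x '' B i) (by
        intro i j hij
        rw [← Set.image_inter hx.injective]
        exact .fin ((hB2 i j hij).image x))
        (fun i => (fun _ => Set.univ, {0})) (htriv _) used
    refine ⟨(x '' B i, (fun _ => Set.univ, {0}), i), h3, h4, h5, fun h h' => (h1 ⟨h, h'⟩).elim, fun _ _ => ⟨?_, ?_, ?_⟩⟩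
    · exact (hB i).image hx.injective.injOn
    · have : Nontrivial ι := by
        rw [← Cardinal.one_lt_iff_nontrivial, hι]
        exact one_lt_aleph0.trans aleph0_lt_continuum
      obtain ⟨j, hj⟩ := exists_ne i
      refine (((hB j).sdiff (hB2 j i hj)).image (f := x) hx.injective.injOn).mono ?_
      rintro _ ⟨n, hn, rfl⟩
      refine ⟨h2.2.1 (Nat.zero_le n) (hxA n), ?_⟩
      rintro ⟨m, hm, hmn⟩
      have : m = n := hx.injective hmn
      subst this
      exact hn.2 ⟨hn.1, hm⟩
    · intro n
      refine ((Set.finite_Iio n).image x).subset ?_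
      rintro _ ⟨⟨m, hm, rfl⟩, hmn⟩
      refine ⟨m, ?_, rfl⟩
      by_contra h
      exact hmn (h2.2.1 (not_lt.1 h) (hxA m))
  · obtain ⟨i, h3, h4, h5⟩ := step hι hS hΛ Q hQ (fun i => ∅) (by
        intro i j hij
        exact .fin (by simp))
        (fun i => (fun _ => Set.univ, {0})) (htriv _) used
    exact ⟨(∅, (fun _ => Set.univ, {0}), i), h3, h4, h5, fun h h' => (h1 ⟨h, h'⟩).elim,
      fun h h' => (h2 ⟨h, h'⟩).elim⟩

def SS {ι : Type} [LT ι] (f : ι → Dat ι) (γ : ι) : Set (Set ℕ) := {x | ∃ β, ∃ _ : β < γ, x = (f β).1}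

lemma SS_mono {ι : Type} [LinearOrder ι] (f : ι → Dat ι) {γ δ : ι} (h : γ ≤ δ) : SS f γ ⊆ SS f δ := by
  rintro _ ⟨β, hβ, rfl⟩
  exact ⟨β, hβ.trans_le h, rfl⟩

lemma ins_SS_mono {ι : Type} [LinearOrder ι] (f : ι → Dat ι) {γ δ : ι} (h : γ ≤ δ) :
    insert (f γ).1 (SS f γ) ⊆ insert (f δ).1 (SS f δ) := by
  rcases h.eq_or_lt with rfl | h'
  · exact subset_rfl
  · rintro _ (rfl | hx)
    · exact Or.inr ⟨γ, h', rfl⟩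
    · exact Or.inr (SS_mono f h hx)

lemma gen_bounded {ι : Type} [LinearOrder ι] (f : ι → Dat ι) {γ : ι} {C : Set ℕ} (h : Gen (SS f γ) C)
    {β : ι} (hβ : β < γ) : ∃ δ < γ, β ≤ δ ∧ Gen (insert (f δ).1 (SS f δ)) C := by
  induction h with
  | fin h => exact ⟨β, hβ, le_rfl, .fin h⟩
  | base h =>
    obtain ⟨δ, hδ, rfl⟩ := h
    refine ⟨max β δ, max_lt hβ hδ, le_max_left _ _, ?_⟩
    exact (Gen.base (Set.mem_insert _ _)).mono (ins_SS_mono f (le_max_right β δ))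
  | compl _ ih =>
    obtain ⟨δ, h1, h2, h3⟩ := ih
    exact ⟨δ, h1, h2, h3.compl⟩
  | union _ _ ih1 ih2 =>
    obtain ⟨δ, h1, h2, h3⟩ := ih1
    obtain ⟨δ', h1', h2', h3'⟩ := ih2
    exact ⟨max δ δ', max_lt h1 h1', h2.trans (le_max_left _ _),
      (h3.mono (ins_SS_mono f (le_max_left _ _))).union (h3'.mono (ins_SS_mono f (le_max_right _ _)))⟩

lemma gen_range {ι : Type} [LinearOrder ι] [Nonempty ι] (f : ι → Dat ι) (hN : ∀ i : ι, ∃ j, i < j) {C : Set ℕ}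
    (h : Gen (Set.range fun γ => (f γ).1) C) : ∃ γ, Gen (SS f γ) C := by
  induction h with
  | fin h => exact ⟨Classical.arbitrary ι, .fin h⟩
  | base h =>
    obtain ⟨δ, rfl⟩ := h
    obtain ⟨γ, hγ⟩ := hN δ
    exact ⟨γ, .base ⟨δ, hγ, rfl⟩⟩
  | compl _ ih =>
    obtain ⟨δ, h1⟩ := ih
    exact ⟨δ, h1.compl⟩
  | union _ _ ih1 ih2 =>
    obtain ⟨δ, h3⟩ := ih1
    obtain ⟨δ', h3'⟩ := ih2
    exact ⟨max δ δ', (h3.mono (SS_mono f (le_max_left _ _))).union (h3'.mono (SS_mono f (le_max_right _ _)))⟩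

structure GoodAlg (𝒜 : Set ℕ → Prop) : Prop where
  fin : ∀ A : Set ℕ, A.Finite → 𝒜 A
  compl : ∀ A, 𝒜 A → 𝒜 Aᶜ
  union : ∀ A B, 𝒜 A → 𝒜 B → 𝒜 (A ∪ B)
  k2 : ∀ D : ℕ → Set ℕ, Antitone D → (∀ n, (D n).Infinite) →
    ∃ e, 𝒜 e ∧ e.Infinite ∧ (D 0 \ e).Infinite ∧ ∀ n, (e \ D n).Finite
  k1 : ∀ A : ℕ → Set ℕ, (∀ n, 𝒜 (A n)) → Pairwise (Function.onFun Disjoint A) →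
    ∃ W : Set (Set ℕ), ¬ W.Countable ∧ (∀ b ∈ W, b.Infinite) ∧
      (∀ b ∈ W, ∀ b' ∈ W, b ≠ b' → (b ∩ b').Finite) ∧ (∀ b ∈ W, 𝒜 (⋃ n ∈ b, A n)) ∧
      ∀ V : ℕ → Set ℕ, (∀ m, (V m).Infinite) → (∀ m n, (V m ∩ A n).Finite) →
        ¬ {b ∈ W | Kept 𝒜 (V, b)}.Countable

theorem exists_goodAlg : ∃ 𝒜, GoodAlg 𝒜 := by
  obtain ⟨ι, _, _, hι, hI, hbd⟩ := index_exists
  obtain ⟨B, hB, hB2⟩ := ad_exists hι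
  obtain ⟨req, hreq⟩ := req_exists hι hI
  have hne : Nonempty ι := by
    rw [← mk_ne_zero_iff, hι]; exact continuum_ne_zero
  obtain ⟨f, hf⟩ := rec_exists (ι := ι) (D := Dat ι) (fun γ F d =>
    (∀ β h, (F β h).2.2 ≠ d.2.2) ∧
    (∀ β h, Kept (Gen (insert d.1 {x | ∃ β, ∃ h : β < γ, x = (F β h).1})) (F β h).2.1) ∧
    Kept (Gen (insert d.1 {x | ∃ β, ∃ h : β < γ, x = (F β h).1})) d.2.1 ∧
    Spec B {x | ∃ β, ∃ h : β < γ, x = (F β h).1} (req γ) d)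
  have hcard : ∀ γ, #(SS f γ) < 𝔠 := by
    intro γ
    have : SS f γ ⊆ (fun β => (f β).1) '' Set.Iio γ := by
      rintro _ ⟨β, hβ, rfl⟩
      exact ⟨β, hβ, rfl⟩
    exact (mk_le_mk_of_subset this).trans_lt (mk_image_le.trans_lt (hI γ))
  have hinv' : ∀ γ, (∀ δ < γ, (∀ β < δ, Kept (Gen (insert (f δ).1 (SS f δ))) (f β).2.1) ∧
      Kept (Gen (insert (f δ).1 (SS f δ))) (f δ).2.1) → ∀ β < γ, Kept (Gen (SS f γ)) (f β).2.1 := by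
    rintro γ h β hβ ⟨C, hC, hC2⟩
    obtain ⟨δ, h1, h2, h3⟩ := gen_bounded f hC hβ
    rcases h2.eq_or_lt with rfl | h4
    · exact (h _ h1).2 ⟨C, h3, hC2⟩
    · exact (h _ h1).1 β h4 ⟨C, h3, hC2⟩
  have hall : ∀ γ, (∀ β < γ, (f β).2.2 ≠ (f γ).2.2) ∧
      (∀ β < γ, Kept (Gen (insert (f γ).1 (SS f γ))) (f β).2.1) ∧
      Kept (Gen (insert (f γ).1 (SS f γ))) (f γ).2.1 ∧ Spec B (SS f γ) (req γ) (f γ) := by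
    intro γ
    induction γ using (wellFounded_lt (α := ι)).induction with
    | _ γ ih =>
    apply hf γ
    have hQ := hinv' γ fun δ hδ => ⟨(ih δ hδ).2.1, (ih δ hδ).2.2.1⟩
    obtain ⟨d, h1, h2, h3, h4⟩ := stage hι hB hB2 (hcard γ) (hI γ) (fun β => (f β).2.1)
      (fun β => hQ β β.2) (fun β => (f β).2.2) (req γ)
    exact ⟨d, fun β h => h1 ⟨β, h⟩, fun β h => h2 ⟨β, h⟩, h3, h4⟩
  have hinv : ∀ γ, ∀ β < γ, Kept (Gen (SS f γ)) (f β).2.1 := fun γ =>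
    hinv' γ fun δ _ => ⟨(hall δ).2.1, (hall δ).2.2.1⟩
  have hN : ∀ i : ι, ∃ j, i < j := fun i => (hbd fun _ => i).imp fun j h => h 0
  have hkept : ∀ β, Kept (Gen (Set.range fun γ => (f γ).1)) (f β).2.1 := by
    rintro β ⟨C, hC, hC2⟩
    obtain ⟨γ, hγ⟩ := gen_range f hN hC
    obtain ⟨δ, hδ⟩ := hN (max β γ)
    exact hinv δ β ((le_max_left _ _).trans_lt hδ)
      ⟨C, hγ.mono (SS_mono f ((le_max_right _ _).trans hδ.le)), hC2⟩
  have hBinj : Function.Injective B := by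
    intro i j h
    by_contra hne
    have := hB2 i j hne
    rw [h, Set.inter_self] at this
    exact hB j this
  have hiinj : Function.Injective (fun γ => B (f γ).2.2) := by
    intro γ δ h
    have h' := hBinj h
    rcases lt_trichotomy γ δ with h1 | h1 | h1
    · exact ((hall δ).1 γ h1 h').elim
    · exact h1
    · exact ((hall γ).1 δ h1 h'.symm).elim
  refine ⟨Gen (Set.range fun γ => (f γ).1), fun A h => .fin h, fun A h => h.compl,
    fun A B hA hB => hA.union hB, ?_, ?_⟩
  · intro D hD hDi
    obtain ⟨γ, hγ⟩ : {γ | Classical.arbitrary ι ≤ γ ∧ req γ = (false, D, D)}.Nonempty := by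
      by_contra h
      rw [Set.not_nonempty_iff_eq_empty] at h
      exact hreq (false, D, D) (Classical.arbitrary ι) (h ▸ Set.countable_empty)
    have h1 := (hall γ).2.2.2.2
    rw [hγ.2] at h1
    exact ⟨(f γ).1, .base ⟨γ, rfl⟩, h1 rfl ⟨hD, hDi⟩⟩
  · intro A hA hAd
    have h1 := fun n => gen_range f hN (hA n)
    choose δ hδ using h1
    obtain ⟨γ₀, hγ₀⟩ := hbd δ
    have hVA : ∀ γ, γ₀ ≤ γ → VA (SS f γ) A := fun γ hγ =>
      ⟨fun n => (hδ n).mono (SS_mono f ((hγ₀ n).le.trans hγ)), hAd⟩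
    have hmem : ∀ V γ, γ₀ ≤ γ ∧ req γ = (true, A, V) → Gen (Set.range fun γ => (f γ).1) (⋃ n ∈ B (f γ).2.2, A n) ∧
        (VV A V → (f γ).2.1 = (V, B (f γ).2.2)) := by
      rintro V γ ⟨h1, h2⟩
      have h3 := (hall γ).2.2.2.1
      rw [h2] at h3
      have h4 := h3 rfl (hVA γ h1)
      refine ⟨?_, h4.2⟩
      change Gen _ (⋃ n ∈ B (f γ).2.2, (true, A, V).2.1 n)
      rw [← h4.1]
      exact .base ⟨γ, rfl⟩
    refine ⟨{b | b ∈ Set.range B ∧ Gen (Set.range fun γ => (f γ).1) (⋃ n ∈ b, A n)}, ?_, ?_, ?_, ?_, ?_⟩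
    · intro hc
      refine hreq (true, A, A) γ₀ ((hc.preimage_of_injOn (f := fun γ => B (f γ).2.2) hiinj.injOn).mono ?_)
      intro γ hγ
      exact ⟨⟨_, rfl⟩, (hmem _ γ hγ).1⟩
    · rintro _ ⟨⟨i, rfl⟩, _⟩
      exact hB i
    · rintro _ ⟨⟨i, rfl⟩, _⟩ _ ⟨⟨j, rfl⟩, _⟩ hne
      exact hB2 i j fun h => hne (h ▸ rfl)
    · rintro b ⟨_, h⟩
      exact h
    · intro V hV hVA' hc
      refine hreq (true, A, V) γ₀ ((hc.preimage_of_injOn (f := fun γ => B (f γ).2.2) hiinj.injOn).mono ?_)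
      intro γ hγ
      have h1 := hmem _ γ hγ
      refine ⟨⟨⟨_, rfl⟩, h1.1⟩, ?_⟩
      have h2 := hkept γ
      rwa [h1.2 (fun m => ⟨hV m, hVA' m⟩)] at h2

end I2
end FK


set_option linter.unusedSectionVars false
namespace FK
open TopologicalSpace Topology
section K1

abbrev QQ (G : Set ℕ → Prop) : Type := {A : Set ℕ // G A} → Bool

open Classical in
noncomputable def Phi (G : Set ℕ → Prop) (n : ℕ) : QQ G := fun A => decide (n ∈ A.1)

abbrev KK (G : Set ℕ → Prop) : Type := {z : QQ G // MapClusterPt z atTop (Phi G)}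

variable {G : Set ℕ → Prop}

lemma Phi_true {n : ℕ} {A : {A : Set ℕ // G A}} : Phi G n A = true ↔ n ∈ A.1 := by
  simp [Phi]

lemma KK_closed : IsClosed {z : QQ G | MapClusterPt z atTop (Phi G)} := by
  simp only [MapClusterPt]
  exact isClosed_setOfPred_clusterPt

instance : CompactSpace (KK G) := isCompact_iff_compactSpace.1 (KK_closed (G := G)).isCompact

lemma ev {P : Set (QQ G)} (hP : IsClosed P) (h : ∀ᶠ n in atTop, Phi G n ∈ P) (z : KK G) : z.1 ∈ P := by
  by_contra hz
  have h1 := (mapClusterPt_iff_frequently.1 z.2) Pᶜ (hP.isOpen_compl.mem_nhds hz)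
  exact h1 (h.mono fun n hn hn' => hn' hn)

lemma exK {P : Set (QQ G)} (hP : IsClosed P) (h : ∃ᶠ n in atTop, Phi G n ∈ P) : ∃ z : KK G, z.1 ∈ P := by
  obtain ⟨z, hz, h2⟩ := hP.isCompact.exists_mapClusterPt_of_frequently h
  exact ⟨⟨z, h2⟩, hz⟩

def cl (A : Set ℕ) (h : G A) : Clopens (KK G) :=
  ⟨{z | z.1 ⟨A, h⟩ = true}, by
    have : Continuous fun z : KK G => z.1 ⟨A, h⟩ := (continuous_apply _).comp continuous_subtype_val
    exact (isClopen_discrete {true}).preimage this⟩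

lemma mem_cl {A : Set ℕ} {h : G A} {z : KK G} : z ∈ cl A h ↔ z.1 ⟨A, h⟩ = true := Iff.rfl

lemma ev3 (R : Bool → Bool → Bool → Prop) (a b c : {A : Set ℕ // G A})
    (h : ∀ᶠ n in atTop, R (Phi G n a) (Phi G n b) (Phi G n c)) (z : KK G) : R (z.1 a) (z.1 b) (z.1 c) := by
  have : IsClosed ((fun z : QQ G => (z a, z b, z c)) ⁻¹' {p | R p.1 p.2.1 p.2.2}) :=
    (isClosed_discrete _).preimage
      ((continuous_apply a).prodMk ((continuous_apply b).prodMk (continuous_apply c)))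
  exact ev this h z

lemma notMem_ev {A : Set ℕ} (h : A.Finite) : ∀ᶠ n in atTop, n ∉ A := by
  rw [← Nat.cofinite_eq_atTop]; simpa [Filter.eventually_cofinite] using h

lemma cl_exists {A : Set ℕ} (h : G A) (hi : A.Infinite) : ∃ z, z ∈ cl A h := by
  have hc : IsClosed ((fun z : QQ G => z ⟨A, h⟩) ⁻¹' {true}) :=
    (isClosed_discrete _).preimage (continuous_apply _)
  obtain ⟨z, hz⟩ := exK hc (by
    have := Nat.frequently_atTop_iff_infinite.2 hi
    exact this.mono fun n hn => Phi_true.2 hn)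
  exact ⟨z, hz⟩

namespace GoodAlg

lemma inter (hG : GoodAlg G) {A B : Set ℕ} (hA : G A) (hB : G B) : G (A ∩ B) := by
  have := hG.compl _ (hG.union _ _ (hG.compl _ hA) (hG.compl _ hB))
  simpa [Set.compl_union] using this

lemma sdiff (hG : GoodAlg G) {A B : Set ℕ} (hA : G A) (hB : G B) : G (A \ B) := hG.inter hA (hG.compl _ hB)

end GoodAlg

lemma mem_cl_inter {A B : Set ℕ} (hA : G A) (hB : G B) (h : G (A ∩ B)) (z : KK G) :
    z ∈ cl _ h ↔ z ∈ cl _ hA ∧ z ∈ cl _ hB :=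
  ev3 (fun p q r => p = true ↔ (q = true ∧ r = true)) ⟨_, h⟩ ⟨_, hA⟩ ⟨_, hB⟩
    (Eventually.of_forall fun n => by simp [Phi_true]) z

lemma mem_cl_union {A B : Set ℕ} (hA : G A) (hB : G B) (h : G (A ∪ B)) (z : KK G) :
    z ∈ cl _ h ↔ z ∈ cl _ hA ∨ z ∈ cl _ hB :=
  ev3 (fun p q r => p = true ↔ (q = true ∨ r = true)) ⟨_, h⟩ ⟨_, hA⟩ ⟨_, hB⟩
    (Eventually.of_forall fun n => by simp [Phi_true]) z

lemma mem_cl_compl {A : Set ℕ} (hA : G A) (h : G Aᶜ) (z : KK G) :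
    z ∈ cl _ h ↔ z ∉ cl _ hA :=
  ev3 (fun p q _ => p = true ↔ ¬ (q = true)) ⟨_, h⟩ ⟨_, hA⟩ ⟨_, hA⟩
    (Eventually.of_forall fun n => by simp [Phi]) z

lemma mem_cl_sdiff {A B : Set ℕ} (hA : G A) (hB : G B) (h : G (A \ B)) (z : KK G) :
    z ∈ cl _ h ↔ z ∈ cl _ hA ∧ z ∉ cl _ hB :=
  ev3 (fun p q r => p = true ↔ (q = true ∧ ¬ r = true)) ⟨_, h⟩ ⟨_, hA⟩ ⟨_, hB⟩
    (Eventually.of_forall fun n => by simp [Phi]) z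

lemma cl_le_of {A B : Set ℕ} (hA : G A) (hB : G B) (h : (A \ B).Finite) : cl _ hA ≤ cl _ hB := by
  intro z
  exact ev3 (fun p q _ => p = true → q = true) ⟨_, hA⟩ ⟨_, hB⟩ ⟨_, hA⟩
    ((notMem_ev h).mono fun n hn => by
      simp only [Phi_true]; intro h1; by_contra h2; exact hn ⟨h1, h2⟩) z

lemma notMem_cl {A : Set ℕ} (hA : G A) (h : A.Finite) (z : KK G) : z ∉ cl _ hA :=
  ev3 (fun p _ _ => ¬ p = true) ⟨_, hA⟩ ⟨_, hA⟩ ⟨_, hA⟩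
    ((notMem_ev h).mono fun n hn => by rwa [Phi_true]) z

lemma cl_ne_bot {A : Set ℕ} (hA : G A) : cl _ hA ≠ ⊥ ↔ A.Infinite := by
  rw [ne_bot_iff]
  exact ⟨fun ⟨z, hz⟩ h => notMem_cl hA h z hz, cl_exists hA⟩

lemma cl_le {A B : Set ℕ} (hG : GoodAlg G) (hA : G A) (hB : G B) : cl _ hA ≤ cl _ hB ↔ (A \ B).Finite := by
  refine ⟨fun h => ?_, cl_le_of hA hB⟩
  by_contra hi
  obtain ⟨z, hz⟩ := cl_exists (hG.sdiff hA hB) hi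
  rw [mem_cl_sdiff hA hB] at hz
  exact hz.2 (h hz.1)

lemma cl_disj {A B : Set ℕ} (hG : GoodAlg G) (hA : G A) (hB : G B) :
    Disjoint (cl _ hA) (cl _ hB) ↔ (A ∩ B).Finite := by
  rw [disj_iff]
  constructor
  · intro h
    by_contra hi
    obtain ⟨z, hz⟩ := cl_exists (hG.inter hA hB) hi
    rw [mem_cl_inter hA hB] at hz
    exact h z hz.1 hz.2
  · intro h z h1 h2
    exact notMem_cl (hG.inter hA hB) h z ((mem_cl_inter hA hB _ z).2 ⟨h1, h2⟩)

lemma G_univ (hG : GoodAlg G) : G Set.univ := by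
  simpa using hG.compl _ (hG.fin ∅ Set.finite_empty)

lemma lift_basic (hG : GoodAlg G) (x : QQ G) (I : Finset {A : Set ℕ // G A}) :
    ∃ (A : Set ℕ) (h : G A), ∀ z : KK G, z ∈ cl A h ↔ ∀ i ∈ I, z.1 i = x i := by
  classical
  induction I using Finset.induction_on with
  | empty =>
    refine ⟨Set.univ, G_univ hG, fun z => ?_⟩
    simp only [Finset.notMem_empty, false_imp_iff, implies_true, iff_true]
    exact ev3 (fun p _ _ => p = true) ⟨_, G_univ hG⟩ ⟨_, G_univ hG⟩ ⟨_, G_univ hG⟩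
      (Eventually.of_forall fun n => by simp [Phi_true]) z
  | insert i I hi ih =>
    obtain ⟨A, hA, h⟩ := ih
    by_cases hx : x i = true
    · refine ⟨i.1 ∩ A, hG.inter i.2 hA, fun z => ?_⟩
      rw [mem_cl_inter i.2 hA, h, Finset.forall_mem_insert, hx]; rfl
    · refine ⟨i.1ᶜ ∩ A, hG.inter (hG.compl _ i.2) hA, fun z => ?_⟩
      rw [mem_cl_inter (hG.compl _ i.2) hA, h, Finset.forall_mem_insert, mem_cl_compl i.2, mem_cl]
      simp only [Bool.not_eq_true] at hx
      simp [hx]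

lemma lift_cl (hG : GoodAlg G) (U : Clopens (KK G)) : ∃ (A : Set ℕ) (h : G A), cl A h = U := by
  classical
  have h1 : ∀ x : KK G, x ∈ U → ∃ (A : Set ℕ) (h : G A), x ∈ cl A h ∧ cl A h ≤ U := by
    intro x hx
    obtain ⟨O, hO, hOU⟩ := isOpen_induced_iff.1 U.isClopen.isOpen
    have hxO : x.1 ∈ O := by
      have : x ∈ Subtype.val ⁻¹' O := by rw [hOU]; exact hx
      exact this
    obtain ⟨I, u, hu, hs⟩ := isOpen_pi_iff.1 hO x.1 hxO
    obtain ⟨A, hA, h⟩ := lift_basic hG x.1 I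
    refine ⟨A, hA, (h x).2 fun _ _ => rfl, fun z hz => ?_⟩
    have hz' := (h z).1 hz
    have : z.1 ∈ O := hs fun i hi => by rw [hz' i hi]; exact (hu i hi).2
    have h3 : z ∈ (Subtype.val ⁻¹' O : Set (KK G)) := this
    rw [hOU] at h3; exact h3
  choose! A hA hx hle using h1
  have hc : IsCompact (U : Set (KK G)) := U.isClopen.isClosed.isCompact
  obtain ⟨t, hcov⟩ := hc.elim_nhds_subcover' (fun x hx => ((cl (A x) (hA x hx)) : Set (KK G)))
    (fun x hx' => (cl (A x) (hA x hx')).isClopen.isOpen.mem_nhds (hx x hx'))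
  have key : ∀ t : Finset (U : Set (KK G)), ∃ (B : Set ℕ) (hB : G B),
      ∀ z, z ∈ cl B hB ↔ ∃ x ∈ t, z ∈ cl (A x.1) (hA x.1 x.2) := by
    intro t
    induction t using Finset.induction_on with
    | empty =>
      refine ⟨∅, hG.fin ∅ Set.finite_empty, fun z => ?_⟩
      have := notMem_cl (hG.fin ∅ Set.finite_empty) Set.finite_empty z
      simp [this]
    | insert i I hi ih =>
      obtain ⟨B, hB, h⟩ := ih
      refine ⟨A i.1 ∪ B, hG.union _ _ (hA i.1 i.2) hB, fun z => ?_⟩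
      rw [mem_cl_union (hA i.1 i.2) hB, h, Finset.exists_mem_insert]
  obtain ⟨B, hB, h⟩ := key t
  refine ⟨B, hB, ?_⟩
  ext z
  change z ∈ cl B hB ↔ z ∈ U
  rw [h]
  constructor
  · rintro ⟨x, _, hz⟩
    exact hle x.1 x.2 hz
  · intro hz
    have := hcov hz
    simp only [Set.mem_iUnion] at this
    obtain ⟨x, hxt, hz⟩ := this
    exact ⟨x, hxt, hz⟩

lemma GoodAlg.finInter (hG : GoodAlg G) (D : ℕ → Set ℕ) (hD : ∀ n, G (D n)) (n : ℕ) :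
    ∃ h : G (⋂ k ∈ Finset.range (n+1), D k), ∀ z, z ∈ cl _ h ↔ ∀ k < n + 1, z ∈ cl _ (hD k) := by
  induction n with
  | zero => simp [hD]
  | succ n ih =>
    obtain ⟨h, hz⟩ := ih
    have e : (⋂ k ∈ Finset.range (n+1+1), D k) = D (n+1) ∩ ⋂ k ∈ Finset.range (n+1), D k := by
      rw [Finset.range_add_one, Finset.set_biInter_insert]
    have h' : G (⋂ k ∈ Finset.range (n+1+1), D k) := by
      rw [e]; exact hG.inter (hD _) h
    refine ⟨h', fun z => ?_⟩
    have : cl _ h' = cl _ (hG.inter (hD (n+1)) h) := by congr 1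
    rw [this, mem_cl_inter (hD _) h, hz]
    constructor
    · rintro ⟨h1, h2⟩ k hk
      rcases Nat.lt_succ_iff_lt_or_eq.1 hk with h | rfl
      · exact h2 k h
      · exact h1
    · intro h
      exact ⟨h _ (by omega), fun k hk => h k (by omega)⟩

lemma GoodAlg.finUnion (hG : GoodAlg G) (D : ℕ → Set ℕ) (hD : ∀ n, G (D n)) (n : ℕ) :
    ∃ h : G (⋃ k ∈ Finset.range n, D k), ∀ z, z ∈ cl _ h ↔ ∃ k < n, z ∈ cl _ (hD k) := by
  induction n with
  | zero =>
    have h : G (⋃ k ∈ Finset.range 0, D k) := by simpa using hG.fin ∅ Set.finite_empty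
    refine ⟨h, fun z => ?_⟩
    have := notMem_cl h (by simp) z
    simp only [this]
    simp
  | succ n ih =>
    obtain ⟨h, hz⟩ := ih
    have e : (⋃ k ∈ Finset.range (n+1), D k) = D n ∪ ⋃ k ∈ Finset.range n, D k := by
      rw [Finset.range_add_one, Finset.set_biUnion_insert]
    have h' : G (⋃ k ∈ Finset.range (n+1), D k) := by
      rw [e]; exact hG.union _ _ (hD _) h
    refine ⟨h', fun z => ?_⟩
    have : cl _ h' = cl _ (hG.union _ _ (hD n) h) := by congr 1
    rw [this, mem_cl_union (hD _) h, hz]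
    constructor
    · rintro (h1 | ⟨k, hk, h2⟩)
      · exact ⟨n, by omega, h1⟩
      · exact ⟨k, by omega, h2⟩
    · rintro ⟨k, hk, h3⟩
      rcases Nat.lt_succ_iff_lt_or_eq.1 hk with h1 | rfl
      · exact Or.inr ⟨k, h1, h3⟩
      · exact Or.inl h3

lemma good_KK (hG : GoodAlg G) : Good (KK G) where
  p1 := by
    intro d hd hne
    choose D hD hDd using fun n => lift_cl hG (d n)
    choose hI hIm using hG.finInter D hD
    have e1 : ∀ n, cl _ (hI n) = d n := by
      intro n
      ext z
      change z ∈ cl _ (hI n) ↔ z ∈ d n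
      rw [hIm]
      simp only [hDd]
      exact ⟨fun h => h n (by omega), fun h k hk => hd (by omega : k ≤ n) h⟩
    obtain ⟨e, he, hei, -, hen⟩ := hG.k2 (fun n => ⋂ k ∈ Finset.range (n+1), D k) (by
      intro m n hmn x hx
      simp only [Finset.mem_range, Set.mem_iInter] at hx ⊢
      exact fun k hk => hx k (by omega)) (fun n => by
        rw [← cl_ne_bot (hI n), e1]; exact hne n)
    refine ⟨cl e he, (cl_ne_bot he).2 hei, fun n => ?_⟩
    rw [← e1]
    exact cl_le_of _ _ (hen n)
  perf := by
    intro c hc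
    obtain ⟨D, hD, rfl⟩ := lift_cl hG c
    have hDi := (cl_ne_bot hD).1 hc
    obtain ⟨e, he, hei, h1, hen⟩ := hG.k2 (fun _ => D) (fun _ _ _ => le_rfl) (fun _ => hDi)
    refine ⟨cl e he, (cl_ne_bot he).2 hei, lt_of_le_not_ge (cl_le_of _ _ (hen 0)) ?_⟩
    rw [cl_le hG]
    exact h1
  p2 := by
    classical
    intro a ha
    choose A0 hA0 hA0a using fun n => lift_cl hG (a n)
    choose hU hUm using hG.finUnion A0 hA0
    set A : ℕ → Set ℕ := fun n => A0 n \ ⋃ k ∈ Finset.range n, A0 k with hAdef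
    have hA : ∀ n, G (A n) := fun n => hG.sdiff (hA0 n) (hU n)
    have hAa : ∀ n, cl _ (hA n) = a n := by
      intro n
      ext z
      change z ∈ cl _ (hA n) ↔ z ∈ a n
      rw [mem_cl_sdiff (hA0 n) (hU n), hUm]
      simp only [hA0a]
      refine ⟨fun h => h.1, fun h => ⟨h, ?_⟩⟩
      rintro ⟨k, hk, h2⟩
      exact disj_iff.1 (ha hk.ne) z h2 h
    have hAd : Pairwise (Function.onFun Disjoint A) := by
      have : ∀ m n, m < n → Disjoint (A m) (A n) := by
        intro m n hmn
        rw [Set.disjoint_left]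
        intro x hx hx'
        apply hx'.2
        simp only [Set.mem_iUnion, Finset.mem_range]
        exact ⟨m, hmn, hx.1⟩
      intro m n hmn
      rcases lt_or_gt_of_ne hmn with h | h
      · exact this _ _ h
      · exact (this _ _ h).symm
    obtain ⟨W, hWc, hWi, hWd, hWG, hWV⟩ := hG.k1 A hA hAd
    refine ⟨W, fun b => if h : G (⋃ n ∈ b, A n) then cl _ h else ⊥, hWc, hWi, ?_, ?_, ?_⟩
    · intro b hb n
      simp only [dif_pos (hWG b hb)]
      rw [← hAa n]
      constructor
      · intro hn
        apply cl_le_of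
        have : A n \ ⋃ n ∈ b, A n = ∅ := Set.sdiff_eq_empty.2 (Set.subset_biUnion_of_mem (u := A) hn)
        rw [this]; exact Set.finite_empty
      · intro hn
        rw [cl_disj hG]
        have : A n ∩ ⋃ n ∈ b, A n = ∅ := by
          rw [← Set.disjoint_iff_inter_eq_empty, Set.disjoint_iUnion₂_right]
          intro m hm
          exact hAd (fun h => hn (h ▸ hm))
        rw [this]; exact Set.finite_empty
    · intro b hb b' hb' hne
      simp only [dif_pos (hWG b hb), dif_pos (hWG b' hb')]
      obtain ⟨N, hN⟩ := (hWd b hb b' hb' hne).bddAbove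
      refine ⟨N + 1, fun z hz => ?_⟩
      have h1 := (mem_cl_inter (hWG b hb) (hWG b' hb') (hG.inter (hWG b hb) (hWG b' hb')) z).2 hz
      obtain ⟨hF, hFm⟩ := hG.finUnion A hA (N+1)
      have h2 := cl_le_of (hG.inter (hWG b hb) (hWG b' hb')) hF (by
        rw [inter_biUnion hAd, Set.sdiff_eq_empty.2]
        · exact Set.finite_empty
        · intro x hx
          simp only [Set.mem_iUnion, Finset.mem_range] at hx ⊢
          obtain ⟨n, hn, hx⟩ := hx
          exact ⟨n, Nat.lt_succ_of_le (hN hn), hx⟩) h1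
      obtain ⟨k, hk, h3⟩ := (hFm z).1 h2
      exact mem_fsup.2 ⟨k, Finset.mem_range.2 hk, hAa k ▸ h3⟩
    · intro v hv hva
      choose V hV hVv using fun n => lift_cl hG (v n)
      have h := hWV V (fun m => (cl_ne_bot (hV m)).1 (by rw [hVv]; exact hv m)) (fun m n => by
        rw [← cl_disj hG (hV m) (hA n), hVv, hAa]; exact hva m n)
      refine fun hc => h (hc.mono ?_)
      rintro b ⟨hb, hk⟩
      refine ⟨hb, ?_⟩
      rintro ⟨c, hc1, hc2⟩
      obtain ⟨C, hC, rfl⟩ := lift_cl hG c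
      apply hk
      refine ⟨C, hC, fun m hm => ?_, fun m hm => ?_⟩
      · rw [← cl_le hG (hV m) hC, hVv]; exact hc1 m hm
      · rw [← cl_disj hG (hV m) hC, hVv]; exact hc2 m hm
end K1
end FK


set_option linter.unusedSectionVars false
namespace FK
open TopologicalSpace Topology
section K2
variable {G : Set ℕ → Prop}

noncomputable def rest : C(QQ G, ℝ) →ₗ[ℝ] C(KK G, ℝ) where
  toFun F := F.comp ⟨Subtype.val, continuous_subtype_val⟩
  map_add' _ _ := rfl
  map_smul' _ _ := rfl

lemma rest_apply (F : C(QQ G, ℝ)) (z : KK G) : rest F z = F z.1 := rfl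

lemma rest_surj (f : C(KK G, ℝ)) : ∃ F : C(QQ G, ℝ), rest F = f :=
  ContinuousMap.exists_extension (e := (Subtype.val : KK G → QQ G)) (KK_closed (G := G)).isClosedEmbedding_subtypeVal f

noncomputable def smp : C(QQ G, ℝ) →ₗ[ℝ] ellInfty where
  toFun F := ⟨fun n => F (Phi G n), memℓp_infty ⟨‖F‖, by
    rintro _ ⟨n, rfl⟩
    exact F.norm_coe_le_norm _⟩⟩
  map_add' _ _ := rfl
  map_smul' _ _ := rfl

lemma smp_apply (F : C(QQ G, ℝ)) (n : ℕ) : (smp F : ellInfty) n = F (Phi G n) := rfl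

lemma mem_cZero {x : ellInfty} : x ∈ cZero ↔ Tendsto (fun n => x n) atTop (𝓝 0) := Iff.rfl

lemma cZero_closed : IsClosed (cZero : Set ellInfty) := by
  rw [← closure_subset_iff_isClosed]
  intro x hx
  change Tendsto (fun n => x n) atTop (𝓝 0)
  rw [Metric.tendsto_atTop]
  intro ε hε
  obtain ⟨y, hy, hxy⟩ := Metric.mem_closure_iff.1 hx (ε/2) (by positivity)
  have hy' : Tendsto (fun n => y n) atTop (𝓝 0) := hy
  rw [Metric.tendsto_atTop] at hy'
  obtain ⟨N, hN⟩ := hy' (ε/2) (by positivity)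
  refine ⟨N, fun n hn => ?_⟩
  have h1 := hN n hn
  have h2 : ‖(x - y) n‖ ≤ ‖x - y‖ := lp.norm_apply_le_norm (by simp) _ n
  rw [dist_eq_norm] at hxy
  simp only [lp.coeFn_sub, Pi.sub_apply, Real.norm_eq_abs] at h2
  simp only [Real.dist_eq, sub_zero] at h1 ⊢
  have := abs_sub_abs_le_abs_sub (x n) (y n)
  linarith

lemma norm_le_rest (F : C(QQ G, ℝ)) : ‖(Submodule.Quotient.mk (smp F) : ellInfty ⧸ cZero)‖ ≤ ‖rest F‖ := by
  classical
  apply le_of_forall_pos_le_add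
  intro ε hε
  have h1 : ∀ᶠ n in atTop, |F (Phi G n)| < ‖rest F‖ + ε := by
    by_contra hc
    rw [not_eventually] at hc
    obtain ⟨z, hz⟩ := exK (G := G) (P := {q | ‖rest F‖ + ε ≤ |F q|})
      (isClosed_le continuous_const (F.continuous.abs)) (hc.mono fun n hn => not_lt.1 hn)
    have hz' : ‖rest F‖ + ε ≤ |F z.1| := hz
    have := (rest F).norm_coe_le_norm z
    rw [rest_apply, Real.norm_eq_abs] at this
    linarith
  obtain ⟨N, hN⟩ := eventually_atTop.1 h1
  have hM : ∀ n, |if N ≤ n then F (Phi G n) else 0| ≤ ‖rest F‖ + ε := by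
    intro n
    split_ifs with h
    · exact (hN n h).le
    · simp; positivity
  let y : ellInfty := ⟨fun n => if N ≤ n then F (Phi G n) else 0, memℓp_infty ⟨‖rest F‖ + ε, by
    rintro _ ⟨n, rfl⟩
    exact hM n⟩⟩
  have hy : (Submodule.Quotient.mk (smp F) : ellInfty ⧸ cZero) = Submodule.Quotient.mk y := by
    rw [Submodule.Quotient.eq, mem_cZero]
    apply tendsto_const_nhds.congr'
    filter_upwards [eventually_ge_atTop N] with n hn
    have : y n = F (Phi G n) := if_pos hn
    simp [lp.coeFn_sub, smp_apply, this]
  rw [hy]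
  refine (Submodule.Quotient.norm_mk_le cZero y).trans ?_
  exact lp.norm_le_of_forall_le (by positivity) hM

lemma rest_le_norm (F : C(QQ G, ℝ)) : ‖rest F‖ ≤ ‖(Submodule.Quotient.mk (smp F) : ellInfty ⧸ cZero)‖ := by
  rw [ContinuousMap.norm_le _ (norm_nonneg _)]
  intro z
  apply le_of_forall_pos_le_add
  intro ε hε
  obtain ⟨y, hy, hlt⟩ := Submodule.Quotient.norm_mk_lt (Submodule.Quotient.mk (smp F) : ellInfty ⧸ cZero) (half_pos hε)
  rw [Submodule.Quotient.eq, mem_cZero, Metric.tendsto_atTop] at hy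
  obtain ⟨N, hN⟩ := hy (ε/2) (half_pos hε)
  have : z.1 ∈ {q : QQ G | |F q| ≤ ‖(Submodule.Quotient.mk (smp F) : ellInfty ⧸ cZero)‖ + ε} := by
    apply ev (isClosed_le F.continuous.abs continuous_const)
    filter_upwards [eventually_ge_atTop N] with n hn
    have h1 := hN n hn
    have h2 : ‖y n‖ ≤ ‖y‖ := lp.norm_apply_le_norm (by simp) _ n
    simp only [Real.dist_eq, sub_zero, lp.coeFn_sub, Pi.sub_apply, smp_apply, Real.norm_eq_abs] at h1 h2
    rw [abs_sub_comm] at h1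
    have := abs_sub_abs_le_abs_sub (F (Phi G n)) (y n)
    change |F (Phi G n)| ≤ _
    linarith
  exact this

noncomputable def Rm : C(QQ G, ℝ) →ₗ[ℝ] (ellInfty ⧸ cZero) := cZero.mkQ ∘ₗ smp

lemma Rm_norm (F : C(QQ G, ℝ)) : ‖Rm F‖ = ‖rest F‖ := le_antisymm (norm_le_rest F) (rest_le_norm F)

lemma Rm_eq {F F' : C(QQ G, ℝ)} (h : rest F = rest F') : Rm F = Rm F' := by
  haveI : IsClosed (cZero : Set ellInfty) := cZero_closed
  have h1 : ‖Rm (F - F')‖ = 0 := by rw [Rm_norm, map_sub, h, sub_self, norm_zero]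
  rw [map_sub] at h1
  exact sub_eq_zero.1 (norm_eq_zero.1 h1)

noncomputable def JJ : C(KK G, ℝ) →ₗᵢ[ℝ] (ellInfty ⧸ cZero) where
  toFun f := Rm (rest_surj f).choose
  map_add' f g := by
    rw [← map_add]
    apply Rm_eq
    rw [map_add, (rest_surj (f + g)).choose_spec, (rest_surj f).choose_spec, (rest_surj g).choose_spec]
  map_smul' c f := by
    rw [← map_smul]
    apply Rm_eq
    rw [map_smul, (rest_surj (c • f)).choose_spec, (rest_surj f).choose_spec, RingHom.id_apply]
  norm_map' f := by
    change ‖Rm (rest_surj f).choose‖ = _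
    rw [Rm_norm, (rest_surj f).choose_spec]

lemma not_fd (hG : GoodAlg G) : ¬ FiniteDimensional ℝ C(KK G, ℝ) := by
  intro hfd
  have hgood := good_KK hG
  have hne : (⊤ : Clopens (KK G)) ≠ ⊥ := by
    obtain ⟨z, -⟩ := cl_exists (G_univ hG) Set.infinite_univ
    exact ne_bot_iff.2 ⟨z, trivial⟩
  choose! g hg hlt using hgood.perf
  let c : ℕ → Clopens (KK G) := fun n => g^[n] ⊤
  have hc : ∀ n, c n ≠ ⊥ := by
    intro n
    induction n with
    | zero => exact hne
    | succ n ih => simp only [c, Function.iterate_succ_apply']; exact hg _ ih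
  have hanti : StrictAnti c := strictAnti_nat_of_succ_lt fun n => by
    simp only [c, Function.iterate_succ_apply']; exact hlt _ (hc n)
  have hx : ∀ n, ∃ x, x ∈ c n ∧ x ∉ c (n+1) := by
    intro n
    have := (hanti (Nat.lt_succ_self n)).not_ge
    rw [le_iff] at this
    push Not at this
    exact this
  choose x hx1 hx2 using hx
  have hli : LinearIndependent ℝ (fun n => ind (c n)) := by
    rw [linearIndependent_iff']
    intro s w hs i
    induction i using Nat.strong_induction_on with
    | _ i ih =>
      intro hi
      have h1 := congrArg (fun f : C(KK G, ℝ) => f (x i)) hs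
      simp only [ContinuousMap.coe_sum, Finset.sum_apply, ContinuousMap.coe_smul, Pi.smul_apply,
        smul_eq_mul, ContinuousMap.coe_zero, Pi.zero_apply] at h1
      rw [Finset.sum_eq_single i] at h1
      · rwa [ind_of_mem (hx1 i), mul_one] at h1
      · intro j hj hji
        rcases lt_or_gt_of_ne hji with h | h
        · rw [ih j h hj, zero_mul]
        · rw [ind_of_not, mul_zero]
          exact fun hm => hx2 i (hanti.antitone (Nat.succ_le_of_lt h) hm)
      · exact fun h => (h hi).elim
  exact absurd hli.finite (by simpa using (inferInstance : Infinite ℕ))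

theorem final : ∃ X : Submodule ℝ (ellInfty ⧸ cZero),
      IsClosed (X : Set (ellInfty ⧸ cZero)) ∧
      ¬ FiniteDimensional ℝ X ∧
      (∃ (K : Type) (_ : TopologicalSpace K) (_ : CompactSpace K) (_ : T2Space K),
        Nonempty (C(K, ℝ) ≃ₗᵢ[ℝ] X)) ∧
      ∀ T : X →L[ℝ] X, Function.Injective T → Function.Surjective T := by
  obtain ⟨G, hG⟩ := exists_goodAlg
  haveI : IsClosed (cZero : Set ellInfty) := cZero_closed
  let J : C(KK G, ℝ) →ₗᵢ[ℝ] (ellInfty ⧸ cZero) := JJ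
  let e : C(KK G, ℝ) ≃ₗᵢ[ℝ] (LinearMap.range J.toLinearMap) := J.equivRange
  refine ⟨LinearMap.range J.toLinearMap, ?_, ?_, ⟨KK G, inferInstance, inferInstance, inferInstance, ⟨e⟩⟩, ?_⟩
  · have : ((LinearMap.range J.toLinearMap : Submodule ℝ _) : Set (ellInfty ⧸ cZero)) = Set.range J := by
      ext; simp
    rw [this]
    exact J.isometry.isClosedEmbedding.isClosed_range
  · intro h
    exact not_fd hG (Module.Finite.equiv e.symm.toLinearEquiv)
  · intro T hT
    let T' : C(KK G, ℝ) →L[ℝ] C(KK G, ℝ) :=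
      (e.symm.toContinuousLinearEquiv : _ →L[ℝ] C(KK G, ℝ)).comp
        (T.comp (e.toContinuousLinearEquiv : C(KK G, ℝ) →L[ℝ] _))
    have hT' : ∀ f, T' f = e.symm (T (e f)) := fun _ => rfl
    have hs := (good_KK hG).main T' (fun f g h => by
      rw [hT', hT'] at h
      exact e.injective (hT (e.symm.injective h)))
    intro y
    obtain ⟨f, hf⟩ := hs (e.symm y)
    rw [hT'] at hf
    exact ⟨e f, e.symm.injective hf⟩
end K2
end FK

/-- There is a closed infinite-dimensional subspace `X` of `ℓ∞/c₀` which is isometrically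
isomorphic to a `C(K)` space, `K` compact Hausdorff, and on which every injective bounded
linear operator is surjective. -/
theorem exists_subspace_of_ellInfty_mod_cZero_injective_implies_surjective :
    ∃ X : Submodule ℝ (ellInfty ⧸ cZero),
      IsClosed (X : Set (ellInfty ⧸ cZero)) ∧
      ¬ FiniteDimensional ℝ X ∧
      (∃ (K : Type) (_ : TopologicalSpace K) (_ : CompactSpace K) (_ : T2Space K),
        Nonempty (C(K, ℝ) ≃ₗᵢ[ℝ] X)) ∧
      ∀ T : X →L[ℝ] X, Function.Injective T → Function.Surjective T := by
  exact FK.final
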